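/- Let q be a prime power. For every real number u with |u| < 1/q, the series ∑_{n=0}^∞ NU_n u^n / |GU(n,q)| converges, the family of factors (1 + (-1)^l u^i q^{-l})^{-1} indexed by pairs (i,l) with i ≥ 1 and l ≥ 1 is multipliable in ℝ, and ∑_{n=0}^∞ NU_n u^n / |GU(n,q)| = ∏_{i ≥ 1} ∏_{l ≥ 1} (1 + (-1)^l u^i q^{-l})^{-1}. -/

import Mathlib

open Matrix

/-- `|GU(n,q)| = q^{n(n-1)/2} ∏_{i=1}^n (q^i - (-1)^i)`, as a real number. -/
noncomputable def guOrder (q n : ℕ) : ℝ :=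
  (q : ℝ) ^ (n * (n - 1) / 2) *
    ∏ i ∈ Finset.range n, ((q : ℝ) ^ (i + 1) - (-1 : ℝ) ^ (i + 1))

/-- `NU_n`: the number of ordered pairs of commuting nilpotent elements of the Lie algebra
`gu(n,q) = {A : A* = -A}` of skew-Hermitian `n × n` matrices over the field `K` with `q²`
elements, where `A*` is the conjugate-transpose `(A.map (·^q))ᵀ`. -/
noncomputable def guNilCommPairs (q : ℕ) (K : Type) [Field K] [Fintype K] (n : ℕ) : ℕ :=
  Nat.card {P : Matrix (Fin n) (Fin n) K × Matrix (Fin n) (Fin n) K //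
    (P.1.map (fun a => a ^ q))ᵀ = -P.1 ∧ (P.2.map (fun a => a ^ q))ᵀ = -P.2 ∧
    IsNilpotent P.1 ∧ IsNilpotent P.2 ∧ P.1 * P.2 = P.2 * P.1}

set_option linter.all false

namespace FF

section basics
variable {K : Type} [Field K] [Fintype K] [StarRing K]

lemma card_mat (n m : Type) [Fintype n] [Fintype m] :
    Nat.card (Matrix n m K) = Fintype.card K ^ (Fintype.card n * Fintype.card m) := by
  classical
  have : Nat.card (Matrix n m K) = Nat.card (n → m → K) := rfl
  rw [this, Nat.card_pi, Finset.prod_const, Nat.card_pi, Finset.prod_const, ← pow_mul,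
    Finset.card_univ, Finset.card_univ, mul_comm, Nat.card_eq_fintype_card]

variable {q : ℕ}

lemma two_le_q (hK : Fintype.card K = q ^ 2) : 2 ≤ q := by
  have := Fintype.one_lt_card (α := K)
  by_contra h
  interval_cases q <;> simp_all

lemma exists_nonfixed (hK : Fintype.card K = q ^ 2) (hs : ∀ a : K, star a = a ^ q) :
    ∃ a : K, star a ≠ a := by
  classical
  by_contra! h
  have h2 := two_le_q hK
  have hne : (Polynomial.X ^ q - Polynomial.X : Polynomial K) ≠ 0 :=
    FiniteField.X_pow_card_sub_X_ne_zero K h2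
  have h1 : (Finset.univ : Finset K).card ≤ (Polynomial.X ^ q - Polynomial.X : Polynomial K).natDegree := by
    apply Polynomial.card_le_degree_of_subset_roots
    intro a _
    rw [Polynomial.mem_roots hne]
    simp [← hs, h]
  rw [FiniteField.X_pow_card_sub_X_natDegree_eq K h2, Finset.card_univ, hK] at h1
  nlinarith

/-- Hermitian matrices. -/
abbrev Herm (K : Type) [Field K] [StarRing K] (n : Type) : Type :=
  {S : Matrix n n K // S.IsHermitian}

/-- Invertible Hermitian matrices. -/
abbrev HInv (K : Type) [Field K] [StarRing K] (n : Type) [Fintype n] [DecidableEq n] : Type :=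
  {S : Matrix n n K // S.IsHermitian ∧ IsUnit S}

lemma card_herm (hK : Fintype.card K = q ^ 2) (hs : ∀ a : K, star a = a ^ q)
    (n : Type) [Fintype n] :
    Nat.card (Herm K n) = q ^ (Fintype.card n ^ 2) := by
  obtain ⟨a, ha⟩ := exists_nonfixed hK hs
  have ha' : a - star a ≠ 0 := sub_ne_zero.mpr (Ne.symm ha)
  have hss : star (a - star a) = - (a - star a) := by simp
  let e : Herm K n × Herm K n ≃ Matrix n n K :=
    { toFun := fun p => p.1.1 + a • p.2.1
      invFun := fun M => 
        (⟨M - a • ((a - star a)⁻¹ • (M - Mᴴ)), by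
          unfold IsHermitian
          ext i j
          simp only [conjTranspose_apply, Matrix.sub_apply, Matrix.smul_apply, star_sub, smul_eq_mul, star_mul', star_inv₀, star_star]
          have : star a - a ≠ 0 := sub_ne_zero.mpr ha
          field_simp
          ring⟩, 
         ⟨(a - star a)⁻¹ • (M - Mᴴ), by
          unfold IsHermitian
          ext i j
          simp only [conjTranspose_apply, Matrix.sub_apply, Matrix.smul_apply, star_sub, smul_eq_mul, star_mul', star_inv₀, star_star]
          have : star a - a ≠ 0 := sub_ne_zero.mpr ha
          field_simp
          ring⟩)
      left_inv := by
        rintro ⟨⟨S, hS⟩, ⟨T, hT⟩⟩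
        have h2 : (a - star a)⁻¹ • (S + a • T - (S + a • T)ᴴ) = T := by
          rw [conjTranspose_add, conjTranspose_smul, hS.eq, hT.eq, add_sub_add_left_eq_sub, ← sub_smul,
            smul_smul, inv_mul_cancel₀ ha', one_smul]
        ext1
        · ext1
          simp only [h2]
          simp
        · ext1
          simp only [h2]
      right_inv := by
        intro M
        simp }
  have h := Nat.card_congr e
  rw [Nat.card_prod, card_mat, hK, ← pow_mul, mul_comm 2, pow_mul, ← sq] at h
  have := Nat.pow_left_injective (n := 2) (by norm_num) h
  rw [this, sq]

lemma card_fixed (hK : Fintype.card K = q ^ 2) (hs : ∀ a : K, star a = a ^ q) :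
    Nat.card {a : K // star a = a} = q := by
  have h := card_herm hK hs Unit
  simp only [Fintype.card_unit, one_pow, pow_one] at h
  rw [← h]
  refine Nat.card_congr 
    { toFun := fun a => ⟨Matrix.of fun _ _ => a.1, by ext; simpa using a.2⟩
      invFun := fun S => ⟨S.1 () (), by simpa using S.2.apply () ()⟩
      left_inv := fun a => rfl
      right_inv := fun S => rfl }

lemma norm_surj_card (hK : Fintype.card K = q ^ 2) (hs : ∀ a : K, star a = a ^ q)
    (c : K) (hc : star c = c) (hc0 : c ≠ 0) :
    Nat.card {a : K // star a * a = c} = q + 1 := by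
  classical
  have h2 := two_le_q hK
  -- upper bound for each fibre
  have hub : ∀ c : K, Nat.card {a : K // star a * a = c} ≤ q + 1 := by
    intro c
    have hne : (Polynomial.X ^ (q+1) - Polynomial.C c : Polynomial K) ≠ 0 :=
      Polynomial.X_pow_sub_C_ne_zero (by omega) c
    have h1 : (Finset.univ.filter fun a : K => star a * a = c).card ≤
        (Polynomial.X ^ (q+1) - Polynomial.C c : Polynomial K).natDegree := by
      apply Polynomial.card_le_degree_of_subset_roots
      intro a ha
      rw [Polynomial.mem_roots hne]
      simp [hs, ← pow_succ] at ha
      simp [ha]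
    rw [Polynomial.natDegree_X_pow_sub_C] at h1
    rw [Nat.card_eq_fintype_card, Fintype.card_subtype]
    exact h1
  -- sum
  let F := {c : K // star c = c ∧ c ≠ 0}
  have hF : Nat.card F = q - 1 := by
    have h3 := card_fixed hK hs
    rw [Nat.card_eq_fintype_card, Fintype.card_subtype] at h3 ⊢
    have : (Finset.univ.filter fun a : K => star a = a ∧ a ≠ 0) =
      (Finset.univ.filter fun a : K => star a = a).erase 0 := by
      ext a; simp [and_comm]
    rw [this, Finset.card_erase_of_mem (by simp), h3]
  have e : (Σ c : F, {a : K // star a * a = c.1}) ≃ Kˣ :=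
    { toFun := fun p => Units.mk0 p.2.1 (by 
        intro h
        have := p.2.2
        rw [h, mul_zero] at this
        exact p.1.2.2 this.symm)
      invFun := fun a => ⟨⟨star a.1 * a.1, by simp [mul_comm], by simp⟩, ⟨a.1, rfl⟩⟩
      left_inv := by
        rintro ⟨⟨c, hc⟩, ⟨a, ha⟩⟩
        simp only at ha
        subst ha
        rfl
      right_inv := fun a => by ext; rfl }
  have hsum := Nat.card_congr e
  rw [Nat.card_sigma, Nat.card_eq_fintype_card (α := Kˣ), Fintype.card_units, hK] at hsum
  have hle := hub c
  by_contra hne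
  have hlt : Nat.card {a : K // star a * a = c} < q + 1 := lt_of_le_of_ne hle hne
  have : ∑ c : F, Nat.card {a : K // star a * a = c.1} < ∑ c : F, (q + 1) := by
    apply Finset.sum_lt_sum
    · intro i _; exact hub _
    · exact ⟨⟨c, hc, hc0⟩, Finset.mem_univ _, hlt⟩
  rw [hsum, Finset.sum_const, Finset.card_univ, ← Nat.card_eq_fintype_card, hF, smul_eq_mul] at this
  have h5 : (q - 1) * (q + 1) = q ^ 2 - 1 := by
    obtain ⟨k, rfl⟩ : ∃ k, q = k + 1 := ⟨q - 1, by omega⟩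
    simp; ring_nf; omega
  omega

lemma exists_norm_eq (hK : Fintype.card K = q ^ 2) (hs : ∀ a : K, star a = a ^ q)
    (c : K) (hc : star c = c) : ∃ a : K, star a * a = c := by
  by_cases hc0 : c = 0
  · exact ⟨0, by simp [hc0]⟩
  have h := norm_surj_card hK hs c hc hc0
  have : Nonempty {a : K // star a * a = c} := by
    by_contra hn
    rw [not_nonempty_iff] at hn
    simp at h
  exact ⟨this.some.1, this.some.2⟩

end basics
end FF

namespace FF

lemma elim_inj {α β γ : Type} {a a' : α → γ} {b b' : β → γ} (h : Sum.elim a b = Sum.elim a' b') :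
    a = a' ∧ b = b' := by
  constructor
  · funext i; exact congrFun h (Sum.inl i)
  · funext i; exact congrFun h (Sum.inr i)

section orbit
lemma orbit_count {G Ω : Type} [Group G] [Fintype G] [Fintype Ω] (act : G → Ω → Ω)
    (hone : ∀ x, act 1 x = x) (hmul : ∀ g h x, act (g * h) x = act g (act h x))
    (E D : Ω → Prop) (P : G → Prop) (w : Ω → ℝ) [DecidablePred E] [DecidablePred D]
    (hw : ∀ g x, E x → w (act g x) = w x) (hE : ∀ g x, E x → E (act g x))
    (hDE : ∀ x, D x → E x) (hex : ∀ x, E x → ∃ g, D (act g x))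
    (hP : ∀ g x, D x → (D (act g x) ↔ P g)) :
    (Nat.card {g // P g} : ℝ) * ∑ x with E x, w x = (Nat.card G : ℝ) * ∑ x with D x, w x := by
  classical
  have h1 : ∀ x, E x → (∑ g : G, if D (act g x) then w x else 0) = (Nat.card {g // P g} : ℝ) * w x := by
    intro x hx
    obtain ⟨g0, hg0⟩ := hex x hx
    rw [← Equiv.sum_comp (Equiv.mulRight g0)]
    have : ∀ g, D (act (Equiv.mulRight g0 g) x) ↔ P g := by
      intro g
      rw [Equiv.coe_mulRight, hmul, hP _ _ hg0]
    simp only [this]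
    rw [← Finset.sum_filter, Finset.sum_const, nsmul_eq_mul, Nat.card_eq_fintype_card, Fintype.card_subtype]
  have h2 : ∀ g : G, (∑ x with E x, if D (act g x) then w x else 0) = ∑ x with D x, w x := by
    intro g
    rw [← Finset.sum_filter]
    have hinv : ∀ x, act g⁻¹ (act g x) = x := by intro x; rw [← hmul]; simp [hone]
    have hinv' : ∀ x, act g (act g⁻¹ x) = x := by intro x; rw [← hmul]; simp [hone]
    refine Finset.sum_bij' (fun x _ => act g x) (fun x _ => act g⁻¹ x) ?_ ?_ ?_ ?_ ?_
    · intro x hx; simp at hx; simp [hx]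
    · intro x hx; simp at hx; simp [hinv', hx, hE _ _ (hDE x hx)]
    · intro x _; exact hinv x
    · intro x _; exact hinv' x
    · intro x hx; simp at hx; exact (hw g x hx.1).symm
  calc (Nat.card {g // P g} : ℝ) * ∑ x with E x, w x
      = ∑ x with E x, ∑ g : G, if D (act g x) then w x else 0 := by
        rw [Finset.mul_sum]
        apply Finset.sum_congr rfl
        intro x hx
        rw [h1 x (by simpa using hx)]
    _ = ∑ g : G, ∑ x with E x, if D (act g x) then w x else 0 := Finset.sum_comm
    _ = _ := by
        simp only [h2]
        rw [Finset.sum_const, nsmul_eq_mul, Finset.card_univ, Nat.card_eq_fintype_card]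

end orbit

section LH
variable {K : Type} [Field K] [Fintype K] [StarRing K]

/-- number of Hermitian forms for which `A` is self-adjoint -/
noncomputable def Lc {n : Type} [Fintype n] [DecidableEq n] (A : Matrix n n K) : ℕ :=
  Nat.card {S : Matrix n n K // S.IsHermitian ∧ (S * A).IsHermitian}

/-- number of nondegenerate Hermitian forms for which `A` is self-adjoint -/
noncomputable def Hc {n : Type} [Fintype n] [DecidableEq n] (A : Matrix n n K) : ℕ :=
  Nat.card {S : Matrix n n K // (S.IsHermitian ∧ (S * A).IsHermitian) ∧ IsUnit S}

section conj
variable {n n' : Type} [Fintype n] [DecidableEq n] [Fintype n'] [DecidableEq n']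

lemma herm_conj {n n' : Type} [Fintype n] [Fintype n'] (p : Matrix n n' K) {S : Matrix n n K} (hS : S.IsHermitian) :
    (pᴴ * S * p).IsHermitian := by
  unfold IsHermitian
  rw [conjTranspose_mul, conjTranspose_mul, conjTranspose_conjTranspose, hS.eq, Matrix.mul_assoc]

lemma isUnit_conj (p : Matrix n' n K) (p' : Matrix n n' K) (h1 : p * p' = 1) (h2 : p' * p = 1)
    {S : Matrix n n K} (hS : IsUnit S) : IsUnit (p'ᴴ * S * p') := by
  obtain ⟨T, hT⟩ := hS.exists_right_inv
  refine IsUnit.of_mul_eq_one (p * T * pᴴ) ?_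
  calc p'ᴴ * S * p' * (p * T * pᴴ) = p'ᴴ * S * (p' * p) * T * pᴴ := by simp only [Matrix.mul_assoc]
    _ = p'ᴴ * (S * T) * pᴴ := by rw [h2]; simp only [Matrix.mul_assoc, Matrix.mul_one, Matrix.one_mul]
    _ = (p * p')ᴴ := by rw [hT, conjTranspose_mul, Matrix.mul_one]
    _ = 1 := by rw [h1]; simp

lemma sa_conj (p : Matrix n' n K) (p' : Matrix n n' K) (h2 : p' * p = 1)
    {S A : Matrix n n K} (hS : (S * A).IsHermitian) : ((p'ᴴ * S * p') * (p * A * p')).IsHermitian := by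
  have : (p'ᴴ * S * p') * (p * A * p') = p'ᴴ * (S * A) * p' := by
    calc (p'ᴴ * S * p') * (p * A * p') = p'ᴴ * S * (p' * p) * A * p' := by simp only [Matrix.mul_assoc]
      _ = _ := by rw [h2]; simp only [Matrix.mul_assoc, Matrix.mul_one, Matrix.one_mul]
  rw [this]
  exact herm_conj p' hS

def formEquiv (p : Matrix n' n K) (p' : Matrix n n' K) (h1 : p * p' = 1) (h2 : p' * p = 1) :
    Matrix n n K ≃ Matrix n' n' K where
  toFun S := p'ᴴ * S * p'
  invFun S := pᴴ * S * p
  left_inv S := by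
    show pᴴ * (p'ᴴ * S * p') * p = S
    have e : pᴴ * (p'ᴴ * S * p') * p = (p' * p)ᴴ * S * (p' * p) := by
      rw [conjTranspose_mul]; simp only [Matrix.mul_assoc]
    rw [e, h2]; simp
  right_inv S := by
    show p'ᴴ * (pᴴ * S * p) * p' = S
    have e : p'ᴴ * (pᴴ * S * p) * p' = (p * p')ᴴ * S * (p * p') := by
      rw [conjTranspose_mul]; simp only [Matrix.mul_assoc]
    rw [e, h1]; simp

lemma conj_conj (p : Matrix n' n K) (p' : Matrix n n' K) (h2 : p' * p = 1) (A : Matrix n n K) :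
    p' * (p * A * p') * p = A := by
  have : p' * (p * A * p') * p = (p' * p) * A * (p' * p) := by simp only [Matrix.mul_assoc]
  rw [this, h2]; simp

lemma Lc_conj (p : Matrix n' n K) (p' : Matrix n n' K) (h1 : p * p' = 1) (h2 : p' * p = 1)
    (A : Matrix n n K) : Lc (p * A * p') = Lc A := by
  symm
  refine Nat.card_congr (Equiv.subtypeEquiv (formEquiv p p' h1 h2) ?_)
  intro S
  constructor
  · rintro ⟨a, b⟩; exact ⟨herm_conj p' a, sa_conj p p' h2 b⟩
  · rintro ⟨a, b⟩
    have e := (formEquiv p p' h1 h2).symm_apply_apply S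
    have a' := herm_conj p a
    have b' := sa_conj p' p h1 b
    rw [conj_conj p p' h2] at b'
    rw [show pᴴ * (formEquiv p p' h1 h2 S) * p = S from e] at a' b'
    exact ⟨a', b'⟩

lemma Hc_conj (p : Matrix n' n K) (p' : Matrix n n' K) (h1 : p * p' = 1) (h2 : p' * p = 1)
    (A : Matrix n n K) : Hc (p * A * p') = Hc A := by
  symm
  refine Nat.card_congr (Equiv.subtypeEquiv (formEquiv p p' h1 h2) ?_)
  intro S
  constructor
  · rintro ⟨⟨a, b⟩, c⟩; exact ⟨⟨herm_conj p' a, sa_conj p p' h2 b⟩, isUnit_conj p p' h1 h2 c⟩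
  · rintro ⟨⟨a, b⟩, c⟩
    have e := (formEquiv p p' h1 h2).symm_apply_apply S
    have a' := herm_conj p a
    have b' := sa_conj p' p h1 b
    have c' := isUnit_conj p' p h2 h1 c
    rw [conj_conj p p' h2] at b'
    rw [show pᴴ * (formEquiv p p' h1 h2 S) * p = S from e] at a' b' c'
    exact ⟨⟨a', b'⟩, c'⟩

end conj

section blocks
variable {r b c m : Type} [Fintype r] [DecidableEq r] [Fintype b] [DecidableEq b]
  [Fintype c] [DecidableEq c] [Fintype m] [DecidableEq m]

/-- `[A' | X]` is surjective. -/
def Sj {s r b : Type} [Fintype s] [DecidableEq s] [Fintype r] [Fintype b] (A : Matrix s r K) (X : Matrix s b K) : Prop :=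
  ∃ (G1 : Matrix r s K) (G2 : Matrix b s K), A * G1 + X * G2 = 1

/-- the bijection of Step A -/
lemma stepA_equiv (A : Matrix r r K) (X : Matrix r b K) (h : Sj A X) :
    ∃ e : {S : Matrix r r K // S.IsHermitian ∧ (S * A).IsHermitian} × Herm K b ≃
      {S : Matrix (r ⊕ b) (r ⊕ b) K // S.IsHermitian ∧ (S * fromBlocks A X 0 0).IsHermitian},
      ∀ x, (e x).1 = fromBlocks (x.1.1 * A) (x.1.1 * X) (Xᴴ * x.1.1) x.2.1 := by
  obtain ⟨G1, G2, hG⟩ := h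
  have hG' : G1ᴴ * Aᴴ + G2ᴴ * Xᴴ = 1 := by
    have := congrArg conjTranspose hG
    simpa [conjTranspose_add, conjTranspose_mul] using this
  let f : {S : Matrix r r K // S.IsHermitian ∧ (S * A).IsHermitian} × Herm K b →
      {S : Matrix (r ⊕ b) (r ⊕ b) K // S.IsHermitian ∧ (S * fromBlocks A X 0 0).IsHermitian} :=
    fun x => ⟨fromBlocks (x.1.1 * A) (x.1.1 * X) (Xᴴ * x.1.1) x.2.1, by
      obtain ⟨⟨S, hS, hSA⟩, ⟨T, hT⟩⟩ := x
      constructor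
      · apply IsHermitian.fromBlocks hSA _ hT
        rw [conjTranspose_mul, hS.eq]
      · rw [fromBlocks_multiply]
        simp only [Matrix.mul_zero, add_zero]
        have hSA' : S * A = Aᴴ * S := by
          rw [← hSA.eq, conjTranspose_mul, hS.eq]
        apply IsHermitian.fromBlocks
        · unfold IsHermitian
          show (S * A * A)ᴴ = S * A * A
          rw [conjTranspose_mul, hSA.eq, ← Matrix.mul_assoc, ← hSA']
        · show (S * A * X)ᴴ = Xᴴ * S * A
          rw [conjTranspose_mul, hSA.eq, ← Matrix.mul_assoc]
        · exact herm_conj X hS⟩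
  have hf : Function.Bijective f := by
    constructor
    · rintro ⟨⟨S, hS, hSA⟩, ⟨T, hT⟩⟩ ⟨⟨S', hS', hSA'⟩, ⟨T', hT'⟩⟩ hh
      have := congrArg Subtype.val hh
      simp only [f] at this
      obtain ⟨h1, h2, h3, h4⟩ := fromBlocks_inj.mp this
      have : S = S' := by
        calc S = S * A * G1 + S * X * G2 := by
                rw [Matrix.mul_assoc, Matrix.mul_assoc, ← Matrix.mul_add, hG, Matrix.mul_one]
          _ = S' * A * G1 + S' * X * G2 := by rw [h1, h2]
          _ = S' := by
                rw [Matrix.mul_assoc, Matrix.mul_assoc, ← Matrix.mul_add, hG, Matrix.mul_one]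
      subst this
      subst h4
      rfl
    · rintro ⟨S, hS, hSA⟩
      obtain ⟨S11, S12, S21, S22, rfl⟩ : ∃ S11 S12 S21 S22, S = fromBlocks S11 S12 S21 S22 :=
        ⟨_, _, _, _, (fromBlocks_toBlocks S).symm⟩
      have h1 := hS
      unfold IsHermitian at h1
      rw [fromBlocks_conjTranspose] at h1
      obtain ⟨a11, a12, a21, a22⟩ := fromBlocks_inj.mp h1
      rw [fromBlocks_multiply] at hSA
      simp only [Matrix.mul_zero, add_zero] at hSA
      unfold IsHermitian at hSA
      rw [fromBlocks_conjTranspose] at hSA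
      obtain ⟨b11, b12, b21, b22⟩ := fromBlocks_inj.mp hSA
      rw [conjTranspose_mul] at b11 b12 b21 b22
      rw [a11] at b11 b21
      rw [a12] at b12 b22
      -- b11 : Aᴴ S11 = S11 A ; b12 : Aᴴ S12 = S11 X ; b21 : Xᴴ S11 = S21 A; b22 : Xᴴ S12 = S21 X
      let S' : Matrix r r K := S11 * G1 + S12 * G2
      have eA : S' * A = S11 := by
        have key : ∀ (u : Matrix r r K), u = G1ᴴ * (Aᴴ * u) + G2ᴴ * (Xᴴ * u) := by
          intro u
          rw [← Matrix.mul_assoc, ← Matrix.mul_assoc, ← Matrix.add_mul, hG', Matrix.one_mul]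
        rw [key (S' * A), key S11]
        have e1 : Aᴴ * (S' * A) = Aᴴ * S11 := by
          calc Aᴴ * (S' * A) = (Aᴴ * S11 * G1 + Aᴴ * S12 * G2) * A := by
                simp only [S', Matrix.mul_add, Matrix.mul_assoc, Matrix.add_mul]
            _ = (S11 * (A * G1 + X * G2)) * A := by rw [b11, b12]; simp only [Matrix.mul_add, Matrix.mul_assoc]
            _ = Aᴴ * S11 := by rw [hG, Matrix.mul_one, b11]
        have e2 : Xᴴ * (S' * A) = Xᴴ * S11 := by
          calc Xᴴ * (S' * A) = (Xᴴ * S11 * G1 + Xᴴ * S12 * G2) * A := by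
                simp only [S', Matrix.mul_add, Matrix.mul_assoc, Matrix.add_mul]
            _ = (S21 * (A * G1 + X * G2)) * A := by rw [b21, b22]; simp only [Matrix.mul_add, Matrix.mul_assoc]
            _ = Xᴴ * S11 := by rw [hG, Matrix.mul_one, b21]
        rw [e1, e2]
      have eX : S' * X = S12 := by
        have key : ∀ (u : Matrix r b K), u = G1ᴴ * (Aᴴ * u) + G2ᴴ * (Xᴴ * u) := by
          intro u
          rw [← Matrix.mul_assoc, ← Matrix.mul_assoc, ← Matrix.add_mul, hG', Matrix.one_mul]
        rw [key (S' * X), key S12]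
        have e1 : Aᴴ * (S' * X) = Aᴴ * S12 := by
          calc Aᴴ * (S' * X) = (Aᴴ * S11 * G1 + Aᴴ * S12 * G2) * X := by
                simp only [S', Matrix.mul_add, Matrix.mul_assoc, Matrix.add_mul]
            _ = (S11 * (A * G1 + X * G2)) * X := by rw [b11, b12]; simp only [Matrix.mul_add, Matrix.mul_assoc]
            _ = Aᴴ * S12 := by rw [hG, Matrix.mul_one, b12]
        have e2 : Xᴴ * (S' * X) = Xᴴ * S12 := by
          calc Xᴴ * (S' * X) = (Xᴴ * S11 * G1 + Xᴴ * S12 * G2) * X := by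
                simp only [S', Matrix.mul_add, Matrix.mul_assoc, Matrix.add_mul]
            _ = (S21 * (A * G1 + X * G2)) * X := by rw [b21, b22]; simp only [Matrix.mul_add, Matrix.mul_assoc]
            _ = Xᴴ * S12 := by rw [hG, Matrix.mul_one, b22]
        rw [e1, e2]
      have hS' : S'ᴴ = S' := by
        have e1 : Aᴴ * S'ᴴ = S' * A := by
          rw [← conjTranspose_mul, eA, a11]
        have e2 : S' * A = Aᴴ * S' := by
          rw [eA]
          calc S11 = S11 * (A * G1 + X * G2) := by rw [hG, Matrix.mul_one]
            _ = Aᴴ * S' := by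
              simp only [Matrix.mul_add, ← Matrix.mul_assoc, S']
              rw [b11, b12]
        have e3 : Xᴴ * S'ᴴ = Xᴴ * S' := by
          rw [← conjTranspose_mul, eX, a21]
          calc S21 = S21 * (A * G1 + X * G2) := by rw [hG, Matrix.mul_one]
            _ = Xᴴ * S' := by
              simp only [Matrix.mul_add, ← Matrix.mul_assoc, S']
              rw [b21, b22]
        calc S'ᴴ = G1ᴴ * (Aᴴ * S'ᴴ) + G2ᴴ * (Xᴴ * S'ᴴ) := by
              rw [← Matrix.mul_assoc, ← Matrix.mul_assoc, ← Matrix.add_mul, hG', Matrix.one_mul]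
          _ = G1ᴴ * (Aᴴ * S') + G2ᴴ * (Xᴴ * S') := by rw [e1, e2, e3]
          _ = S' := by
              rw [← Matrix.mul_assoc, ← Matrix.mul_assoc, ← Matrix.add_mul, hG', Matrix.one_mul]
      refine ⟨⟨⟨S', hS', ?_⟩, ⟨S22, a22⟩⟩, ?_⟩
      · rw [eA]; exact a11
      · apply Subtype.ext
        simp only [f]
        rw [eA, eX]
        congr 1
        have : Xᴴ * S' = (S' * X)ᴴ := by rw [conjTranspose_mul, hS']
        rw [this, eX, a21]
  exact ⟨Equiv.ofBijective f hf, fun x => rfl⟩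

lemma Lc_step {q : ℕ} (hK : Fintype.card K = q ^ 2) (hs : ∀ a : K, star a = a ^ q)
    (A : Matrix r r K) (X : Matrix r b K) (h : Sj A X) :
    Lc (fromBlocks A X 0 0) = q ^ (Fintype.card b ^ 2) * Lc A := by
  obtain ⟨e, _⟩ := stepA_equiv A X h
  have := Nat.card_congr e
  rw [Nat.card_prod, card_herm hK hs] at this
  unfold Lc
  rw [← this, mul_comm]

/-- invertibility criterion -/
lemma isUnit_block (A : Matrix r r K) (X : Matrix r c K) (h : Sj A X)
    (hi : ∀ x y, A *ᵥ x + X *ᵥ y = 0 → y = 0)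
    (S : Matrix r r K) (hS : S.IsHermitian) (hSA : (S * A).IsHermitian)
    (S22 : Matrix c c K) (S23 : Matrix c m K) (S32 : Matrix m c K) (S33 : Matrix m m K) :
    IsUnit (fromBlocks (S * A) (S * fromCols X (0 : Matrix r m K)) ((fromCols X (0 : Matrix r m K))ᴴ * S)
      (fromBlocks S22 S23 S32 S33)) ↔ IsUnit S ∧ IsUnit S33 := by
  have hSA' : S * A = Aᴴ * S := by
    rw [← hSA.eq, conjTranspose_mul, hS.eq]
  have hmv : ∀ (x : r → K) (y : c → K) (z : m → K),
    (fromBlocks (S * A) (S * fromCols X (0 : Matrix r m K)) ((fromCols X (0 : Matrix r m K))ᴴ * S)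
      (fromBlocks S22 S23 S32 S33)) *ᵥ (Sum.elim x (Sum.elim y z)) =
      Sum.elim (S *ᵥ (A *ᵥ x + X *ᵥ y)) (Sum.elim (Xᴴ *ᵥ (S *ᵥ x) + S22 *ᵥ y + S23 *ᵥ z)
        (S32 *ᵥ y + S33 *ᵥ z)) := by
    intro x y z
    have e0 : fromCols X (0 : Matrix r m K) *ᵥ (Sum.elim y z) = X *ᵥ y := by
      rw [fromCols_mulVec]; simp
    rw [fromBlocks_mulVec, fromBlocks_mulVec]
    simp only [Sum.elim_comp_inl, Sum.elim_comp_inr]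
    congr 1
    · rw [← mulVec_mulVec, ← mulVec_mulVec, e0, mulVec_add]
    · rw [conjTranspose_fromCols_eq_fromRows_conjTranspose, fromRows_mul, fromRows_mulVec]
      ext i
      rcases i with i | i
      · simp [← mulVec_mulVec, add_assoc]
      · simp
  constructor
  · intro hu
    have hsur := Matrix.mulVec_surjective_iff_isUnit.mpr hu
    have hS' : IsUnit S := by
      rw [← Matrix.mulVec_surjective_iff_isUnit]
      intro w
      obtain ⟨v, hv⟩ := hsur (Sum.elim w (Sum.elim 0 0))
      have ev : v = Sum.elim (v ∘ Sum.inl) (Sum.elim (v ∘ Sum.inr ∘ Sum.inl) (v ∘ Sum.inr ∘ Sum.inr)) := by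
        ext i; rcases i with i | i | i <;> rfl
      rw [ev, hmv] at hv
      exact ⟨_, (elim_inj hv).1⟩
    refine ⟨hS', ?_⟩
    rw [← Matrix.mulVec_surjective_iff_isUnit]
    intro w
    obtain ⟨v, hv⟩ := hsur (Sum.elim 0 (Sum.elim 0 w))
    have ev : v = Sum.elim (v ∘ Sum.inl) (Sum.elim (v ∘ Sum.inr ∘ Sum.inl) (v ∘ Sum.inr ∘ Sum.inr)) := by
      ext i; rcases i with i | i | i <;> rfl
    rw [ev, hmv] at hv
    obtain ⟨h1, h2⟩ := elim_inj hv
    obtain ⟨h2, h3⟩ := elim_inj h2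
    have h1' : A *ᵥ (v ∘ Sum.inl) + X *ᵥ (v ∘ Sum.inr ∘ Sum.inl) = 0 :=
      Matrix.mulVec_injective_iff_isUnit.mpr hS' (by rw [h1, mulVec_zero])
    rw [hi _ _ h1'] at h3
    rw [mulVec_zero, zero_add] at h3
    exact ⟨_, h3⟩
  · rintro ⟨hS', hS33⟩
    rw [← Matrix.mulVec_injective_iff_isUnit]
    rw [← Matrix.coe_mulVecLin, injective_iff_map_eq_zero]
    intro v hv
    rw [Matrix.mulVecLin_apply] at hv
    have ev : v = Sum.elim (v ∘ Sum.inl) (Sum.elim (v ∘ Sum.inr ∘ Sum.inl) (v ∘ Sum.inr ∘ Sum.inr)) := by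
      ext i; rcases i with i | i | i <;> rfl
    generalize v ∘ Sum.inl = x at ev
    generalize v ∘ Sum.inr ∘ Sum.inl = y at ev
    generalize v ∘ Sum.inr ∘ Sum.inr = z at ev
    subst ev
    rw [hmv, show (0 : r ⊕ (c ⊕ m) → K) = Sum.elim (0 : r → K) (Sum.elim (0 : c → K) (0 : m → K)) by
      ext i; rcases i with i | i | i <;> rfl] at hv
    obtain ⟨h1, h2⟩ := elim_inj hv
    obtain ⟨h2, h3⟩ := elim_inj h2
    have h1' : A *ᵥ x + X *ᵥ y = 0 :=
      Matrix.mulVec_injective_iff_isUnit.mpr hS' (by rw [h1, mulVec_zero])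
    have hy := hi _ _ h1'
    subst hy
    rw [mulVec_zero, zero_add] at h3
    have hz : z = 0 := Matrix.mulVec_injective_iff_isUnit.mpr hS33 (by rw [h3, mulVec_zero])
    subst hz
    simp only [mulVec_zero, add_zero] at h1' h2
    have hx : S *ᵥ x = 0 := by
      obtain ⟨G1, G2, hG⟩ := h
      have hG' : G1ᴴ * Aᴴ + G2ᴴ * Xᴴ = 1 := by
        have := congrArg conjTranspose hG
        simpa [conjTranspose_add, conjTranspose_mul] using this
      have h5 : Aᴴ *ᵥ (S *ᵥ x) = 0 := by
        rw [mulVec_mulVec, ← hSA', ← mulVec_mulVec, h1', mulVec_zero]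
      rw [← one_mulVec (S *ᵥ x), ← hG', add_mulVec, ← mulVec_mulVec, ← mulVec_mulVec, h5, h2]
      simp
    have : x = 0 := Matrix.mulVec_injective_iff_isUnit.mpr hS' (by rw [hx, mulVec_zero])
    subst this
    ext i; rcases i with i | i | i <;> rfl

lemma Hc_step' {q : ℕ} (hK : Fintype.card K = q ^ 2) (hs : ∀ a : K, star a = a ^ q)
    (A : Matrix r r K) (X : Matrix r c K) (h : Sj A X)
    (hi : ∀ x y, A *ᵥ x + X *ᵥ y = 0 → y = 0) :
    Hc (fromBlocks A (fromCols X (0 : Matrix r m K)) 0 0) =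
      Hc A * (q ^ (Fintype.card c ^ 2) * (q ^ 2) ^ (Fintype.card c * Fintype.card m) * Nat.card (HInv K m)) := by
  have h' : Sj A (fromCols X (0 : Matrix r m K)) := by
    obtain ⟨G1, G2, hG⟩ := h
    exact ⟨G1, fromRows G2 0, by rw [fromCols_mul_fromRows]; simpa using hG⟩
  obtain ⟨e, he⟩ := stepA_equiv A (fromCols X (0 : Matrix r m K)) h'
  let g : {S : Matrix r r K // (S.IsHermitian ∧ (S * A).IsHermitian) ∧ IsUnit S} ×
      (Herm K c × Matrix c m K × HInv K m) →
      {S : Matrix (r ⊕ (c ⊕ m)) (r ⊕ (c ⊕ m)) K //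
        (S.IsHermitian ∧ (S * fromBlocks A (fromCols X (0 : Matrix r m K)) 0 0).IsHermitian) ∧ IsUnit S} :=
    fun x => ⟨(e (⟨x.1.1, x.1.2.1⟩, ⟨fromBlocks x.2.1.1 x.2.2.1 x.2.2.1ᴴ x.2.2.2.1,
        IsHermitian.fromBlocks x.2.1.2 rfl x.2.2.2.2.1⟩)).1, (e _).2, by
        rw [he]
        rw [isUnit_block A X h hi x.1.1 x.1.2.1.1 x.1.2.1.2]
        exact ⟨x.1.2.2, x.2.2.2.2.2⟩⟩
  have hg : Function.Bijective g := by
    constructor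
    · rintro ⟨⟨S, hS⟩, ⟨T, hT⟩, Y, ⟨Z, hZ⟩⟩ ⟨⟨S', hS'⟩, ⟨T', hT'⟩, Y', ⟨Z', hZ'⟩⟩ hh
      have h1 := congrArg Subtype.val hh
      simp only [g] at h1
      have h2 := e.injective (Subtype.ext h1)
      simp only [Prod.mk.injEq, Subtype.mk.injEq] at h2
      obtain ⟨h3, h4⟩ := h2
      obtain ⟨h5, h6, _, h7⟩ := fromBlocks_inj.mp h4
      subst h3 h5 h6 h7
      rfl
    · rintro ⟨S, hS, hSu⟩
      obtain ⟨⟨⟨S', hS'⟩, ⟨T, hT⟩⟩, hx⟩ := e.surjective ⟨S, hS⟩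
      have hx' := congrArg Subtype.val hx
      rw [he] at hx'
      simp only at hx'
      obtain ⟨S22, S23, S32, S33, rfl⟩ : ∃ S11 S12 S21 S22, T = fromBlocks S11 S12 S21 S22 :=
        ⟨_, _, _, _, (fromBlocks_toBlocks T).symm⟩
      rw [← hx', isUnit_block A X h hi S' hS'.1 hS'.2] at hSu
      have h1 := hT
      unfold IsHermitian at h1
      rw [fromBlocks_conjTranspose] at h1
      obtain ⟨a11, a12, a21, a22⟩ := fromBlocks_inj.mp h1
      subst a21
      refine ⟨(⟨S', hS', hSu.1⟩, ⟨S22, a11⟩, S23, ⟨S33, a22, hSu.2⟩), ?_⟩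
      apply Subtype.ext
      simp only [g]
      exact congrArg Subtype.val hx
  have := Nat.card_congr (Equiv.ofBijective g hg)
  rw [Nat.card_prod, Nat.card_prod, Nat.card_prod, card_herm hK hs, card_mat, hK] at this
  unfold Hc
  rw [← this]
  ring

end blocks
end LH
end FF

namespace FF

section adapted
variable {K : Type} [Field K]

lemma mat_eq_zero {n m : Type} [Fintype m] [DecidableEq m] (A : Matrix n m K) (h : ∀ v, A *ᵥ v = 0) : A = 0 := by
  apply Matrix.mulVec_injective
  funext v
  rw [h, zero_mulVec]

lemma exists_factor {r s m : Type} [Fintype r] [Fintype s] [Fintype m] [DecidableEq m]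
    (A : Matrix r s K) (M : Matrix r m K)
    (h : ∀ v, M *ᵥ v ∈ LinearMap.range A.mulVecLin) : ∃ Y : Matrix s m K, M = A * Y := by
  choose y hy using h
  refine ⟨Matrix.of fun i j => y (Pi.single j 1) i, ?_⟩
  ext i j
  have := congrFun (hy (Pi.single j 1)) i
  rw [mulVecLin_apply, mulVec_single_one] at this
  rw [Matrix.mul_apply]
  exact this.symm

lemma adapted {n : Type} [Fintype n] [DecidableEq n] (W W' : Submodule K (n → K)) (hc : IsCompl W W')
    {d e : ℕ} (hd : Module.finrank K W = d) (he : Module.finrank K W' = e) :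
    ∃ (p1 : Matrix n (Fin d) K) (p2 : Matrix n (Fin e) K) (p1' : Matrix (Fin d) n K)
      (p2' : Matrix (Fin e) n K),
      p1 * p1' + p2 * p2' = 1 ∧ p1' * p1 = 1 ∧ p2' * p2 = 1 ∧ p1' * p2 = 0 ∧ p2' * p1 = 0 ∧
      (∀ v, v ∈ W ↔ p2' *ᵥ v = 0) ∧ (∀ v, v ∈ W' ↔ p1' *ᵥ v = 0) := by
  let f1 : W ≃ₗ[K] (Fin d → K) := LinearEquiv.ofFinrankEq _ _ (by simp [hd])
  let f2 : W' ≃ₗ[K] (Fin e → K) := LinearEquiv.ofFinrankEq _ _ (by simp [he])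
  let P := W.prodEquivOfIsCompl W' hc
  let p1 : Matrix n (Fin d) K := LinearMap.toMatrix' (W.subtype ∘ₗ f1.symm.toLinearMap)
  let p2 : Matrix n (Fin e) K := LinearMap.toMatrix' (W'.subtype ∘ₗ f2.symm.toLinearMap)
  let p1' : Matrix (Fin d) n K := LinearMap.toMatrix' (f1.toLinearMap ∘ₗ LinearMap.fst K W W' ∘ₗ P.symm.toLinearMap)
  let p2' : Matrix (Fin e) n K := LinearMap.toMatrix' (f2.toLinearMap ∘ₗ LinearMap.snd K W W' ∘ₗ P.symm.toLinearMap)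
  have e1 : ∀ w : W, P.symm w = (w, 0) := fun w => by
    simp [P]
  have e2 : ∀ w : W', P.symm w = (0, w) := fun w => by
    simp [P]
  have a1 : ∀ v, p1 *ᵥ v = (f1.symm v : n → K) := fun v => by simp [p1, LinearMap.toMatrix'_mulVec]
  have a2 : ∀ v, p2 *ᵥ v = (f2.symm v : n → K) := fun v => by simp [p2, LinearMap.toMatrix'_mulVec]
  have a3 : ∀ v, p1' *ᵥ v = f1 (P.symm v).1 := fun v => by simp [p1', LinearMap.toMatrix'_mulVec]
  have a4 : ∀ v, p2' *ᵥ v = f2 (P.symm v).2 := fun v => by simp [p2', LinearMap.toMatrix'_mulVec]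
  refine ⟨p1, p2, p1', p2', ?_, ?_, ?_, ?_, ?_, ?_, ?_⟩
  · apply Matrix.mulVec_injective
    funext v
    rw [add_mulVec, ← mulVec_mulVec, ← mulVec_mulVec, a1, a2, a3, a4, one_mulVec]
    simp only [LinearEquiv.symm_apply_apply]
    exact P.apply_symm_apply v
  · apply Matrix.mulVec_injective
    funext v
    rw [← mulVec_mulVec, a1, a3, e1, one_mulVec]; simp
  · apply Matrix.mulVec_injective
    funext v
    rw [← mulVec_mulVec, a2, a4, e2, one_mulVec]; simp
  · apply mat_eq_zero
    intro v
    rw [← mulVec_mulVec, a2, a3, e2]; simp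
  · apply mat_eq_zero
    intro v
    rw [← mulVec_mulVec, a1, a4, e1]; simp
  · intro v
    rw [a4, LinearEquiv.map_eq_zero_iff]
    exact (Submodule.prodEquivOfIsCompl_symm_apply_snd_eq_zero W W' hc).symm
  · intro v
    rw [a3, LinearEquiv.map_eq_zero_iff]
    exact (Submodule.prodEquivOfIsCompl_symm_apply_fst_eq_zero W W' hc).symm

/-- surjectivity is full row rank -/
lemma surj_of_rank {s n : Type} [Fintype s] [DecidableEq s] [Fintype n] (A : Matrix s n K)
    (h : A.rank = Fintype.card s) : ∃ G : Matrix n s K, A * G = 1 := by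
  rw [← mulVec_surjective_iff_exists_right_inverse]
  have : LinearMap.range A.mulVecLin = ⊤ := by
    apply Submodule.eq_top_of_finrank_eq
    rw [show Module.finrank K (LinearMap.range A.mulVecLin) = A.rank from rfl, h]
    simp
  rw [LinearMap.range_eq_top] at this
  exact this

lemma rank_of_surj {s n : Type} [Fintype s] [DecidableEq s] [Fintype n] (A : Matrix s n K)
    (G : Matrix n s K) (h : A * G = 1) : A.rank = Fintype.card s := by
  apply le_antisymm (rank_le_card_height A)
  have := rank_mul_le_left A G
  rwa [h, rank_one] at this

end adapted

section nf
variable {K : Type} [Field K] [Fintype K] [StarRing K]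

lemma corank_of {r c : Type} [Fintype r] [DecidableEq r] [Fintype c] [DecidableEq c] (A : Matrix r r K) (X : Matrix r c K) (h : Sj A X)
    (hi : ∀ x y, A *ᵥ x + X *ᵥ y = 0 → y = 0) : A.rank + Fintype.card c = Fintype.card r := by
  let f : (c → K) →ₗ[K] ((r → K) ⧸ LinearMap.range A.mulVecLin) :=
    (LinearMap.range A.mulVecLin).mkQ ∘ₗ X.mulVecLin
  have hf : Function.Bijective f := by
    constructor
    · rw [injective_iff_map_eq_zero]
      intro y hy
      simp only [f, LinearMap.comp_apply, Submodule.mkQ_apply, Submodule.Quotient.mk_eq_zero] at hy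
      obtain ⟨x, hx⟩ := hy
      simp only [mulVecLin_apply] at hx
      apply hi (-x) y
      rw [mulVec_neg, hx]; simp
    · intro z
      obtain ⟨w, rfl⟩ := Submodule.Quotient.mk_surjective _ z
      obtain ⟨G1, G2, hG⟩ := h
      refine ⟨G2 *ᵥ w, ?_⟩
      simp only [f, LinearMap.comp_apply, Submodule.mkQ_apply]
      rw [Submodule.Quotient.eq]
      refine ⟨-(G1 *ᵥ w), ?_⟩
      simp only [mulVecLin_apply]
      have : A *ᵥ (G1 *ᵥ w) + X *ᵥ (G2 *ᵥ w) = w := by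
        rw [mulVec_mulVec, mulVec_mulVec, ← add_mulVec, hG, one_mulVec]
      rw [mulVec_neg]
      nth_rewrite 3 [← this]
      abel
  have h1 := (LinearEquiv.ofBijective f hf).finrank_eq
  have h2 := Submodule.finrank_quotient_add_finrank (LinearMap.range A.mulVecLin)
  rw [← h1] at h2
  simp only [Module.finrank_fintype_fun_eq_card] at h2
  rw [← h2, add_comm]
  rfl

lemma normal_form {r b : Type} [Fintype r] [DecidableEq r] [Fintype b] [DecidableEq b]
    (A : Matrix r r K) (X : Matrix r b K) (h : Sj A X) :
    ∃ (c m : ℕ) (X1 : Matrix r (Fin c) K) (P : Matrix (r ⊕ b) (r ⊕ (Fin c ⊕ Fin m)) K)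
      (P' : Matrix (r ⊕ (Fin c ⊕ Fin m)) (r ⊕ b) K), P * P' = 1 ∧ P' * P = 1 ∧ Sj A X1 ∧
      (∀ x y, A *ᵥ x + X1 *ᵥ y = 0 → y = 0) ∧ c + m = Fintype.card b ∧
      P' * (fromBlocks A X 0 0 : Matrix (r ⊕ b) (r ⊕ b) K) * P = fromBlocks A (fromCols X1 (0 : Matrix r (Fin m) K)) 0 0 := by
  let N := Submodule.comap X.mulVecLin (LinearMap.range A.mulVecLin)
  obtain ⟨C, hC⟩ := Submodule.exists_isCompl N
  obtain ⟨p1, p2, p1', p2', h1, h11, h22, h12, h21, hW, hW'⟩ := adapted C N hC.symm rfl rfl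
  have hcm : Module.finrank K C + Module.finrank K N = Fintype.card b := by
    rw [add_comm, Submodule.finrank_add_eq_of_isCompl hC]; simp
  obtain ⟨Y2, hY2⟩ : ∃ Y2 : Matrix r (Fin _) K, X * p2 = A * Y2 := by
    apply exists_factor
    intro v
    have : p2 *ᵥ v ∈ N := by
      rw [hW', mulVec_mulVec, h12, zero_mulVec]
    rw [← mulVec_mulVec]
    exact this
  refine ⟨_, _, X * p1, fromBlocks 1 (fromCols 0 (-Y2)) 0 (fromCols p1 p2),
    fromBlocks 1 (Y2 * p2') 0 (fromRows p1' p2'), ?_, ?_, ?_, ?_, hcm, ?_⟩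
  · rw [fromBlocks_multiply, fromCols_mul_fromRows, fromCols_mul_fromRows, h1]
    simp
  · rw [fromBlocks_multiply, fromRows_mul_fromCols, h11, h12, h21, h22]
    have e1 : Y2 * p2' * fromCols p1 p2 = fromCols 0 Y2 := by
      rw [mul_fromCols, Matrix.mul_assoc, Matrix.mul_assoc, h21, h22]; simp
    rw [e1]
    have : fromCols (0 : Matrix r (Fin (Module.finrank K C)) K) (-Y2) + (fromCols 0 Y2) = 0 := by
      ext i (j | j) <;> simp
    simp [this]
  · obtain ⟨G1, G2, hG⟩ := h
    refine ⟨G1 + Y2 * p2' * G2, p1' * G2, ?_⟩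
    calc A * (G1 + Y2 * p2' * G2) + X * p1 * (p1' * G2)
        = A * G1 + ((A * Y2) * p2' * G2 + X * p1 * p1' * G2) := by
          simp only [Matrix.mul_add, Matrix.mul_assoc, add_assoc]
      _ = A * G1 + X * (p1 * p1' + p2 * p2') * G2 := by
          rw [← hY2]; simp only [Matrix.mul_add, Matrix.add_mul, Matrix.mul_assoc]
          abel
      _ = 1 := by rw [h1, Matrix.mul_one, hG]
  · intro x y hxy
    have hC1 : p1 *ᵥ y ∈ C := by rw [hW, mulVec_mulVec, h21, zero_mulVec]
    have hN1 : p1 *ᵥ y ∈ N := by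
      refine ⟨-x, ?_⟩
      simp only [mulVecLin_apply]
      rw [mulVec_neg, mulVec_mulVec, eq_comm, ← add_eq_zero_iff_eq_neg, add_comm]
      exact hxy
    have h0 : p1 *ᵥ y = 0 := by
      have := (Submodule.disjoint_def.mp hC.disjoint) _ hN1 hC1
      exact this
    rw [← one_mulVec y, ← h11, ← mulVec_mulVec, h0, mulVec_zero]
  · rw [fromBlocks_multiply, fromBlocks_multiply]
    simp only [Matrix.mul_zero, Matrix.one_mul, Matrix.zero_mul, add_zero, Matrix.mul_one]
    rw [mul_fromCols, mul_fromCols, hY2]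
    congr 1
    ext i (j | j) <;> simp

lemma Hc_step {q : ℕ} (hK : Fintype.card K = q ^ 2) (hs : ∀ a : K, star a = a ^ q)
    {r b : Type} [Fintype r] [DecidableEq r] [Fintype b] [DecidableEq b]
    (A : Matrix r r K) (X : Matrix r b K) (h : Sj A X) :
    ∃ c m : ℕ, A.rank + c = Fintype.card r ∧ c + m = Fintype.card b ∧
    Hc (fromBlocks A X 0 0) = Hc A * (q ^ (c ^ 2) * (q ^ 2) ^ (c * m) * Nat.card (HInv K (Fin m))) := by
  obtain ⟨c, m, X1, P, P', h1, h2, h3, h4, h5, h6⟩ := normal_form A X h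
  refine ⟨c, m, ?_, h5, ?_⟩
  · simpa using corank_of A X1 h3 h4
  · rw [← Hc_conj P' P h2 h1, h6, Hc_step' hK hs A X1 h3 h4]
    simp

end nf

section ext
variable {K : Type} [Field K] [Fintype K]

lemma ext_iff_surj {r b : Type} [Fintype r] [DecidableEq r] [Fintype b] [DecidableEq b]
    (A : Matrix r r K) (c : ℕ) (hc : A.rank + c = Fintype.card r) :
    Nat.card {X : Matrix r b K // Sj A X} = Fintype.card K ^ (A.rank * Fintype.card b) *
      Nat.card {X : Matrix (Fin c) b K // ∃ G : Matrix b (Fin c) K, X * G = 1} := by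
  obtain ⟨C, hC⟩ := Submodule.exists_isCompl (LinearMap.range A.mulVecLin)
  have hCc : Module.finrank K C = c := by
    have := Submodule.finrank_add_eq_of_isCompl hC
    rw [show Module.finrank K (LinearMap.range A.mulVecLin) = A.rank from rfl] at this
    simp at this
    omega
  obtain ⟨p1, p2, p1', p2', h1, h11, h22, h12, h21, hW, hW'⟩ := adapted _ C hC (d := A.rank) rfl hCc
  have hA : p2' * A = 0 := by
    apply mat_eq_zero
    intro v
    rw [← mulVec_mulVec, ← hW]
    exact ⟨v, rfl⟩
  obtain ⟨Y1, hY1⟩ : ∃ Y1 : Matrix r (Fin A.rank) K, p1 = A * Y1 := by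
    apply exists_factor
    intro v
    rw [hW, mulVec_mulVec, h21, zero_mulVec]
  have key : ∀ X : Matrix r b K, Sj A X ↔ ∃ G : Matrix b (Fin c) K, (p2' * X) * G = 1 := by
    intro X
    constructor
    · rintro ⟨G1, G2, hG⟩
      refine ⟨G2 * p2, ?_⟩
      calc p2' * X * (G2 * p2) = (p2' * A) * G1 * p2 + p2' * X * (G2 * p2) := by rw [hA]; simp
        _ = p2' * (A * G1 + X * G2) * p2 := by
          simp only [Matrix.mul_add, Matrix.add_mul, Matrix.mul_assoc]
        _ = 1 := by rw [hG, Matrix.mul_one, h22]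
    · rintro ⟨G, hG⟩
      refine ⟨Y1 * p1' - Y1 * p1' * X * G * p2', G * p2', ?_⟩
      calc A * (Y1 * p1' - Y1 * p1' * X * G * p2') + X * (G * p2')
          = (A * Y1) * p1' - (A * Y1) * p1' * X * G * p2' + (p1 * p1' + p2 * p2') * X * (G * p2') := by
            rw [h1, Matrix.one_mul]; simp only [Matrix.mul_sub, Matrix.mul_assoc]
        _ = p1 * p1' + p2 * (p2' * X * G) * p2' := by
            rw [← hY1]; simp only [Matrix.add_mul, Matrix.mul_assoc]; abel
        _ = 1 := by rw [hG, Matrix.mul_one, h1]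
  let e : {X : Matrix r b K // Sj A X} ≃ Matrix (Fin A.rank) b K × {X : Matrix (Fin c) b K // ∃ G : Matrix b (Fin c) K, X * G = 1} :=
    { toFun := fun X => (p1' * X.1, ⟨p2' * X.1, (key X.1).mp X.2⟩)
      invFun := fun Y => ⟨p1 * Y.1 + p2 * Y.2.1, by
        rw [key, Matrix.mul_add, ← Matrix.mul_assoc, ← Matrix.mul_assoc, h21, h22, Matrix.zero_mul, zero_add,
          Matrix.one_mul]
        exact Y.2.2⟩
      left_inv := by
        rintro ⟨X, hX⟩
        apply Subtype.ext
        show p1 * (p1' * X) + p2 * (p2' * X) = X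
        rw [← Matrix.mul_assoc, ← Matrix.mul_assoc, ← Matrix.add_mul, h1, Matrix.one_mul]
      right_inv := by
        rintro ⟨Y, ⟨Z, hZ⟩⟩
        have a1 : p1' * (p1 * Y + p2 * Z) = Y := by
          rw [Matrix.mul_add, ← Matrix.mul_assoc, ← Matrix.mul_assoc, h11, h12]; simp
        have a2 : p2' * (p1 * Y + p2 * Z) = Z := by
          rw [Matrix.mul_add, ← Matrix.mul_assoc, ← Matrix.mul_assoc, h21, h22]; simp
        simp only [a1, a2] }
  have := Nat.card_congr e
  rw [this, Nat.card_prod, show Nat.card (Matrix (Fin A.rank) b K) = Fintype.card K ^ (A.rank * Fintype.card b) by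
    have : Nat.card (Matrix (Fin A.rank) b K) = Nat.card (Fin A.rank → b → K) := rfl
    rw [this, Nat.card_pi, Finset.prod_const, Nat.card_pi, Finset.prod_const, ← pow_mul,
    Finset.card_univ, Finset.card_univ, mul_comm, Nat.card_eq_fintype_card, Fintype.card_fin]]

lemma card_surj (c m : ℕ) :
    Nat.card {X : Matrix (Fin c) (Fin (c + m)) K // ∃ G : Matrix (Fin (c + m)) (Fin c) K, X * G = 1} * 
      (Fintype.card K ^ (c * m) * Nat.card (GL (Fin m) K)) = Nat.card (GL (Fin (c + m)) K) := by
  have h1 : Nat.card {X : Matrix (Fin c) (Fin (c + m)) K // ∃ G : Matrix (Fin (c + m)) (Fin c) K, X * G = 1} =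
      Nat.card {s : Fin c → (Fin (c + m) → K) // LinearIndependent K s} := by
    refine Nat.card_congr (Equiv.subtypeEquiv (Equiv.refl _) ?_)
    intro X
    show _ ↔ LinearIndependent K X.row
    constructor
    · rintro ⟨G, hG⟩
      rw [← vecMul_injective_iff]
      intro v w hvw
      have := congrArg (fun z => z ᵥ* G) hvw
      simpa [vecMul_vecMul, hG] using this
    · intro h
      exact surj_of_rank X h.rank_matrix
  rw [h1, card_linearIndependent (by simp), Matrix.card_GL_field, Matrix.card_GL_field]
  simp only [Module.finrank_fintype_fun_eq_card, Fintype.card_fin]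
  rw [Fin.prod_univ_add]
  congr 1
  simp only [Fin.val_natAdd]
  have : ∀ i : Fin m, (Fintype.card K ^ (c + m) - Fintype.card K ^ (c + (i : ℕ))) =
      Fintype.card K ^ c * (Fintype.card K ^ m - Fintype.card K ^ (i : ℕ)) := by
    intro i
    rw [Nat.mul_sub, pow_add, pow_add]
  simp only [this]
  rw [Finset.prod_mul_distrib, Finset.prod_const, Finset.card_univ, Fintype.card_fin, ← pow_mul]

lemma card_surj_zero (c b : ℕ) (h : b < c) :
    Nat.card {X : Matrix (Fin c) (Fin b) K // ∃ G : Matrix (Fin b) (Fin c) K, X * G = 1} = 0 := by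
  have : IsEmpty {X : Matrix (Fin c) (Fin b) K // ∃ G : Matrix (Fin b) (Fin c) K, X * G = 1} := by
    constructor
    rintro ⟨X, G, hG⟩
    have h1 := rank_of_surj X G hG
    have h2 := rank_le_card_width X
    simp at h1 h2
    omega
  exact Nat.card_of_isEmpty

end ext
end FF

namespace FF

section rec
variable {K : Type} [Field K] [Fintype K] [StarRing K]

/-- the two weights -/
noncomputable def Wt (f : Bool) {n : Type} [Fintype n] [DecidableEq n] (A : Matrix n n K) : ℝ :=
  (Hc A : ℝ) * (if f then (Lc A : ℝ) else (Hc A : ℝ))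

lemma Wt_conj (f : Bool) {n n' : Type} [Fintype n] [DecidableEq n] [Fintype n'] [DecidableEq n']
    (p : Matrix n' n K) (p' : Matrix n n' K) (h1 : p * p' = 1) (h2 : p' * p = 1)
    (A : Matrix n n K) : Wt f (p * A * p') = Wt f A := by
  unfold Wt
  rw [Lc_conj p p' h1 h2, Hc_conj p p' h1 h2]

/-- the coefficients `c_m` -/
noncomputable def coef (K : Type) [Field K] [Fintype K] [StarRing K] (q : ℕ) (f : Bool) (m : ℕ) : ℝ :=
  (if f then (q : ℝ) ^ (m ^ 2) * (Nat.card (HInv K (Fin m)) : ℝ) else (Nat.card (HInv K (Fin m)) : ℝ) ^ 2) /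
    (Nat.card (GL (Fin m) K) : ℝ)

lemma GL_pos (n : Type) [Fintype n] [DecidableEq n] : (0 : ℝ) < Nat.card (GL n K) := by
  exact_mod_cast Nat.card_pos

lemma nilp_block {r b : Type} [Fintype r] [DecidableEq r] [Fintype b] [DecidableEq b]
    (A : Matrix r r K) (X : Matrix r b K) :
    IsNilpotent (fromBlocks A X 0 0 : Matrix (r ⊕ b) (r ⊕ b) K) ↔ IsNilpotent A := by
  have key : ∀ k, (fromBlocks A X 0 0 : Matrix (r ⊕ b) (r ⊕ b) K) ^ (k + 1) =
      fromBlocks (A ^ (k + 1)) (A ^ k * X) 0 0 := by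
    intro k
    induction k with
    | zero => simp
    | succ k ih =>
      rw [pow_succ, ih, fromBlocks_multiply]
      simp [pow_succ]
  constructor
  · rintro ⟨k, hk⟩
    refine ⟨k + 1, ?_⟩
    have := key k
    rw [pow_succ, hk, Matrix.zero_mul, ← fromBlocks_zero] at this
    exact (fromBlocks_inj.mp this).1.symm
  · rintro ⟨k, hk⟩
    refine ⟨k + 1, ?_⟩
    rw [key, pow_succ, hk]; simp

lemma rank_block {r b : Type} [Fintype r] [DecidableEq r] [Fintype b] [DecidableEq b]
    (A : Matrix r r K) (X : Matrix r b K) :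
    (fromBlocks A X 0 0 : Matrix (r ⊕ b) (r ⊕ b) K).rank = Fintype.card r ↔ Sj A X := by
  have h1 : (fromBlocks A X 0 0 : Matrix (r ⊕ b) (r ⊕ b) K) =
      fromRows (1 : Matrix r r K) (0 : Matrix b r K) * fromCols A X := by
    rw [fromRows_mul_fromCols]; simp
  have h2 : fromCols (1 : Matrix r r K) (0 : Matrix r b K) * (fromBlocks A X 0 0 : Matrix (r ⊕ b) (r ⊕ b) K) =
      fromCols A X := by
    rw [fromCols_mul_fromBlocks]; simp
  have h3 : (fromBlocks A X 0 0 : Matrix (r ⊕ b) (r ⊕ b) K).rank = (fromCols A X).rank := by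
    apply le_antisymm
    · rw [h1]; exact rank_mul_le_right _ _
    · rw [← h2]; exact rank_mul_le_right _ _
  rw [h3]
  constructor
  · intro h
    obtain ⟨G, hG⟩ := surj_of_rank _ h
    refine ⟨G.toRows₁, G.toRows₂, ?_⟩
    rw [← fromCols_mul_fromRows, fromRows_toRows, hG]
  · rintro ⟨G1, G2, hG⟩
    apply rank_of_surj _ (fromRows G1 G2)
    rw [fromCols_mul_fromRows, hG]

lemma rank_le_block {r b : Type} [Fintype r] [DecidableEq r] [Fintype b] [DecidableEq b]
    (x : Matrix (r ⊕ b) (r ⊕ b) K) (h : fromCols (0 : Matrix b r K) (1 : Matrix b b K) * x = 0) :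
    ∃ A X, x = fromBlocks A X 0 0 := by
  obtain ⟨S11, S12, S21, S22, rfl⟩ : ∃ S11 S12 S21 S22, x = fromBlocks S11 S12 S21 S22 :=
        ⟨_, _, _, _, (fromBlocks_toBlocks x).symm⟩
  rw [fromCols_mul_fromBlocks] at h
  simp only [Matrix.zero_mul, Matrix.one_mul, zero_add] at h
  have h1 : S21 = 0 := by
    ext i j; exact congrFun (congrFun h i) (Sum.inl j)
  have h2 : S22 = 0 := by
    ext i j; exact congrFun (congrFun h i) (Sum.inr j)
  exact ⟨S11, S12, by rw [h1, h2]⟩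

/-- order of the parabolic subgroup -/
lemma card_parab (r b : ℕ) :
    Nat.card {g : GL (Fin r ⊕ Fin b) K // (g : Matrix (Fin r ⊕ Fin b) (Fin r ⊕ Fin b) K).toBlocks₂₁ = 0} =
      Nat.card (GL (Fin r) K) * (Nat.card (GL (Fin b) K) * Fintype.card K ^ (r * b)) := by
  let f : GL (Fin r) K × GL (Fin b) K × Matrix (Fin r) (Fin b) K →
      {g : GL (Fin r ⊕ Fin b) K // (g : Matrix (Fin r ⊕ Fin b) (Fin r ⊕ Fin b) K).toBlocks₂₁ = 0} :=
    fun x => ⟨(Matrix.isUnit_fromBlocks_zero₂₁.mpr ⟨x.1.isUnit, x.2.1.isUnit⟩ :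
      IsUnit (fromBlocks (x.1 : Matrix _ _ K) x.2.2 0 (x.2.1 : Matrix _ _ K))).unit, by
        rw [IsUnit.unit_spec, toBlocks_fromBlocks₂₁]⟩
  have hf : Function.Bijective f := by
    constructor
    · rintro ⟨g, h, X⟩ ⟨g', h', X'⟩ hh
      have h1 := congrArg (fun z => (z.1 : Matrix (Fin r ⊕ Fin b) (Fin r ⊕ Fin b) K)) hh
      simp only [f, IsUnit.unit_spec] at h1
      obtain ⟨a, b', _, d⟩ := fromBlocks_inj.mp h1
      have a' := Units.ext a
      have d' := Units.ext d
      subst a' d' b'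
      rfl
    · rintro ⟨g, hg⟩
      have hu := g.isUnit
      rw [← fromBlocks_toBlocks (g : Matrix (Fin r ⊕ Fin b) (Fin r ⊕ Fin b) K), hg,
        Matrix.isUnit_fromBlocks_zero₂₁] at hu
      refine ⟨(hu.1.unit, hu.2.unit, (g : Matrix (Fin r ⊕ Fin b) (Fin r ⊕ Fin b) K).toBlocks₁₂), ?_⟩
      apply Subtype.ext
      apply Units.ext
      simp only [f, IsUnit.unit_spec]
      conv_rhs => rw [← fromBlocks_toBlocks (g : Matrix (Fin r ⊕ Fin b) (Fin r ⊕ Fin b) K), hg]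
  have := Nat.card_congr (Equiv.ofBijective f hf)
  rw [← this, Nat.card_prod, Nat.card_prod, card_mat]
  simp

variable {q : ℕ} (hK : Fintype.card K = q ^ 2) (hs : ∀ a : K, star a = a ^ q)

lemma Wt_step (hK : Fintype.card K = q ^ 2) (hs : ∀ a : K, star a = a ^ q) (f : Bool) {r b : ℕ} (A : Matrix (Fin r) (Fin r) K) (X : Matrix (Fin r) (Fin b) K) (h : Sj A X)
    (c m : ℕ) (hc : A.rank + c = r) (hm : c + m = b) :
    Wt f (fromBlocks A X 0 0 : Matrix (Fin r ⊕ Fin b) (Fin r ⊕ Fin b) K) =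
      Wt f A * (((q : ℝ) ^ 2) ^ (c * b + c * m) * (coef K q f m * Nat.card (GL (Fin m) K))) := by
  obtain ⟨c', m', h1, h2, h3⟩ := Hc_step hK hs A X h
  simp only [Fintype.card_fin] at h1 h2
  obtain rfl : c' = c := by omega
  obtain rfl : m' = m := by omega
  have hg := (GL_pos (K := K) (Fin m')).ne'
  unfold Wt coef
  rw [Lc_step hK hs A X h, h3, Fintype.card_fin, ← h2, div_mul_cancel₀ _ hg]
  push_cast
  rcases f with _ | _
  · simp only [Bool.false_eq_true, if_false]
    ring
  · simp only [if_true]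
    ring

open Classical in
lemma inner_sum (hK : Fintype.card K = q ^ 2) (hs : ∀ a : K, star a = a ^ q) (f : Bool) {r b : ℕ} (A : Matrix (Fin r) (Fin r) K)
    (c : ℕ) (hc : A.rank + c = r) :
    ∑ X : Matrix (Fin r) (Fin b) K with Sj A X, Wt f (fromBlocks A X 0 0 : Matrix (Fin r ⊕ Fin b) (Fin r ⊕ Fin b) K) =
      if c ≤ b then Wt f A * (coef K q f (b - c) * (((q : ℝ) ^ 2) ^ (r * b) * Nat.card (GL (Fin b) K))) else 0 := by
  have hN := ext_iff_surj (b := Fin b) A c (by simpa using hc)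
  split_ifs with hcb
  · obtain ⟨m, rfl⟩ := Nat.exists_eq_add_of_le hcb
    rw [Finset.sum_congr rfl (fun X hX => Wt_step hK hs f A X (by simpa using hX) c m hc rfl)]
    rw [Finset.sum_const, nsmul_eq_mul, Nat.add_sub_cancel_left]
    have h2 := card_surj (K := K) c m
    have h3 : (Finset.univ.filter (fun X : Matrix (Fin r) (Fin (c + m)) K => Sj A X)).card =
      Nat.card {X : Matrix (Fin r) (Fin (c + m)) K // Sj A X} := by
      rw [Nat.card_eq_fintype_card, Fintype.card_subtype]
    rw [h3, hN, hK, ← h2, hK, Fintype.card_fin]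
    have : r = A.rank + c := hc.symm
    have e : ((q : ℝ) ^ 2) ^ (r * (c + m)) = ((q : ℝ) ^ 2) ^ (A.rank * (c + m)) * ((q : ℝ) ^ 2) ^ (c * (c + m)) := by
      rw [← pow_add, ← add_mul, hc]
    rw [e]
    push_cast
    ring
  · rw [card_surj_zero c b (by omega), mul_zero] at hN
    rw [Finset.filter_eq_empty_iff.mpr, Finset.sum_empty]
    intro X _ hX
    have : 0 < Nat.card {X : Matrix (Fin r) (Fin b) K // Sj A X} :=
      Nat.card_pos_iff.mpr ⟨⟨⟨X, hX⟩⟩, inferInstance⟩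
    omega

/-- the sum over nilpotent matrices of given corank -/
noncomputable def TT (K : Type) [Field K] [Fintype K] [StarRing K] (f : Bool) (n b : ℕ) : ℝ := by
  classical exact
  (∑ A : Matrix (Fin n) (Fin n) K with IsNilpotent A ∧ A.rank + b = n, Wt f A) / Nat.card (GL (Fin n) K)

open Classical in
lemma orbit_rank (hK : Fintype.card K = q ^ 2) (f : Bool) (r b : ℕ) :
    ((Nat.card (GL (Fin r) K) * (Nat.card (GL (Fin b) K) * (q ^ 2) ^ (r * b)) : ℕ) : ℝ) *
      ∑ A : Matrix (Fin r ⊕ Fin b) (Fin r ⊕ Fin b) K with IsNilpotent A ∧ A.rank = r, Wt f A =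
    Nat.card (GL (Fin r ⊕ Fin b) K) *
      ∑ A : Matrix (Fin r ⊕ Fin b) (Fin r ⊕ Fin b) K with
        (IsNilpotent A ∧ A.rank = r) ∧ fromCols (0 : Matrix (Fin b) (Fin r) K) (1 : Matrix (Fin b) (Fin b) K) * A = 0, Wt f A := by
  rw [← hK, ← card_parab]
  refine orbit_count (G := GL (Fin r ⊕ Fin b) K) (Ω := Matrix (Fin r ⊕ Fin b) (Fin r ⊕ Fin b) K)
    (fun g A => (g : Matrix (Fin r ⊕ Fin b) (Fin r ⊕ Fin b) K) * A * (g⁻¹ : GL (Fin r ⊕ Fin b) K)) ?_ ?_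
    (fun A => IsNilpotent A ∧ A.rank = r)
    (fun A => (IsNilpotent A ∧ A.rank = r) ∧ fromCols (0 : Matrix (Fin b) (Fin r) K) (1 : Matrix (Fin b) (Fin b) K) * A = 0)
    (fun g => (g : Matrix (Fin r ⊕ Fin b) (Fin r ⊕ Fin b) K).toBlocks₂₁ = 0) _ ?_ ?_ ?_ ?_ ?_
  · intro x; simp
  · intro g h x; simp [Matrix.mul_assoc]
  · intro g x _
    exact Wt_conj f _ _ (by simp) (by simp) x
  · rintro g x ⟨h1, h2⟩
    constructor
    · obtain ⟨k, hk⟩ := h1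
      refine ⟨k, ?_⟩
      rw [Units.conj_pow, hk]; simp
    · rw [rank_mul_eq_left_of_isUnit_det _ _ ((isUnit_iff_isUnit_det _).mp (Units.isUnit _)),
        rank_mul_eq_right_of_isUnit_det _ _ ((isUnit_iff_isUnit_det _).mp (Units.isUnit _)), h2]
  · rintro x ⟨h, _⟩; exact h
  · rintro x ⟨h1, h2⟩
    obtain ⟨C, hC⟩ := Submodule.exists_isCompl (LinearMap.range x.mulVecLin)
    have hCc : Module.finrank K C = b := by
      have := Submodule.finrank_add_eq_of_isCompl hC
      rw [show Module.finrank K (LinearMap.range x.mulVecLin) = x.rank from rfl] at this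
      simp at this
      omega
    obtain ⟨p1, p2, p1', p2', h1', h11, h22, h12, h21, hW, hW'⟩ := adapted _ C hC (d := r) h2 hCc
    let g : GL (Fin r ⊕ Fin b) K := ⟨fromRows p1' p2', fromCols p1 p2,
      by rw [fromRows_mul_fromCols, h11, h22, h12, h21]; simp, by rw [fromCols_mul_fromRows, h1']⟩
    have hx : p2' * x = 0 := by
      apply mat_eq_zero
      intro v
      rw [← mulVec_mulVec, ← hW]
      exact ⟨v, rfl⟩
    refine ⟨g, ⟨?_, ?_⟩, ?_⟩
    · obtain ⟨k, hk⟩ := h1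
      refine ⟨k, ?_⟩
      rw [Units.conj_pow, hk]; simp
    · rw [rank_mul_eq_left_of_isUnit_det _ _ ((isUnit_iff_isUnit_det _).mp (Units.isUnit _)),
        rank_mul_eq_right_of_isUnit_det _ _ ((isUnit_iff_isUnit_det _).mp (Units.isUnit _)), h2]
    · have : fromCols (0 : Matrix (Fin b) (Fin r) K) (1 : Matrix (Fin b) (Fin b) K) * (g : Matrix (Fin r ⊕ Fin b) (Fin r ⊕ Fin b) K) = p2' := by
        show fromCols (0 : Matrix (Fin b) (Fin r) K) (1 : Matrix (Fin b) (Fin b) K) * fromRows p1' p2' = p2'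
        rw [fromCols_mul_fromRows]; simp
      rw [← Matrix.mul_assoc, ← Matrix.mul_assoc, this, hx, Matrix.zero_mul]
  · rintro g x ⟨⟨h1, h2⟩, h3⟩
    obtain ⟨A, X, rfl⟩ := rank_le_block x h3
    have hS : Sj A X := (rank_block A X).mp (by simpa using h2)
    constructor
    · rintro ⟨-, h4⟩
      have h5 : fromCols (0 : Matrix (Fin b) (Fin r) K) (1 : Matrix (Fin b) (Fin b) K) * ((g : Matrix (Fin r ⊕ Fin b) (Fin r ⊕ Fin b) K) * fromBlocks A X 0 0) = 0 := by
        have := congrArg (fun z => z * (g : Matrix (Fin r ⊕ Fin b) (Fin r ⊕ Fin b) K)) h4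
        simpa [Matrix.mul_assoc] using this
      rw [← fromBlocks_toBlocks (g : Matrix (Fin r ⊕ Fin b) (Fin r ⊕ Fin b) K), fromBlocks_multiply,
        fromCols_mul_fromBlocks] at h5
      simp only [Matrix.zero_mul, Matrix.one_mul, zero_add, Matrix.mul_zero, add_zero] at h5
      set g21 := (g : Matrix (Fin r ⊕ Fin b) (Fin r ⊕ Fin b) K).toBlocks₂₁
      have e1 : g21 * A = 0 := by ext i j; exact congrFun (congrFun h5 i) (Sum.inl j)
      have e2 : g21 * X = 0 := by ext i j; exact congrFun (congrFun h5 i) (Sum.inr j)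
      obtain ⟨G1, G2, hG⟩ := hS
      rw [← Matrix.mul_one g21, ← hG, Matrix.mul_add, ← Matrix.mul_assoc, ← Matrix.mul_assoc, e1, e2]
      simp
    · intro h4
      refine ⟨⟨?_, ?_⟩, ?_⟩
      · obtain ⟨k, hk⟩ := h1
        refine ⟨k, ?_⟩
        rw [Units.conj_pow, hk]; simp
      · rw [rank_mul_eq_left_of_isUnit_det _ _ ((isUnit_iff_isUnit_det _).mp (Units.isUnit _)),
          rank_mul_eq_right_of_isUnit_det _ _ ((isUnit_iff_isUnit_det _).mp (Units.isUnit _)), h2]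
      · rw [← Matrix.mul_assoc, ← fromBlocks_toBlocks (g : Matrix (Fin r ⊕ Fin b) (Fin r ⊕ Fin b) K), h4, fromBlocks_multiply,
          fromCols_mul_fromBlocks]
        have : (fromCols 0 0 : Matrix (Fin b) (Fin r ⊕ Fin b) K) = 0 := by simp
        simp [this]

lemma reindex_eq {n n' : Type} [Fintype n] [DecidableEq n] [Fintype n'] [DecidableEq n'] (e : n ≃ n')
    (A : Matrix n n K) : reindex e e A =
      (1 : Matrix n n K).submatrix e.symm id * A * (1 : Matrix n n K).submatrix id e.symm := by
  ext i j
  simp [Matrix.mul_apply, Matrix.one_apply]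

lemma Wt_reindex (f : Bool) {n n' : Type} [Fintype n] [DecidableEq n] [Fintype n'] [DecidableEq n'] (e : n ≃ n')
    (A : Matrix n n K) : Wt f (reindex e e A) = Wt f A := by
  rw [reindex_eq]
  apply Wt_conj
  · ext i j; simp [Matrix.mul_apply, Matrix.one_apply]
  · have h : (1 : Matrix n n K).submatrix id e.symm * (1 : Matrix n n K).submatrix e.symm id = 1 := by
      rw [submatrix_mul_equiv]; simp
    exact h

lemma card_GL_reindex {n n' : Type} [Fintype n] [DecidableEq n] [Fintype n'] [DecidableEq n'] (e : n ≃ n') :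
    Nat.card (GL n K) = Nat.card (GL n' K) :=
  Nat.card_congr (Units.mapEquiv (reindexRingEquiv K e).toMulEquiv).toEquiv

lemma nilp_reindex {n n' : Type} [Fintype n] [DecidableEq n] [Fintype n'] [DecidableEq n'] (e : n ≃ n')
    (A : Matrix n n K) : IsNilpotent (reindex e e A) ↔ IsNilpotent A :=
  IsNilpotent.map_iff (f := reindexRingEquiv K e) (reindexRingEquiv K e).injective

open Classical in
lemma TT_rec (hK : Fintype.card K = q ^ 2) (hs : ∀ a : K, star a = a ^ q) (f : Bool) (r b : ℕ) :
    TT K f (r + b) b = ∑ c ∈ Finset.range (b + 1), coef K q f (b - c) * TT K f r c := by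
  have h0 := orbit_rank hK f r b
  have hr := GL_pos (K := K) (Fin r)
  have hb := GL_pos (K := K) (Fin b)
  have hrb := GL_pos (K := K) (Fin r ⊕ Fin b)
  have hq : (0 : ℝ) < ((q : ℝ) ^ 2) ^ (r * b) := by
    have := two_le_q hK
    positivity
  have h1 : TT K f (r + b) b = (∑ A : Matrix (Fin r ⊕ Fin b) (Fin r ⊕ Fin b) K with IsNilpotent A ∧ A.rank = r, Wt f A) /
      Nat.card (GL (Fin r ⊕ Fin b) K) := by
    unfold TT
    rw [card_GL_reindex (finSumFinEquiv (m := r) (n := b)).symm]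
    congr 1
    refine Finset.sum_equiv (reindex finSumFinEquiv.symm finSumFinEquiv.symm) ?_ ?_
    · intro A
      simp only [Finset.mem_filter, Finset.mem_univ, true_and]
      rw [nilp_reindex, rank_reindex]
      simp
    · intro A _
      rw [Wt_reindex]
  have h2 : (∑ A : Matrix (Fin r ⊕ Fin b) (Fin r ⊕ Fin b) K with
        (IsNilpotent A ∧ A.rank = r) ∧ fromCols (0 : Matrix (Fin b) (Fin r) K) (1 : Matrix (Fin b) (Fin b) K) * A = 0, Wt f A) =
      ∑ A : Matrix (Fin r) (Fin r) K with IsNilpotent A, 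
        ∑ X : Matrix (Fin r) (Fin b) K with Sj A X, Wt f (fromBlocks A X 0 0 : Matrix (Fin r ⊕ Fin b) (Fin r ⊕ Fin b) K) := by
    rw [Finset.sum_sigma']
    symm
    refine Finset.sum_bij (fun x _ => fromBlocks x.1 x.2 0 0) ?_ ?_ ?_ ?_
    · rintro ⟨A, X⟩ hx
      simp only [Finset.mem_sigma, Finset.mem_filter, Finset.mem_univ, true_and] at hx ⊢
      refine ⟨⟨(nilp_block A X).mpr hx.1, by simpa using (rank_block A X).mpr hx.2⟩, ?_⟩
      rw [fromCols_mul_fromBlocks]; simp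
    · rintro ⟨A, X⟩ hx ⟨A', X'⟩ hx' hh
      obtain ⟨a, b, _⟩ := fromBlocks_inj.mp hh
      simp only at a b
      subst a b; rfl
    · intro x hx
      simp only [Finset.mem_filter, Finset.mem_univ, true_and] at hx
      obtain ⟨⟨h3, h4⟩, h5⟩ := hx
      obtain ⟨A, X, rfl⟩ := rank_le_block x h5
      refine ⟨⟨A, X⟩, ?_, rfl⟩
      simp only [Finset.mem_sigma, Finset.mem_filter, Finset.mem_univ, true_and]
      exact ⟨(nilp_block A X).mp h3, (rank_block A X).mp (by simpa using h4)⟩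
    · intro x _; rfl
  have h3 : (∑ A : Matrix (Fin r) (Fin r) K with IsNilpotent A, 
        ∑ X : Matrix (Fin r) (Fin b) K with Sj A X, Wt f (fromBlocks A X 0 0 : Matrix (Fin r ⊕ Fin b) (Fin r ⊕ Fin b) K)) =
      ∑ c ∈ Finset.range (b + 1), (∑ A : Matrix (Fin r) (Fin r) K with IsNilpotent A ∧ A.rank + c = r, Wt f A) *
        (coef K q f (b - c) * (((q : ℝ) ^ 2) ^ (r * b) * Nat.card (GL (Fin b) K))) := by
    simp only [Finset.sum_filter (fun A : Matrix (Fin r) (Fin r) K => IsNilpotent A ∧ _), Finset.sum_mul]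
    rw [Finset.sum_comm, Finset.sum_filter]
    apply Finset.sum_congr rfl
    intro A _
    obtain ⟨c, hc⟩ : ∃ c, A.rank + c = r := by
      have := rank_le_card_height A
      simp at this
      exact ⟨r - A.rank, by omega⟩
    rw [inner_sum hK hs f A c hc]
    by_cases hA : IsNilpotent A
    · simp only [hA, if_true, true_and]
      have : ∀ x, A.rank + x = r ↔ c = x := by intro x; omega
      simp only [this, ite_mul, zero_mul]
      rw [Finset.sum_ite_eq]
      simp [Nat.lt_succ_iff]
    · simp [hA]
  rw [h2, h3] at h0
  rw [h1, div_eq_iff hrb.ne']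
  push_cast at h0
  have h4 : ((Nat.card (GL (Fin r) K) : ℝ) * ((Nat.card (GL (Fin b) K) : ℝ) * ((q : ℝ) ^ 2) ^ (r * b))) ≠ 0 := by positivity
  apply mul_left_cancel₀ h4
  rw [h0, Finset.mul_sum, Finset.sum_mul, Finset.mul_sum]
  apply Finset.sum_congr rfl
  intro c _
  unfold TT
  field_simp

end rec
end FF

namespace FF

section fitting
variable {K : Type} [Field K] [Fintype K] [StarRing K]

/-- triples of matrices -/
abbrev Tr (K n : Type) : Type := Matrix n n K × Matrix n n K × Matrix n n K

/-- `(h, A, B)`: `h` a nondegenerate form, `A`, `B` commuting and self-adjoint, `A` nilpotent -/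
def V {n : Type} [Fintype n] [DecidableEq n] (x : Tr K n) : Prop :=
  (x.1.IsHermitian ∧ IsUnit x.1) ∧ (x.1 * x.2.1).IsHermitian ∧ (x.1 * x.2.2).IsHermitian ∧
    x.2.1 * x.2.2 = x.2.2 * x.2.1 ∧ IsNilpotent x.2.1

def actT {n n' : Type} [Fintype n] [Fintype n'] (p : Matrix n' n K) (p' : Matrix n n' K) (x : Tr K n) : Tr K n' :=
  (p'ᴴ * x.1 * p', p * x.2.1 * p', p * x.2.2 * p')

section
variable {n n' : Type} [Fintype n] [DecidableEq n] [Fintype n'] [DecidableEq n']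

lemma conj_mul (p : Matrix n' n K) (p' : Matrix n n' K) (h2 : p' * p = 1) (A B : Matrix n n K) :
    (p * A * p') * (p * B * p') = p * (A * B) * p' := by
  calc (p * A * p') * (p * B * p') = p * A * (p' * p) * B * p' := by simp only [Matrix.mul_assoc]
    _ = _ := by rw [h2]; simp only [Matrix.mul_assoc, Matrix.one_mul]

lemma conj_pow (p : Matrix n' n K) (p' : Matrix n n' K) (h1 : p * p' = 1) (h2 : p' * p = 1) (A : Matrix n n K) (k : ℕ) :
    (p * A * p') ^ k = p * A ^ k * p' := by
  induction k with
  | zero => simp [h1]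
  | succ k ih => rw [pow_succ, ih, conj_mul p p' h2, pow_succ]

lemma nilp_conj (p : Matrix n' n K) (p' : Matrix n n' K) (h1 : p * p' = 1) (h2 : p' * p = 1) {A : Matrix n n K}
    (h : IsNilpotent A) : IsNilpotent (p * A * p') := by
  obtain ⟨k, hk⟩ := h
  exact ⟨k, by rw [conj_pow p p' h1 h2, hk]; simp⟩

lemma V_act (p : Matrix n' n K) (p' : Matrix n n' K) (h1 : p * p' = 1) (h2 : p' * p = 1) {x : Tr K n} (hx : V x) :
    V (actT p p' x) := by
  obtain ⟨⟨a, b⟩, c, d, e, f⟩ := hx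
  refine ⟨⟨herm_conj p' a, isUnit_conj p p' h1 h2 b⟩, sa_conj p p' h2 c, sa_conj p p' h2 d, ?_, ?_⟩
  · show (p * _ * p') * (p * _ * p') = (p * _ * p') * (p * _ * p')
    rw [conj_mul p p' h2, conj_mul p p' h2, e]
  · exact nilp_conj p p' h1 h2 f

lemma act_act (p : Matrix n' n K) (p' : Matrix n n' K) (h2 : p' * p = 1) (x : Tr K n) :
    actT p' p (actT p p' x) = x := by
  refine Prod.ext ?_ (Prod.ext ?_ ?_)
  · show pᴴ * (p'ᴴ * x.1 * p') * p = x.1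
    have e : pᴴ * (p'ᴴ * x.1 * p') * p = (p' * p)ᴴ * x.1 * (p' * p) := by
      rw [conjTranspose_mul]; simp only [Matrix.mul_assoc]
    rw [e, h2]; simp
  · exact conj_conj p p' h2 _
  · exact conj_conj p p' h2 _

lemma rank_conj (p : Matrix n' n K) (p' : Matrix n n' K) (h1 : p * p' = 1) (h2 : p' * p = 1) (A : Matrix n n K) :
    (p * A * p').rank = A.rank := by
  have key : ∀ {n n' : Type} [Fintype n] [DecidableEq n] [Fintype n'] [DecidableEq n'] (p : Matrix n' n K) (p' : Matrix n n' K) (A : Matrix n n K),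
    (p * A * p').rank ≤ A.rank := fun p p' A =>
      (rank_mul_le_left _ _).trans (rank_mul_le_right _ _)
  apply le_antisymm (key _ _ _)
  conv_lhs => rw [← conj_conj p p' h2 A]
  exact key _ _ _

/-- the stable rank -/
def SR {n : Type} [Fintype n] [DecidableEq n] (B : Matrix n n K) (l : ℕ) : Prop := ∀ᶠ m in Filter.atTop, (B ^ m).rank = l

lemma SR_conj (p : Matrix n' n K) (p' : Matrix n n' K) (h1 : p * p' = 1) (h2 : p' * p = 1) {B : Matrix n n K} {l : ℕ}
    (h : SR B l) : SR (p * B * p') l := by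
  unfold SR at *
  filter_upwards [h] with m hm
  rw [conj_pow p p' h1 h2, rank_conj p p' h1 h2, hm]

lemma SR_unique {B : Matrix n n K} {l l' : ℕ} (h : SR B l) (h' : SR B l') : l = l' := by
  obtain ⟨m, a, b⟩ := (Filter.Eventually.and h h').exists
  omega

lemma SR_exists (B : Matrix n n K) : ∃ l ≤ Fintype.card n, SR B l := by
  obtain ⟨m, hm⟩ : ∃ m, ∀ m', m ≤ m' → LinearMap.range ((B.toLin') ^ m) = LinearMap.range ((B.toLin') ^ m') :=
    IsArtinian.monotone_stabilizes B.toLin'.iterateRange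
  refine ⟨(B ^ m).rank, rank_le_card_height _, ?_⟩
  unfold SR
  filter_upwards [Filter.eventually_ge_atTop m] with m' h'
  have := hm m' h'
  rw [← toLin'_pow, ← toLin'_pow] at this
  unfold Matrix.rank
  rw [← toLin'_apply', ← toLin'_apply', this]

end

lemma syl1 {k l : Type} [Fintype k] [Fintype l] [DecidableEq k] [DecidableEq l] (B1 : Matrix k k K) (B2 : Matrix l l K)
    (h1 : IsNilpotent B1) (h2 : IsUnit B2) (X : Matrix k l K) (h : X * B2 = B1 * X) : X = 0 := by
  have key : ∀ m, X * B2 ^ m = B1 ^ m * X := by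
    intro m
    induction m with
    | zero => simp
    | succ m ih => rw [pow_succ, ← Matrix.mul_assoc, ih, Matrix.mul_assoc, h, pow_succ, Matrix.mul_assoc]
  obtain ⟨m, hm⟩ := h1
  have := key m
  rw [hm, Matrix.zero_mul] at this
  obtain ⟨C, hC⟩ := (h2.pow m).exists_right_inv
  rw [← Matrix.mul_one X, ← hC, ← Matrix.mul_assoc, this, Matrix.zero_mul]

lemma syl2 {k l : Type} [Fintype k] [Fintype l] [DecidableEq k] [DecidableEq l] (B1 : Matrix k k K) (B2 : Matrix l l K)
    (h1 : IsNilpotent B1) (h2 : IsUnit B2) (X : Matrix l k K) (h : B2 * X = X * B1) : X = 0 := by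
  have h3 : Xᵀ = 0 := by
    apply syl1 B1ᵀ B2ᵀ _ _ Xᵀ
    · rw [← transpose_mul, h, transpose_mul]
    · obtain ⟨m, hm⟩ := h1
      exact ⟨m, by rw [← transpose_pow, hm]; simp⟩
    · exact isUnit_transpose B2 |>.mpr h2
  simpa using congrArg transpose h3

/-- normal form of `B` -/
def Dg {k l : Type} [Fintype k] [DecidableEq k] [Fintype l] [DecidableEq l] (B : Matrix (k ⊕ l) (k ⊕ l) K) : Prop :=
  ∃ (B1 : Matrix k k K) (B2 : Matrix l l K), B = fromBlocks B1 0 0 B2 ∧ IsNilpotent B1 ∧ IsUnit B2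

lemma fb_diag_pow {k l : Type} [Fintype k] [DecidableEq k] [Fintype l] [DecidableEq l] (B1 : Matrix k k K) (B2 : Matrix l l K) (m : ℕ) :
    (fromBlocks B1 0 0 B2) ^ m = fromBlocks (B1 ^ m) 0 0 (B2 ^ m) := by
  induction m with
  | zero => simp
  | succ m ih => rw [pow_succ, ih, fromBlocks_multiply]; simp [pow_succ]

lemma Dg_SR {k l : ℕ} {B : Matrix (Fin k ⊕ Fin l) (Fin k ⊕ Fin l) K} (h : Dg B) : SR B l := by
  obtain ⟨B1, B2, rfl, ⟨m, hm⟩, h2⟩ := h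
  unfold SR
  filter_upwards [Filter.eventually_ge_atTop m] with m' h'
  have h0 : B1 ^ m' = 0 := pow_eq_zero_of_le h' hm
  rw [fb_diag_pow, h0]
  obtain ⟨C, hC⟩ := (h2.pow m').exists_right_inv
  have e1 : (fromBlocks 0 0 0 (B2 ^ m') : Matrix (Fin k ⊕ Fin l) (Fin k ⊕ Fin l) K) =
    fromRows (0 : Matrix (Fin k) (Fin l) K) (B2 ^ m') * fromCols (0 : Matrix (Fin l) (Fin k) K) (1 : Matrix (Fin l) (Fin l) K) := by
    rw [fromRows_mul_fromCols]; simp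
  have e2 : fromCols (0 : Matrix (Fin l) (Fin k) K) (1 : Matrix (Fin l) (Fin l) K) *
    ((fromBlocks 0 0 0 (B2 ^ m') : Matrix (Fin k ⊕ Fin l) (Fin k ⊕ Fin l) K) * fromRows (0 : Matrix (Fin k) (Fin l) K) C) = 1 := by
    rw [fromBlocks_mul_fromRows, fromCols_mul_fromRows]; simp [hC]
  apply le_antisymm
  · rw [e1]
    refine (rank_mul_le_right _ _).trans ?_
    simpa using rank_le_card_height (fromCols (0 : Matrix (Fin l) (Fin k) K) (1 : Matrix (Fin l) (Fin l) K))
  · have h3 := (rank_mul_le_right (fromCols (0 : Matrix (Fin l) (Fin k) K) (1 : Matrix (Fin l) (Fin l) K))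
      ((fromBlocks 0 0 0 (B2 ^ m') : Matrix (Fin k ⊕ Fin l) (Fin k ⊕ Fin l) K) * fromRows (0 : Matrix (Fin k) (Fin l) K) C)).trans (rank_mul_le_left _ _)
    rw [e2, rank_one] at h3
    simpa using h3

lemma exists_Dg {k l : ℕ} {B : Matrix (Fin k ⊕ Fin l) (Fin k ⊕ Fin l) K} (h : SR B l) :
    ∃ g : GL (Fin k ⊕ Fin l) K, Dg ((g : Matrix (Fin k ⊕ Fin l) (Fin k ⊕ Fin l) K) * B * ((g⁻¹ : GL (Fin k ⊕ Fin l) K) : Matrix (Fin k ⊕ Fin l) (Fin k ⊕ Fin l) K)) := by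
  obtain ⟨m, ⟨h1, h2⟩, h3⟩ := ((h.and (LinearMap.eventually_isCompl_ker_pow_range_pow B.toLin')).and
    (Filter.eventually_ge_atTop 1)).exists
  rw [← toLin'_pow, toLin'_apply'] at h2
  have hd : Module.finrank K (LinearMap.range (B ^ m).mulVecLin) = l := h1
  have hk : Module.finrank K (LinearMap.ker (B ^ m).mulVecLin) = k := by
    have := Submodule.finrank_add_eq_of_isCompl h2
    simp only [Module.finrank_fintype_fun_eq_card, Fintype.card_sum, Fintype.card_fin] at this
    omega
  obtain ⟨p1, p2, p1', p2', h1', h11, h22, h12, h21, hW, hW'⟩ := adapted _ _ h2 hk hd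
  let g : GL (Fin k ⊕ Fin l) K := ⟨fromRows p1' p2', fromCols p1 p2,
      by rw [fromRows_mul_fromCols, h11, h22, h12, h21]; simp, by rw [fromCols_mul_fromRows, h1']⟩
  have a1 : p2' * (B * p1) = 0 := by
    apply mat_eq_zero
    intro v
    rw [← mulVec_mulVec, ← hW, LinearMap.mem_ker, mulVecLin_apply]
    have : (B ^ m).mulVecLin (p1 *ᵥ v) = 0 := by
      rw [← LinearMap.mem_ker, hW, mulVec_mulVec, h21, zero_mulVec]
    rw [mulVecLin_apply] at this
    rw [← mulVec_mulVec, mulVec_mulVec, ← pow_succ, pow_succ', ← mulVec_mulVec, this, mulVec_zero]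
  have a2 : p1' * (B * p2) = 0 := by
    apply mat_eq_zero
    intro v
    rw [← mulVec_mulVec, ← hW']
    have : p2 *ᵥ v ∈ LinearMap.range (B ^ m).mulVecLin := by
      rw [hW', mulVec_mulVec, h12, zero_mulVec]
    obtain ⟨w, hw⟩ := this
    refine ⟨B *ᵥ w, ?_⟩
    rw [← mulVec_mulVec, ← hw, mulVecLin_apply, mulVecLin_apply, mulVec_mulVec, mulVec_mulVec, ← pow_succ, pow_succ']
  have a3 : B ^ m * p1 = 0 := by
    apply mat_eq_zero
    intro v
    rw [← mulVec_mulVec]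
    have : (B ^ m).mulVecLin (p1 *ᵥ v) = 0 := by
      rw [← LinearMap.mem_ker, hW, mulVec_mulVec, h21, zero_mulVec]
    exact this
  have e : (g : Matrix (Fin k ⊕ Fin l) (Fin k ⊕ Fin l) K) * B * ((g⁻¹ : GL (Fin k ⊕ Fin l) K) : Matrix (Fin k ⊕ Fin l) (Fin k ⊕ Fin l) K) =
      fromBlocks (p1' * (B * p1)) 0 0 (p2' * (B * p2)) := by
    show fromRows p1' p2' * B * fromCols p1 p2 = _
    rw [Matrix.mul_assoc, mul_fromCols, fromRows_mul_fromCols, a1, a2]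
  have e2 := conj_pow (fromRows p1' p2') (fromCols p1 p2) (by rw [fromRows_mul_fromCols, h11, h22, h12, h21]; simp)
    (by rw [fromCols_mul_fromRows, h1']) B m
  refine ⟨g, p1' * (B * p1), p2' * (B * p2), e, ⟨m, ?_⟩, ?_⟩
  · have e3 : (fromRows p1' p2' * B * fromCols p1 p2) = fromBlocks (p1' * (B * p1)) 0 0 (p2' * (B * p2)) := e
    rw [e3, fb_diag_pow, Matrix.mul_assoc, mul_fromCols, fromRows_mul_fromCols, a3] at e2
    have := (fromBlocks_inj.mp e2).1
    simpa using this
  · rw [← mulVec_injective_iff_isUnit, ← coe_mulVecLin, injective_iff_map_eq_zero]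
    intro y hy
    rw [mulVecLin_apply] at hy
    have b1 : B *ᵥ (p2 *ᵥ y) = 0 := by
      have : B *ᵥ (p2 *ᵥ y) = (p1 * (p1' * (B * p2)) + p2 * (p2' * (B * p2))) *ᵥ y := by
        rw [← Matrix.mul_assoc p1, ← Matrix.mul_assoc p2, ← Matrix.add_mul, h1', Matrix.one_mul, mulVec_mulVec]
      rw [this, a2, Matrix.mul_zero, zero_add, ← mulVec_mulVec, hy, mulVec_zero]
    have b2 : p2 *ᵥ y ∈ LinearMap.ker (B ^ m).mulVecLin := by
      rw [LinearMap.mem_ker, mulVecLin_apply]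
      obtain ⟨m', rfl⟩ : ∃ m', m = m' + 1 := ⟨m - 1, by omega⟩
      rw [pow_succ, ← mulVec_mulVec, b1, mulVec_zero]
    rw [hW, mulVec_mulVec, h22, one_mulVec] at b2
    exact b2

end fitting
end FF

namespace FF

section fitting2
variable {K : Type} [Field K] [Fintype K] [StarRing K]

lemma card_levi (r b : ℕ) :
    Nat.card {g : GL (Fin r ⊕ Fin b) K // (g : Matrix (Fin r ⊕ Fin b) (Fin r ⊕ Fin b) K).toBlocks₁₂ = 0 ∧ 
      (g : Matrix (Fin r ⊕ Fin b) (Fin r ⊕ Fin b) K).toBlocks₂₁ = 0} =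
      Nat.card (GL (Fin r) K) * Nat.card (GL (Fin b) K) := by
  let f : GL (Fin r) K × GL (Fin b) K →
      {g : GL (Fin r ⊕ Fin b) K // (g : Matrix (Fin r ⊕ Fin b) (Fin r ⊕ Fin b) K).toBlocks₁₂ = 0 ∧ 
      (g : Matrix (Fin r ⊕ Fin b) (Fin r ⊕ Fin b) K).toBlocks₂₁ = 0} :=
    fun x => ⟨(Matrix.isUnit_fromBlocks_zero₂₁.mpr ⟨x.1.isUnit, x.2.isUnit⟩ :
      IsUnit (fromBlocks (x.1 : Matrix _ _ K) 0 0 (x.2 : Matrix _ _ K))).unit, by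
        rw [IsUnit.unit_spec, toBlocks_fromBlocks₂₁, toBlocks_fromBlocks₁₂]; exact ⟨rfl, rfl⟩⟩
  have hf : Function.Bijective f := by
    constructor
    · rintro ⟨g, h⟩ ⟨g', h'⟩ hh
      have h1 := congrArg (fun z => (z.1 : Matrix (Fin r ⊕ Fin b) (Fin r ⊕ Fin b) K)) hh
      simp only [f, IsUnit.unit_spec] at h1
      obtain ⟨a, b', _, d⟩ := fromBlocks_inj.mp h1
      have a' := Units.ext a
      have d' := Units.ext d
      subst a' d'
      rfl
    · rintro ⟨g, hg0, hg⟩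
      have hu := g.isUnit
      rw [← fromBlocks_toBlocks (g : Matrix (Fin r ⊕ Fin b) (Fin r ⊕ Fin b) K), hg,
        Matrix.isUnit_fromBlocks_zero₂₁] at hu
      refine ⟨(hu.1.unit, hu.2.unit), ?_⟩
      apply Subtype.ext
      apply Units.ext
      simp only [f, IsUnit.unit_spec]
      conv_rhs => rw [← fromBlocks_toBlocks (g : Matrix (Fin r ⊕ Fin b) (Fin r ⊕ Fin b) K), hg, hg0]
  have := Nat.card_congr (Equiv.ofBijective f hf)
  rw [← this, Nat.card_prod]

noncomputable def nQ (K : Type) [Field K] [Fintype K] [StarRing K] (n : Type) [Fintype n] [DecidableEq n] : ℕ :=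
  Nat.card {x : Tr K n // V x}
noncomputable def nR (K : Type) [Field K] [Fintype K] [StarRing K] (n : Type) [Fintype n] [DecidableEq n] : ℕ :=
  Nat.card {x : Tr K n // V x ∧ IsUnit x.2.2}
noncomputable def nP (K : Type) [Field K] [Fintype K] [StarRing K] (n : Type) [Fintype n] [DecidableEq n] : ℕ :=
  Nat.card {x : Tr K n // V x ∧ IsNilpotent x.2.2}

/-- block sum of triples -/
def bs {k l : Type} (x : Tr K k) (y : Tr K l) : Tr K (k ⊕ l) :=
  (fromBlocks x.1 0 0 y.1, fromBlocks x.2.1 0 0 y.2.1, fromBlocks x.2.2 0 0 y.2.2)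

lemma herm_diag {k l : Type} (a : Matrix k k K) (b : Matrix l l K) :
    (fromBlocks a 0 0 b).IsHermitian ↔ a.IsHermitian ∧ b.IsHermitian := by
  unfold IsHermitian
  rw [fromBlocks_conjTranspose, fromBlocks_inj]
  simp

lemma V_bs {k l : Type} [Fintype k] [DecidableEq k] [Fintype l] [DecidableEq l] (x : Tr K k) (y : Tr K l) :
    V (bs x y) ↔ V x ∧ V y := by
  unfold V bs
  simp only [fromBlocks_multiply, Matrix.mul_zero, Matrix.zero_mul, add_zero, zero_add, herm_diag, fromBlocks_inj,
    Matrix.isUnit_fromBlocks_zero₂₁]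
  have : IsNilpotent (fromBlocks x.2.1 0 0 y.2.1) ↔ IsNilpotent x.2.1 ∧ IsNilpotent y.2.1 := by
    constructor
    · rintro ⟨m, hm⟩
      rw [fb_diag_pow, ← fromBlocks_zero, fromBlocks_inj] at hm
      exact ⟨⟨m, hm.1⟩, ⟨m, hm.2.2.2⟩⟩
    · rintro ⟨⟨m, hm⟩, ⟨m', hm'⟩⟩
      refine ⟨m + m', ?_⟩
      rw [fb_diag_pow, pow_add, pow_add, hm, hm']
      simp
  rw [this]
  tauto

lemma card_D (k l : Type) [Fintype k] [DecidableEq k] [Fintype l] [DecidableEq l] :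
    Nat.card {x : Tr K (k ⊕ l) // V x ∧ Dg x.2.2} = nP K k * nR K l := by
  let f : {x : Tr K k // V x ∧ IsNilpotent x.2.2} × {x : Tr K l // V x ∧ IsUnit x.2.2} →
      {x : Tr K (k ⊕ l) // V x ∧ Dg x.2.2} := fun z =>
    ⟨bs z.1.1 z.2.1, (V_bs _ _).mpr ⟨z.1.2.1, z.2.2.1⟩, ⟨_, _, rfl, z.1.2.2, z.2.2.2⟩⟩
  have hf : Function.Bijective f := by
    constructor
    · rintro ⟨⟨⟨h, A, B⟩, hx⟩, ⟨⟨h', A', B'⟩, hy⟩⟩ ⟨⟨⟨g, C, D⟩, hx'⟩, ⟨⟨g', C', D'⟩, hy'⟩⟩ hh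
      have h1 := congrArg Subtype.val hh
      simp only [f, bs, Prod.mk.injEq, fromBlocks_inj] at h1
      obtain ⟨⟨a1, -, -, a2⟩, ⟨a3, -, -, a4⟩, ⟨a5, -, -, a6⟩⟩ := h1
      subst a1 a2 a3 a4 a5 a6
      rfl
    · rintro ⟨⟨h, A, B⟩, hV, ⟨B1, B2, hB, hn, hu⟩⟩
      simp only at hB
      subst hB
      obtain ⟨h11, h12, h21, h22, rfl⟩ : ∃ S11 S12 S21 S22, h = fromBlocks S11 S12 S21 S22 :=
        ⟨_, _, _, _, (fromBlocks_toBlocks h).symm⟩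
      obtain ⟨A11, A12, A21, A22, rfl⟩ : ∃ S11 S12 S21 S22, A = fromBlocks S11 S12 S21 S22 :=
        ⟨_, _, _, _, (fromBlocks_toBlocks A).symm⟩
      have hcomm := hV.2.2.2.1
      simp only [fromBlocks_multiply, Matrix.mul_zero, Matrix.zero_mul, add_zero, zero_add, fromBlocks_inj] at hcomm
      obtain ⟨-, c12, c21, -⟩ := hcomm
      have e1 := syl1 B1 B2 hn hu A12 c12
      have e2 := syl2 B1 B2 hn hu A21 c21.symm
      have hh := hV.1.1
      have hhB := hV.2.2.1
      unfold IsHermitian at hh hhB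
      simp only [fromBlocks_multiply, Matrix.mul_zero, Matrix.zero_mul, add_zero, zero_add] at hhB
      rw [fromBlocks_conjTranspose, fromBlocks_inj] at hh hhB
      simp only [conjTranspose_mul] at hhB
      obtain ⟨-, d12, d21, -⟩ := hh
      obtain ⟨-, f12, f21, -⟩ := hhB
      have hn' : IsNilpotent B1ᴴ := by
        obtain ⟨m, hm⟩ := hn
        exact ⟨m, by rw [← conjTranspose_pow, hm]; simp⟩
      have e3 : h12 = 0 := by
        apply syl1 B1ᴴ B2 hn' hu
        rw [← f12, d12]
      have e4 : h21 = 0 := by rw [← d21, e3]; simp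
      subst e1 e2 e3 e4
      have hV' := (V_bs (h11, A11, B1) (h22, A22, B2)).mp hV
      exact ⟨(⟨(h11, A11, B1), hV'.1, hn⟩, ⟨(h22, A22, B2), hV'.2, hu⟩), rfl⟩
  have := Nat.card_congr (Equiv.ofBijective f hf)
  rw [← this, Nat.card_prod]
  rfl

lemma fitting_orbit (k l : ℕ) :
    Nat.card (GL (Fin k) K) * Nat.card (GL (Fin l) K) *
      Nat.card {x : Tr K (Fin k ⊕ Fin l) // V x ∧ SR x.2.2 l} =
    Nat.card (GL (Fin k ⊕ Fin l) K) * (nP K (Fin k) * nR K (Fin l)) := by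
  classical
  rw [← card_D, ← card_levi]
  have h := orbit_count (G := GL (Fin k ⊕ Fin l) K) (Ω := Tr K (Fin k ⊕ Fin l))
    (fun g x => actT (g : Matrix (Fin k ⊕ Fin l) (Fin k ⊕ Fin l) K) ((g⁻¹ : GL (Fin k ⊕ Fin l) K) : Matrix (Fin k ⊕ Fin l) (Fin k ⊕ Fin l) K) x)
    (by intro x; simp [actT]) (by intro g h x; simp [actT, Matrix.mul_assoc])
    (fun x => V x ∧ SR x.2.2 l) (fun x => V x ∧ Dg x.2.2)
    (fun g => (g : Matrix (Fin k ⊕ Fin l) (Fin k ⊕ Fin l) K).toBlocks₁₂ = 0 ∧ 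
      (g : Matrix (Fin k ⊕ Fin l) (Fin k ⊕ Fin l) K).toBlocks₂₁ = 0) (fun _ => 1)
    (by intros; rfl)
    (by
      rintro g x ⟨h1, h2⟩
      exact ⟨V_act _ _ (by simp) (by simp) h1, SR_conj _ _ (by simp) (by simp) h2⟩)
    (by rintro x ⟨h1, h2⟩; exact ⟨h1, Dg_SR h2⟩)
    (by
      rintro x ⟨h1, h2⟩
      obtain ⟨g, hg⟩ := exists_Dg h2
      exact ⟨g, V_act _ _ (by simp) (by simp) h1, hg⟩)
    (by
      rintro g ⟨h, A, B⟩ ⟨h1, B1, B2, hB, hn, hu⟩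
      simp only at hB
      subst hB
      constructor
      · rintro ⟨-, C1, C2, hC, hn', hu'⟩
        have hC' : (g : Matrix (Fin k ⊕ Fin l) (Fin k ⊕ Fin l) K) * fromBlocks B1 0 0 B2 = fromBlocks C1 0 0 C2 * g := by
          rw [← hC]
          simp [actT, Matrix.mul_assoc]
        rw [← fromBlocks_toBlocks (g : Matrix (Fin k ⊕ Fin l) (Fin k ⊕ Fin l) K)] at hC'
        simp only [fromBlocks_multiply, Matrix.mul_zero, Matrix.zero_mul, add_zero, zero_add, fromBlocks_inj] at hC'
        obtain ⟨-, c12, c21, -⟩ := hC'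
        exact ⟨syl1 C1 B2 hn' hu _ c12, syl2 B1 C2 hn hu' _ c21.symm⟩
      · rintro ⟨h12, h21⟩
        refine ⟨V_act _ _ (by simp) (by simp) h1, ?_⟩
        have hgu := g.isUnit
        have hg : (g : Matrix (Fin k ⊕ Fin l) (Fin k ⊕ Fin l) K) = 
          fromBlocks (g : Matrix (Fin k ⊕ Fin l) (Fin k ⊕ Fin l) K).toBlocks₁₁ 0 0 (g : Matrix (Fin k ⊕ Fin l) (Fin k ⊕ Fin l) K).toBlocks₂₂ := by
          conv_lhs => rw [← fromBlocks_toBlocks (g : Matrix (Fin k ⊕ Fin l) (Fin k ⊕ Fin l) K), h12, h21]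
        generalize (g : Matrix (Fin k ⊕ Fin l) (Fin k ⊕ Fin l) K).toBlocks₁₁ = a at hg
        generalize (g : Matrix (Fin k ⊕ Fin l) (Fin k ⊕ Fin l) K).toBlocks₂₂ = b at hg
        rw [hg, Matrix.isUnit_fromBlocks_zero₂₁] at hgu
        obtain ⟨⟨a', ha'⟩, ⟨b', hb'⟩⟩ := hgu
        have hinv : ((g⁻¹ : GL (Fin k ⊕ Fin l) K) : Matrix (Fin k ⊕ Fin l) (Fin k ⊕ Fin l) K) =
            fromBlocks ((a'⁻¹ : GL (Fin k) K) : Matrix (Fin k) (Fin k) K) 0 0 ((b'⁻¹ : GL (Fin l) K) : Matrix (Fin l) (Fin l) K) := by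
          apply Units.inv_eq_of_mul_eq_one_right
          rw [hg, fromBlocks_multiply, ← ha', ← hb']
          simp
        refine ⟨a * B1 * ((a'⁻¹ : GL (Fin k) K) : Matrix (Fin k) (Fin k) K), b * B2 * ((b'⁻¹ : GL (Fin l) K) : Matrix (Fin l) (Fin l) K), ?_, ?_, ?_⟩
        · simp only [actT]
          rw [hinv, hg]
          simp [fromBlocks_multiply]
        · exact nilp_conj _ _ (by rw [← ha']; simp) (by rw [← ha']; simp) hn
        · rw [← hb']
          exact (b'.isUnit.mul hu).mul (Units.isUnit _))
  simp only [Finset.sum_const, nsmul_eq_mul, mul_one] at h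
  rw [Nat.card_eq_fintype_card (α := {x : Tr K (Fin k ⊕ Fin l) // V x ∧ SR x.2.2 l}),
    Nat.card_eq_fintype_card (α := {x : Tr K (Fin k ⊕ Fin l) // V x ∧ Dg x.2.2}),
    Fintype.card_subtype, Fintype.card_subtype]
  exact_mod_cast h

lemma card_SR_reindex {n n' : Type} [Fintype n] [DecidableEq n] [Fintype n'] [DecidableEq n'] (e : n ≃ n') (l : ℕ) :
    Nat.card {x : Tr K n // V x ∧ SR x.2.2 l} = Nat.card {x : Tr K n' // V x ∧ SR x.2.2 l} := by
  let p : Matrix n' n K := (1 : Matrix n n K).submatrix e.symm id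
  let p' : Matrix n n' K := (1 : Matrix n n K).submatrix id e.symm
  have h1 : p * p' = 1 := by
    ext i j; simp [p, p', Matrix.mul_apply, Matrix.one_apply]
  have h2 : p' * p = 1 := by
    have h : (1 : Matrix n n K).submatrix id e.symm * (1 : Matrix n n K).submatrix e.symm id = 1 := by
      rw [submatrix_mul_equiv]; simp
    exact h
  exact Nat.card_congr 
    { toFun := fun x => ⟨actT p p' x.1, V_act p p' h1 h2 x.2.1, SR_conj p p' h1 h2 x.2.2⟩
      invFun := fun x => ⟨actT p' p x.1, V_act p' p h2 h1 x.2.1, SR_conj p' p h2 h1 x.2.2⟩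
      left_inv := fun x => Subtype.ext (act_act p p' h2 x.1)
      right_inv := fun x => Subtype.ext (act_act p' p h1 x.1) }

lemma fitting_sum (n : ℕ) :
    (nQ K (Fin n) : ℝ) / Nat.card (GL (Fin n) K) = ∑ kl ∈ Finset.HasAntidiagonal.antidiagonal n,
      ((nP K (Fin kl.1) : ℝ) / Nat.card (GL (Fin kl.1) K)) * ((nR K (Fin kl.2) : ℝ) / Nat.card (GL (Fin kl.2) K)) := by
  classical
  have h1 : nQ K (Fin n) = ∑ kl ∈ Finset.HasAntidiagonal.antidiagonal n, Nat.card {x : Tr K (Fin n) // V x ∧ SR x.2.2 kl.2} := by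
    unfold nQ
    simp only [Nat.card_eq_fintype_card, Fintype.card_subtype]
    rw [← Finset.card_biUnion]
    · congr 1
      ext x
      simp only [Finset.mem_filter, Finset.mem_univ, true_and, Finset.mem_biUnion]
      constructor
      · intro hx
        obtain ⟨l, hl, hS⟩ := SR_exists x.2.2
        simp only [Fintype.card_fin] at hl
        exact ⟨(n - l, l), by simp; omega, hx, hS⟩
      · rintro ⟨_, _, h, _⟩; exact h
    · rintro ⟨k, l⟩ hkl ⟨k', l'⟩ hkl' hne
      rw [Function.onFun, Finset.disjoint_left]
      intro x hx hx'
      simp only [Finset.mem_filter, Finset.mem_univ, true_and] at hx hx'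
      have := SR_unique hx.2 hx'.2
      simp at hkl hkl'
      apply hne
      ext <;> simp <;> omega
  rw [h1]
  push_cast
  rw [Finset.sum_div]
  apply Finset.sum_congr rfl
  rintro ⟨k, l⟩ hkl
  simp only [Finset.HasAntidiagonal.mem_antidiagonal] at hkl
  subst hkl
  have h2 := fitting_orbit (K := K) k l
  rw [card_SR_reindex (finSumFinEquiv (m := k) (n := l)), card_GL_reindex (finSumFinEquiv (m := k) (n := l))] at h2
  have a1 := GL_pos (K := K) (Fin k)
  have a2 := GL_pos (K := K) (Fin l)
  have a3 := GL_pos (K := K) (Fin (k + l))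
  simp only
  rw [div_mul_div_comm, div_eq_div_iff a3.ne' (by positivity)]
  have h3 : ((Nat.card (GL (Fin k) K) : ℝ) * Nat.card (GL (Fin l) K) *
      Nat.card {x : Tr K (Fin (k + l)) // V x ∧ SR x.2.2 l}) =
    Nat.card (GL (Fin (k + l)) K) * (nP K (Fin k) * nR K (Fin l)) := by exact_mod_cast h2
  rw [mul_comm, h3]; ring

end fitting2
end FF

namespace FF

section ident
variable {K : Type} [Field K] [Fintype K] [StarRing K]

lemma card_pairs {n : Type} [Fintype n] [DecidableEq n] [Fintype {A : Matrix n n K // IsNilpotent A}] (F : Matrix n n K → Prop)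
    (hF : ∀ h B, IsUnit h → (F (h * B) ↔ F B)) :
    Nat.card {x : Tr K n // V x ∧ F x.2.2} = ∑ A : {A : Matrix n n K // IsNilpotent A},
      Hc A.1 * Nat.card {S : Matrix n n K // (S.IsHermitian ∧ (S * A.1).IsHermitian) ∧ F S} := by
  classical
  let f : {x : Tr K n // V x ∧ F x.2.2} → Σ A : {A : Matrix n n K // IsNilpotent A},
      {S : Matrix n n K // (S.IsHermitian ∧ (S * A.1).IsHermitian) ∧ IsUnit S} ×
      {S : Matrix n n K // (S.IsHermitian ∧ (S * A.1).IsHermitian) ∧ F S} := fun x =>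
    ⟨⟨x.1.2.1, x.2.1.2.2.2.2⟩, ⟨x.1.1, ⟨x.2.1.1.1, x.2.1.2.1⟩, x.2.1.1.2⟩, ⟨x.1.1 * x.1.2.2, ⟨x.2.1.2.2.1, by
      obtain ⟨⟨h, A, B⟩, ⟨⟨h1, h2⟩, h3, h4, h5, h6⟩, h7⟩ := x
      simp only at h1 h2 h3 h4 h5 h6 h7 ⊢
      have e3 : Aᴴ * h = h * A := by rw [← h3.eq, conjTranspose_mul, h1.eq]
      have e4 : Bᴴ * h = h * B := by rw [← h4.eq, conjTranspose_mul, h1.eq]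
      unfold IsHermitian
      rw [conjTranspose_mul, h4.eq, ← Matrix.mul_assoc, e3, Matrix.mul_assoc, h5, Matrix.mul_assoc]⟩,
      (hF _ _ x.2.1.1.2).mpr x.2.2⟩⟩
  have hf : Function.Bijective f := by
    constructor
    · rintro ⟨⟨h, A, B⟩, hx⟩ ⟨⟨h', A', B'⟩, hx'⟩ hh
      simp only [f, Sigma.mk.injEq, Subtype.mk.injEq] at hh
      obtain ⟨rfl, hh⟩ := hh
      have hh := eq_of_heq hh
      simp only [Prod.mk.injEq, Subtype.mk.injEq] at hh
      obtain ⟨rfl, h3⟩ := hh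
      have : B = B' := hx.1.1.2.mul_left_cancel h3
      subst this; rfl
    · rintro ⟨⟨A, hA⟩, ⟨h, ⟨h1, h2⟩, h3⟩, ⟨S, ⟨h4, h5⟩, h6⟩⟩
      obtain ⟨u, hu⟩ := h3
      have hS : h * (((u⁻¹ : GL n K) : Matrix n n K) * S) = S := by
        rw [← hu, ← Matrix.mul_assoc]; simp
      simp only at h2 h5
      have e3 : Aᴴ * h = h * A := by rw [← h2.eq, conjTranspose_mul, h1.eq]
      have e4 : Aᴴ * S = S * A := by rw [← h5.eq, conjTranspose_mul, h4.eq]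
      have hx : V (h, A, ((u⁻¹ : GL n K) : Matrix n n K) * S) := by
        refine ⟨⟨h1, u, hu⟩, h2, ?_, ?_, hA⟩
        · simp only; rw [hS]; exact h4
        · simp only
          have : IsUnit h := ⟨u, hu⟩
          apply this.mul_left_cancel
          rw [← Matrix.mul_assoc, ← e3, Matrix.mul_assoc, hS, e4, ← Matrix.mul_assoc, hS]
      refine ⟨⟨(h, A, ((u⁻¹ : GL n K) : Matrix n n K) * S), hx, ?_⟩, ?_⟩
      · rw [← hF h _ ⟨u, hu⟩]; simp only; rw [hS]; exact h6
      · simp only [f, hS]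
  rw [Nat.card_congr (Equiv.ofBijective f hf), Nat.card_sigma]
  simp only [Nat.card_prod]
  rfl

/-- totals -/
noncomputable def tot (K : Type) [Field K] [Fintype K] [StarRing K] (f : Bool) (n : ℕ) : ℝ :=
  (if f then (nQ K (Fin n) : ℝ) else (nR K (Fin n) : ℝ)) / Nat.card (GL (Fin n) K)

lemma sum_TT (f : Bool) (n : ℕ) : ∑ b ∈ Finset.range (n + 1), TT K f n b = tot K f n := by
  classical
  unfold TT tot
  rw [← Finset.sum_div]
  congr 1
  simp only [Finset.sum_filter]
  rw [Finset.sum_comm]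
  have h1 : ∀ A : Matrix (Fin n) (Fin n) K, (∑ b ∈ Finset.range (n + 1), if IsNilpotent A ∧ A.rank + b = n then Wt f A else 0) =
      if IsNilpotent A then Wt f A else 0 := by
    intro A
    by_cases hA : IsNilpotent A
    · have := rank_le_card_height A
      simp only [Fintype.card_fin] at this
      have h2 : ∀ b, A.rank + b = n ↔ n - A.rank = b := by intro b; omega
      simp only [hA, true_and, h2, if_true]
      rw [Finset.sum_ite_eq, if_pos]
      simp
    · simp [hA]
  simp only [h1]
  rw [← Finset.sum_filter, Finset.sum_subtype (p := fun A : Matrix (Fin n) (Fin n) K => IsNilpotent A) _ (by simp)]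
  rcases f with _ | _
  · simp only [Bool.false_eq_true, if_false, Wt]
    unfold nR
    rw [card_pairs (fun B => IsUnit B)]
    · push_cast; rfl
    · intro h B hh
      constructor
      · intro h3
        obtain ⟨u, rfl⟩ := hh
        exact (Units.isUnit_units_mul u B).mp h3
      · intro h3; exact hh.mul h3
  · simp only [if_true, Wt]
    unfold nQ
    have := card_pairs (K := K) (n := Fin n) (fun B => True) (by simp)
    simp only [and_true] at this
    rw [this]
    push_cast; rfl

lemma TT_nonneg (f : Bool) (n b : ℕ) : 0 ≤ TT K f n b := by
  unfold TT
  apply div_nonneg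
  · apply Finset.sum_nonneg
    intro A _
    unfold Wt
    split_ifs <;> positivity
  · positivity

lemma TT_gt (f : Bool) (n b : ℕ) (h : n < b) : TT K f n b = 0 := by
  classical
  unfold TT
  rw [Finset.filter_eq_empty_iff.mpr]
  · simp
  · intro A _ h'; omega

lemma TT_pos_zero (f : Bool) (n : ℕ) : TT K f (n + 1) 0 = 0 := by
  classical
  unfold TT
  rw [Finset.filter_eq_empty_iff.mpr]
  · simp
  · rintro A _ ⟨⟨k, hk⟩, h'⟩
    obtain ⟨G, hG⟩ := surj_of_rank A (by simpa using h')
    have : IsUnit A := IsUnit.of_mul_eq_one G hG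
    have := this.pow k
    rw [hk] at this
    exact not_isUnit_zero this

lemma card_one_of {α : Type} [Subsingleton α] (a : α) : Nat.card α = 1 := by
  rw [Nat.card_eq_one_iff_unique]; exact ⟨inferInstance, ⟨a⟩⟩

lemma Hc_zero (A : Matrix (Fin 0) (Fin 0) K) : Hc A = 1 := by
  unfold Hc
  have : Subsingleton {S : Matrix (Fin 0) (Fin 0) K // (S.IsHermitian ∧ (S * A).IsHermitian) ∧ IsUnit S} :=
    ⟨fun a b => Subtype.ext (Subsingleton.elim _ _)⟩
  exact card_one_of ⟨1, ⟨Subsingleton.elim _ _, Subsingleton.elim _ _⟩, isUnit_one⟩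

lemma Lc_zero (A : Matrix (Fin 0) (Fin 0) K) : Lc A = 1 := by
  unfold Lc
  have : Subsingleton {S : Matrix (Fin 0) (Fin 0) K // (S.IsHermitian ∧ (S * A).IsHermitian)} :=
    ⟨fun a b => Subtype.ext (Subsingleton.elim _ _)⟩
  exact card_one_of ⟨1, ⟨Subsingleton.elim _ _, Subsingleton.elim _ _⟩⟩

lemma card_GL_zero : Nat.card (GL (Fin 0) K) = 1 := card_one_of 1

lemma card_HInv_zero : Nat.card (HInv K (Fin 0)) = 1 := by
  have : Subsingleton (HInv K (Fin 0)) := ⟨fun a b => Subtype.ext (Subsingleton.elim _ _)⟩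
  exact card_one_of ⟨1, ⟨Subsingleton.elim _ _, isUnit_one⟩⟩

lemma TT_zero (f : Bool) : TT K f 0 0 = 1 := by
  classical
  unfold TT
  rw [card_GL_zero, Finset.filter_true_of_mem]
  · simp only [Wt, Hc_zero, Lc_zero]
    simp
    rw [← Nat.card_eq_fintype_card]
    exact card_one_of 0
  · intro A _
    refine ⟨⟨1, Subsingleton.elim _ _⟩, ?_⟩
    have := rank_le_card_height A
    simpa using this

lemma tot_zero (f : Bool) : tot K f 0 = 1 := by
  rw [← sum_TT]; simp [TT_zero]

lemma coef_zero (q : ℕ) (f : Bool) : coef K q f 0 = 1 := by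
  unfold coef
  rw [card_GL_zero, card_HInv_zero]; simp

lemma coef_nonneg (q : ℕ) (f : Bool) (m : ℕ) : 0 ≤ coef K q f m := by
  unfold coef
  split_ifs <;> positivity

/-- `P_n` -/
noncomputable def totP (K : Type) [Field K] [Fintype K] [StarRing K] (n : ℕ) : ℝ :=
  (nP K (Fin n) : ℝ) / Nat.card (GL (Fin n) K)

lemma totP_nonneg (n : ℕ) : 0 ≤ totP K n := by unfold totP; positivity
lemma tot_nonneg (f : Bool) (n : ℕ) : 0 ≤ tot K f n := by unfold tot; split_ifs <;> positivity

lemma fitting_tot (n : ℕ) : tot K true n = ∑ kl ∈ Finset.HasAntidiagonal.antidiagonal n, totP K kl.1 * tot K false kl.2 := by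
  have := fitting_sum (K := K) n
  unfold tot totP
  simp only [if_true, Bool.false_eq_true, if_false]
  exact this

lemma totP_le (n : ℕ) : totP K n ≤ tot K true n := by
  rw [fitting_tot]
  have := Finset.single_le_sum (f := fun kl : ℕ × ℕ => totP K kl.1 * tot K false kl.2)
    (fun kl _ => mul_nonneg (totP_nonneg _) (tot_nonneg _ _)) (show (n, 0) ∈ Finset.HasAntidiagonal.antidiagonal n by simp)
  simpa [tot_zero] using this

end ident
end FF

namespace FF

section forms
variable {K : Type} [Field K] [Fintype K] [StarRing K]

lemma hyper {n : Type} [Fintype n] [DecidableEq n] {m : ℕ} (hn : Fintype.card n = m + 1)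
    (w : Matrix Unit n K) (G : Matrix n Unit K) (h : w * G = 1) :
    ∃ (p1 : Matrix n (Fin m) K) (p1' : Matrix (Fin m) n K), w * p1 = 0 ∧ p1' * G = 0 ∧ p1' * p1 = 1 ∧
      G * w + p1 * p1' = 1 := by
  have hGw : ∀ v, w *ᵥ (G *ᵥ v) = v := by intro v; rw [mulVec_mulVec, h, one_mulVec]
  have hc : IsCompl (LinearMap.ker w.mulVecLin) (LinearMap.range G.mulVecLin) := by
    constructor
    · rw [Submodule.disjoint_def]
      rintro x hx ⟨y, rfl⟩
      simp only [mulVecLin_apply, LinearMap.mem_ker] at hx ⊢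
      rw [hGw] at hx
      rw [hx, mulVec_zero]
    · rw [codisjoint_iff, Submodule.eq_top_iff']
      intro x
      rw [Submodule.mem_sup]
      refine ⟨x - G *ᵥ (w *ᵥ x), ?_, G *ᵥ (w *ᵥ x), ⟨_, rfl⟩, by abel⟩
      simp only [mulVecLin_apply, LinearMap.mem_ker]
      rw [mulVec_sub, hGw, sub_self]
  have hr : Module.finrank K (LinearMap.range G.mulVecLin) = 1 := by
    have : Function.Injective G.mulVecLin := by
      intro a b hab
      simp only [mulVecLin_apply] at hab
      rw [← hGw a, hab, hGw]
    rw [LinearMap.finrank_range_of_inj this]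
    simp
  have hk : Module.finrank K (LinearMap.ker w.mulVecLin) = m := by
    have := Submodule.finrank_add_eq_of_isCompl hc
    simp [hn] at this
    omega
  obtain ⟨p1, p2, p1', p2', h1, h11, h22, h12, h21, hW, hW'⟩ := adapted _ _ hc hk hr
  have a1 : w * p1 = 0 := by
    apply mat_eq_zero
    intro v
    have := (hW (p1 *ᵥ v)).mpr (by rw [mulVec_mulVec, h21, zero_mulVec])
    simpa using this
  have a2 : p1' * G = 0 := by
    apply mat_eq_zero
    intro v
    rw [← mulVec_mulVec, ← hW']
    exact ⟨v, rfl⟩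
  obtain ⟨Y, hY⟩ : ∃ Y : Matrix Unit (Fin 1) K, p2 = G * Y := by
    apply exists_factor
    intro v
    rw [hW', mulVec_mulVec, h12, zero_mulVec]
  refine ⟨p1, p1', a1, a2, h11, ?_⟩
  have b2 : G * w * p2 = p2 := by
    rw [hY, Matrix.mul_assoc, ← Matrix.mul_assoc w, h, Matrix.one_mul]
  calc G * w + p1 * p1' = G * w * (p1 * p1' + p2 * p2') + p1 * p1' := by rw [h1, Matrix.mul_one]
    _ = G * (w * p1) * p1' + (G * w * p2) * p2' + p1 * p1' := by
      simp only [Matrix.mul_add, Matrix.mul_assoc]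
    _ = 1 := by rw [a1, b2, ← h1]; simp; abel

/-- packaged change of basis -/
lemma hyper' {n : Type} [Fintype n] [DecidableEq n] {m : ℕ} (hn : Fintype.card n = m + 1)
    (w : Matrix Unit n K) (G : Matrix n Unit K) (h : w * G = 1) :
    ∃ (p1 : Matrix n (Fin m) K) (p' : Matrix (Unit ⊕ Fin m) n K), w * p1 = 0 ∧
      fromCols G p1 * p' = 1 ∧ p' * fromCols G p1 = 1 := by
  obtain ⟨p1, p1', h1, h2, h3, h4⟩ := hyper hn w G h
  refine ⟨p1, fromRows w p1', h1, ?_, ?_⟩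
  · rw [fromCols_mul_fromRows, h4]
  · rw [fromRows_mul_fromCols, h, h1, h2, h3, fromBlocks_one]

variable {q : ℕ}

lemma exists_aniso (hK : Fintype.card K = q ^ 2) (hs : ∀ a : K, star a = a ^ q) {n : Type} [Fintype n] [DecidableEq n]
    [Nonempty n] (h : Matrix n n K) (hh : h.IsHermitian) (hu : IsUnit h) :
    ∃ v : Matrix n Unit K, vᴴ * h * v = 1 := by
  obtain ⟨a, ha⟩ := exists_nonfixed hK hs
  by_cases hz : ∃ v : Matrix n Unit K, vᴴ * h * v ≠ 0
  · obtain ⟨v, hv⟩ := hz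
    set c := (vᴴ * h * v) () () with hc
    have hM : vᴴ * h * v = c • (1 : Matrix Unit Unit K) := by
      ext i j; simp [hc]
    have hc0 : c ≠ 0 := by rintro h0; rw [h0, zero_smul] at hM; exact hv hM
    have hcs : star c = c := by
      have := (herm_conj v hh).apply () ()
      simpa [hc] using this
    obtain ⟨b, hb⟩ := exists_norm_eq hK hs c hcs
    refine ⟨b⁻¹ • v, ?_⟩
    have hb0 : b ≠ 0 := by rintro rfl; simp at hb; exact hc0 hb.symm
    have hb1 : star b ≠ 0 := by simpa using hb0
    rw [conjTranspose_smul, Matrix.smul_mul, Matrix.smul_mul, Matrix.mul_smul, hM, smul_smul, smul_smul, mul_assoc]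
    have : star b⁻¹ * (b⁻¹ * c) = 1 := by rw [← hb, star_inv₀]; field_simp
    rw [this, one_smul]
  · exfalso
    push Not at hz
    have hxy : ∀ x y : Matrix n Unit K, xᴴ * h * y = 0 := by
      intro x y
      have e1 := hz (x + y)
      have e2 := hz (x + a • y)
      simp only [conjTranspose_add, conjTranspose_smul, Matrix.add_mul, Matrix.mul_add, Matrix.smul_mul, Matrix.mul_smul, hz] at e1 e2
      simp only [zero_add, add_zero, smul_zero] at e1 e2
      have e3 : yᴴ * h * x = - (xᴴ * h * y) := by
        rw [eq_neg_iff_add_eq_zero, ← e1]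
      rw [e3, smul_neg, neg_add_eq_zero] at e2
      have e4 : (a - star a) • (xᴴ * h * y) = 0 := by
        rw [sub_smul, sub_eq_zero]; first | exact e2 | exact e2.symm
      rcases smul_eq_zero.mp e4 with h5 | h5
      · exact absurd (sub_eq_zero.mp h5).symm ha
      · exact h5
    have h0 : h = 0 := by
      ext i j
      have := congrFun (congrFun (hxy (Matrix.of fun k _ => if k = i then 1 else 0) (Matrix.of fun k _ => if k = j then 1 else 0)) ()) ()
      simpa [Matrix.mul_apply, apply_ite star] using this
    rw [h0] at hu
    exact not_isUnit_zero hu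

lemma trans_fin (hK : Fintype.card K = q ^ 2) (hs : ∀ a : K, star a = a ^ q) (m : ℕ) :
    ∀ h : Matrix (Fin m) (Fin m) K, h.IsHermitian → IsUnit h →
      ∃ p p' : Matrix (Fin m) (Fin m) K, p * p' = 1 ∧ p' * p = 1 ∧ pᴴ * h * p = 1 := by
  induction m with
  | zero => intro h _ _; exact ⟨1, 1, Subsingleton.elim _ _, Subsingleton.elim _ _, Subsingleton.elim _ _⟩
  | succ m ih =>
    intro h hh hu
    obtain ⟨v, hv⟩ := exists_aniso hK hs h hh hu
    obtain ⟨p1, p', h1, h2, h3⟩ := hyper' (m := m) (by simp) (vᴴ * h) v hv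
    have hb : (fromCols v p1)ᴴ * h * fromCols v p1 = fromBlocks 1 0 0 (p1ᴴ * h * p1) := by
      rw [conjTranspose_fromCols_eq_fromRows_conjTranspose, fromRows_mul, fromRows_mul_fromCols, hv, h1]
      congr 1
      have := congrArg conjTranspose h1
      rw [conjTranspose_mul, conjTranspose_mul, hh.eq, conjTranspose_conjTranspose, conjTranspose_zero, ← Matrix.mul_assoc] at this
      exact this
    have hu2 : IsUnit (p1ᴴ * h * p1) := by
      have := isUnit_conj p' (fromCols v p1) h3 h2 hu
      rw [hb, isUnit_iff_isUnit_det, det_fromBlocks_zero₂₁] at this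
      rw [isUnit_iff_isUnit_det]
      simpa using this
    obtain ⟨g, g', g1, g2, g3⟩ := ih _ (herm_conj p1 hh) hu2
    let e : Fin (m+1) ≃ Unit ⊕ Fin m := Fintype.equivOfCardEq (by simp [add_comm])
    let F : Matrix (Unit ⊕ Fin m) (Unit ⊕ Fin m) K := fromBlocks 1 0 0 g
    let F' : Matrix (Unit ⊕ Fin m) (Unit ⊕ Fin m) K := fromBlocks 1 0 0 g'
    have f1 : F * F' = 1 := by
      simp only [F, F', fromBlocks_multiply]
      simp [g1]
    have f2 : F' * F = 1 := by
      simp only [F, F', fromBlocks_multiply]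
      simp [g2]
    have f3 : Fᴴ * (fromBlocks 1 0 0 (p1ᴴ * h * p1)) * F = 1 := by
      simp only [F, fromBlocks_conjTranspose, fromBlocks_multiply]
      simp only [Matrix.mul_zero, Matrix.zero_mul, conjTranspose_zero, conjTranspose_one, Matrix.mul_one, add_zero, zero_add, g3, fromBlocks_one]
    let p : Matrix (Fin (m+1)) (Unit ⊕ Fin m) K := fromCols v p1 * F
    let r : Matrix (Unit ⊕ Fin m) (Fin (m+1)) K := F' * p'
    have pr : p * r = 1 := by
      show (fromCols v p1 * F) * (F' * p') = 1
      rw [Matrix.mul_assoc, ← Matrix.mul_assoc F, f1, Matrix.one_mul, h2]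
    have rp : r * p = 1 := by
      show (F' * p') * (fromCols v p1 * F) = 1
      rw [Matrix.mul_assoc, ← Matrix.mul_assoc p', h3, Matrix.one_mul, f2]
    have php : pᴴ * h * p = 1 := by
      show (fromCols v p1 * F)ᴴ * h * (fromCols v p1 * F) = 1
      rw [conjTranspose_mul]
      calc Fᴴ * (fromCols v p1)ᴴ * h * (fromCols v p1 * F)
          = Fᴴ * ((fromCols v p1)ᴴ * h * (fromCols v p1)) * F := by
              simp only [Matrix.mul_assoc]
          _ = 1 := by rw [hb, f3]
    refine ⟨p.submatrix id e, r.submatrix e id, ?_, ?_, ?_⟩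
    · rw [submatrix_mul_equiv, pr]; simp
    · rw [← submatrix_mul _ _ e id e Function.bijective_id, rp]; simp
    · have e2 : h = h.submatrix id id := by simp
      rw [conjTranspose_submatrix]
      nth_rewrite 1 [e2]
      rw [← submatrix_mul _ _ e id id Function.bijective_id, ← submatrix_mul _ _ e id e Function.bijective_id, php]
      simp

end forms
end FF

namespace FF

section counts
variable {K : Type} [Field K] [Fintype K] [StarRing K]

lemma card_HInv_conj {n n' : Type} [Fintype n] [DecidableEq n] [Fintype n'] [DecidableEq n']
    (p : Matrix n' n K) (p' : Matrix n n' K) (h1 : p * p' = 1) (h2 : p' * p = 1) :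
    Nat.card (HInv K n) = Nat.card (HInv K n') := by
  refine Nat.card_congr 
    { toFun := fun S => ⟨p'ᴴ * S.1 * p', herm_conj p' S.2.1, isUnit_conj p p' h1 h2 S.2.2⟩
      invFun := fun S => ⟨pᴴ * S.1 * p, herm_conj p S.2.1, isUnit_conj p' p h2 h1 S.2.2⟩
      left_inv := ?_
      right_inv := ?_ }
  · rintro ⟨S, hS⟩
    apply Subtype.ext
    show pᴴ * (p'ᴴ * S * p') * p = S
    have e : pᴴ * (p'ᴴ * S * p') * p = (p' * p)ᴴ * S * (p' * p) := by
      rw [conjTranspose_mul]; simp only [Matrix.mul_assoc]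
    rw [e, h2]; simp
  · rintro ⟨S, hS⟩
    apply Subtype.ext
    show p'ᴴ * (pᴴ * S * p) * p' = S
    have e : p'ᴴ * (pᴴ * S * p) * p' = (p * p')ᴴ * S * (p * p') := by
      rw [conjTranspose_mul]; simp only [Matrix.mul_assoc]
    rw [e, h1]; simp

lemma card_HInv_reindex {n n' : Type} [Fintype n] [DecidableEq n] [Fintype n'] [DecidableEq n'] (e : n ≃ n') :
    Nat.card (HInv K n) = Nat.card (HInv K n') := by
  refine card_HInv_conj ((1 : Matrix n n K).submatrix e.symm id) ((1 : Matrix n n K).submatrix id e.symm) ?_ ?_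
  · ext i j; simp [Matrix.mul_apply, Matrix.one_apply]
  · rw [submatrix_mul_equiv]; simp

/-- number of completions -/
noncomputable def Nc {n : Type} [Fintype n] [DecidableEq n] (a : Matrix Unit Unit K) (w : Matrix Unit n K) : ℕ :=
  Nat.card {T : Matrix n n K // T.IsHermitian ∧ IsUnit (fromBlocks a w wᴴ T)}

lemma card_HInv_sum {n : Type} [Fintype n] [DecidableEq n] [Fintype (Herm K Unit)] :
    Nat.card (HInv K (Unit ⊕ n)) = ∑ a : Herm K Unit, ∑ w : Matrix Unit n K, Nc a.1 w := by
  unfold Nc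
  rw [← Fintype.sum_prod_type' (f := fun (a : Herm K Unit) (w : Matrix Unit n K) => Nat.card {T : Matrix n n K // T.IsHermitian ∧ IsUnit (fromBlocks a.1 w wᴴ T)}), ← Nat.card_sigma]
  refine Nat.card_congr (Equiv.ofBijective
    (fun x : Σ aw : Herm K Unit × Matrix Unit n K, {T : Matrix n n K // T.IsHermitian ∧ IsUnit (fromBlocks aw.1.1 aw.2 aw.2ᴴ T)} => 
      (⟨fromBlocks x.1.1.1 x.1.2 x.1.2ᴴ x.2.1, IsHermitian.fromBlocks x.1.1.2 rfl x.2.2.1, x.2.2.2⟩ : HInv K (Unit ⊕ n))) ⟨?_, ?_⟩).symm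
  · rintro ⟨⟨⟨a, ha⟩, w⟩, ⟨T, hT⟩⟩ ⟨⟨⟨a', ha'⟩, w'⟩, ⟨T', hT'⟩⟩ h
    have := congrArg Subtype.val h
    obtain ⟨h1, h2, _, h4⟩ := fromBlocks_inj.mp this
    subst h1 h2 h4
    rfl
  · rintro ⟨S, hS, hu⟩
    obtain ⟨S11, S12, S21, S22, rfl⟩ : ∃ S11 S12 S21 S22, S = fromBlocks S11 S12 S21 S22 :=
        ⟨_, _, _, _, (fromBlocks_toBlocks S).symm⟩
    have h1 := hS
    unfold IsHermitian at h1
    rw [fromBlocks_conjTranspose] at h1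
    obtain ⟨a11, a12, a21, a22⟩ := fromBlocks_inj.mp h1
    subst a21
    exact ⟨⟨(⟨S11, a11⟩, S12), ⟨S22, a22, hu⟩⟩, rfl⟩

lemma Nc_ne {n : Type} [Fintype n] [DecidableEq n] (a : Matrix Unit Unit K) (ha : a.IsHermitian) (h0 : a ≠ 0) (w : Matrix Unit n K) :
    Nc a w = Nat.card (HInv K n) := by
  have hu : IsUnit a := by
    rw [isUnit_iff_isUnit_det, isUnit_iff_ne_zero, det_unique]
    intro h
    apply h0
    ext i j
    exact h
  have : Invertible a := hu.invertible
  unfold Nc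
  have hi : (⅟a).IsHermitian := by
    unfold IsHermitian
    rw [invOf_eq_nonsing_inv, conjTranspose_nonsing_inv, ha.eq]
  have hw : (wᴴ * ⅟a * w).IsHermitian := herm_conj w hi
  refine Nat.card_congr (Equiv.subtypeEquiv (Equiv.subRight (wᴴ * ⅟a * w)) ?_)
  intro T
  rw [isUnit_fromBlocks_iff_of_invertible₁₁]
  simp only [Equiv.subRight_apply]
  apply and_congr_left'
  constructor
  · intro h; exact h.sub hw
  · intro h; have := h.add hw; simpa using this

lemma Nc_zero_zero {n : Type} [Fintype n] [DecidableEq n] : Nc (0 : Matrix Unit Unit K) (0 : Matrix Unit n K) = 0 := by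
  unfold Nc
  have : IsEmpty {T : Matrix n n K // T.IsHermitian ∧ IsUnit (fromBlocks (0 : Matrix Unit Unit K) (0 : Matrix Unit n K) (0 : Matrix Unit n K)ᴴ T)} := by
    constructor
    rintro ⟨T, hT, hu⟩
    rw [isUnit_iff_isUnit_det, conjTranspose_zero, det_fromBlocks_zero₂₁] at hu
    simp at hu
  exact Nat.card_of_isEmpty

lemma Nc_zero {q : ℕ} (hK : Fintype.card K = q ^ 2) (hs : ∀ a : K, star a = a ^ q) (m : ℕ) (w : Matrix Unit (Fin (m+1)) K) (hw : w ≠ 0) :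
    Nc (0 : Matrix Unit Unit K) w = q * (q ^ 2) ^ m * Nat.card (HInv K (Fin m)) := by
  obtain ⟨G, hG⟩ : ∃ G : Matrix (Fin (m+1)) Unit K, w * G = 1 := by
    obtain ⟨j, hj⟩ : ∃ j, w () j ≠ 0 := by
      by_contra! h
      apply hw; ext i j; exact h j
    refine ⟨Matrix.of fun i _ => if i = j then (w () j)⁻¹ else 0, ?_⟩
    ext i k
    simp [Matrix.mul_apply, hj]
  obtain ⟨p1, p', h1, h2, h3⟩ := hyper' (m := m) (by simp) w G hG
  set p : Matrix (Fin (m+1)) (Unit ⊕ Fin m) K := fromCols G p1 with hp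
  let X : Matrix Unit (Unit ⊕ Fin m) K := fromCols 1 0
  have hwp : w * p = X := by rw [hp, mul_fromCols, hG, h1]
  have step1 : Nc (0 : Matrix Unit Unit K) w = Nc (0 : Matrix Unit Unit K) X := by
    unfold Nc
    let D : Matrix (Unit ⊕ Fin (m+1)) (Unit ⊕ (Unit ⊕ Fin m)) K := fromBlocks 1 0 0 p
    let D' : Matrix (Unit ⊕ (Unit ⊕ Fin m)) (Unit ⊕ Fin (m+1)) K := fromBlocks 1 0 0 p'
    have d1 : D * D' = 1 := by simp only [D, D', fromBlocks_multiply]; simp [h2]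
    have d2 : D' * D = 1 := by simp only [D, D', fromBlocks_multiply]; simp [h3]
    have e1 : ∀ T : Matrix (Fin (m+1)) (Fin (m+1)) K, Dᴴ * fromBlocks 0 w wᴴ T * D = fromBlocks 0 X Xᴴ (pᴴ * T * p) := by
      intro T
      simp only [D, fromBlocks_conjTranspose, fromBlocks_multiply]
      rw [← hwp, conjTranspose_mul]
      simp
    have e2 : ∀ T : Matrix (Unit ⊕ Fin m) (Unit ⊕ Fin m) K, D'ᴴ * fromBlocks 0 X Xᴴ T * D' = fromBlocks 0 w wᴴ (p'ᴴ * T * p') := by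
      intro T
      have : w = X * p' := by rw [← hwp, Matrix.mul_assoc, h2, Matrix.mul_one]
      simp only [D', fromBlocks_conjTranspose, fromBlocks_multiply]
      rw [this, conjTranspose_mul]
      simp
    refine Nat.card_congr 
      { toFun := fun T => ⟨pᴴ * T.1 * p, herm_conj p T.2.1, by rw [← e1]; exact isUnit_conj D' D d2 d1 T.2.2⟩
        invFun := fun T => ⟨p'ᴴ * T.1 * p', herm_conj p' T.2.1, by rw [← e2]; exact isUnit_conj D D' d1 d2 T.2.2⟩
        left_inv := ?_
        right_inv := ?_ }
    · rintro ⟨S, hS⟩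
      apply Subtype.ext
      show p'ᴴ * (pᴴ * S * p) * p' = S
      have e : p'ᴴ * (pᴴ * S * p) * p' = (p * p')ᴴ * S * (p * p') := by
        rw [conjTranspose_mul]; simp only [Matrix.mul_assoc]
      rw [e, h2]; simp
    · rintro ⟨S, hS⟩
      apply Subtype.ext
      show pᴴ * (p'ᴴ * S * p') * p = S
      have e : pᴴ * (p'ᴴ * S * p') * p = (p' * p)ᴴ * S * (p' * p) := by
        rw [conjTranspose_mul]; simp only [Matrix.mul_assoc]
      rw [e, h3]; simp
  rw [step1]
  have key : ∀ (a : Matrix Unit Unit K) (b : Matrix Unit (Fin m) K) (c : Matrix (Fin m) Unit K) (d : Matrix (Fin m) (Fin m) K),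
      IsUnit (fromBlocks 0 X Xᴴ (fromBlocks a b c d)) ↔ IsUnit d := by
    intro a b c d
    have := isUnit_block (K := K) (0 : Matrix Unit Unit K) (1 : Matrix Unit Unit K) ⟨0, 1, by simp⟩ (by intro x y h; simpa using h)
      (1 : Matrix Unit Unit K) (by simp [IsHermitian]) (by simp [IsHermitian]) a b c d
    simp only [Matrix.one_mul, Matrix.mul_one, isUnit_one, true_and] at this
    exact this
  have hcard : Nat.card (Herm K Unit × Matrix Unit (Fin m) K × HInv K (Fin m)) = q * (q ^ 2) ^ m * Nat.card (HInv K (Fin m)) := by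
    rw [Nat.card_prod, Nat.card_prod, card_herm hK hs, card_mat, hK]
    simp; ring
  rw [← hcard]
  unfold Nc
  refine Nat.card_congr (Equiv.ofBijective
    (fun x : Herm K Unit × Matrix Unit (Fin m) K × HInv K (Fin m) => 
      (⟨fromBlocks x.1.1 x.2.1 x.2.1ᴴ x.2.2.1, IsHermitian.fromBlocks x.1.2 rfl x.2.2.2.1, (key _ _ _ _).mpr x.2.2.2.2⟩ : {T : Matrix (Unit ⊕ Fin m) (Unit ⊕ Fin m) K // T.IsHermitian ∧ IsUnit (fromBlocks 0 X Xᴴ T)})) ⟨?_, ?_⟩).symm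
  · rintro ⟨⟨a, ha⟩, w, ⟨T, hT⟩⟩ ⟨⟨a', ha'⟩, w', ⟨T', hT'⟩⟩ h
    have := congrArg Subtype.val h
    obtain ⟨h1, h2, _, h4⟩ := fromBlocks_inj.mp this
    subst h1 h2 h4
    rfl
  · rintro ⟨S, hS, hu⟩
    obtain ⟨S11, S12, S21, S22, rfl⟩ : ∃ S11 S12 S21 S22, S = fromBlocks S11 S12 S21 S22 :=
        ⟨_, _, _, _, (fromBlocks_toBlocks S).symm⟩
    have h1 := hS
    unfold IsHermitian at h1
    rw [fromBlocks_conjTranspose] at h1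
    obtain ⟨a11, a12, a21, a22⟩ := fromBlocks_inj.mp h1
    subst a21
    exact ⟨(⟨S11, a11⟩, S12, ⟨S22, a22, (key _ _ _ _).mp hu⟩), rfl⟩

variable {q : ℕ}

lemma I_sum (hK : Fintype.card K = q ^ 2) (hs : ∀ a : K, star a = a ^ q) (n : ℕ) (Y : ℝ)
    (hY : ∀ w : Matrix Unit (Fin n) K, w ≠ 0 → (Nc (0 : Matrix Unit Unit K) w : ℝ) = Y) :
    (Nat.card (HInv K (Fin (n+1))) : ℝ) = ((q:ℝ) - 1) * ((q:ℝ)^2)^n * Nat.card (HInv K (Fin n)) + (((q:ℝ)^2)^n - 1) * Y := by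
  classical
  let e : Fin (n+1) ≃ Unit ⊕ Fin n := Fintype.equivOfCardEq (by simp [add_comm])
  rw [card_HInv_reindex e, card_HInv_sum]
  push_cast
  have hcm : (Fintype.card (Matrix Unit (Fin n) K) : ℝ) = ((q:ℝ)^2)^n := by
    rw [← Nat.card_eq_fintype_card, card_mat, hK]; simp
  have hch : (Fintype.card (Herm K Unit) : ℝ) = q := by
    rw [← Nat.card_eq_fintype_card, card_herm hK hs]; simp
  set I := (Nat.card (HInv K (Fin n)) : ℝ) with hI
  have h1 : ∀ a : Herm K Unit, ∑ w : Matrix Unit (Fin n) K, (Nc a.1 w : ℝ) =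
      ((q:ℝ)^2)^n * I + (if a = ⟨0, isHermitian_zero⟩ then (((q:ℝ)^2)^n - 1) * Y - ((q:ℝ)^2)^n * I else 0) := by
    intro a
    by_cases ha : a = ⟨0, isHermitian_zero⟩
    · rw [if_pos ha, ha]
      have : ∀ w : Matrix Unit (Fin n) K, (Nc (0 : Matrix Unit Unit K) w : ℝ) = Y - if w = 0 then Y else 0 := by
        intro w
        by_cases hw : w = 0
        · simp [hw, Nc_zero_zero]
        · simp [hw, hY]
      simp only [this]
      rw [Finset.sum_sub_distrib, Finset.sum_const, Finset.sum_ite_eq', nsmul_eq_mul, Finset.card_univ, hcm]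
      simp; ring
    · rw [if_neg ha]
      have : ∀ w : Matrix Unit (Fin n) K, (Nc a.1 w : ℝ) = I := by
        intro w
        rw [Nc_ne a.1 a.2 (by intro h; apply ha; exact Subtype.ext h)]
      simp only [this]
      rw [Finset.sum_const, nsmul_eq_mul, Finset.card_univ, hcm]
      simp
  simp only [h1]
  rw [Finset.sum_add_distrib, Finset.sum_const, Finset.sum_ite_eq', nsmul_eq_mul, Finset.card_univ, hch]
  simp; ring

lemma I_step (hK : Fintype.card K = q ^ 2) (hs : ∀ a : K, star a = a ^ q) (n : ℕ) :
    (Nat.card (HInv K (Fin (n+1))) : ℝ) = (q:ℝ)^n * ((q:ℝ)^(n+1) + (-1)^(n+1)) * Nat.card (HInv K (Fin n)) := by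
  induction n with
  | zero =>
    rw [I_sum hK hs 0 0 (by intro w hw; exact absurd (Subsingleton.elim _ _) hw)]
    simp; ring
  | succ n ih =>
    rw [I_sum hK hs (n+1) _ (by intro w hw; rw [Nc_zero hK hs n w hw])]
    push_cast
    have e1 : (((q:ℝ)^2)^(n+1) - 1) * (q * (q^2)^n * Nat.card (HInv K (Fin n))) = 
        (q:ℝ)^(n+1) * ((q:ℝ)^(n+1) - (-1)^(n+1)) * ((q:ℝ)^n * ((q:ℝ)^(n+1) + (-1)^(n+1)) * Nat.card (HInv K (Fin n))) := by
      have : ((-1:ℝ)^(n+1)) ^ 2 = 1 := by rw [← pow_mul, mul_comm, pow_mul]; simp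
      linear_combination ((q:ℝ)^(2*n+1) * Nat.card (HInv K (Fin n))) * this
    rw [e1, ← ih]
    ring

end counts
end FF

namespace FF

section orders
variable {K : Type} [Field K] [Fintype K] [StarRing K] {q : ℕ}

lemma card_GL_step (hK : Fintype.card K = q ^ 2) (n : ℕ) :
    (Nat.card (GL (Fin (n+1)) K) : ℝ) = ((q:ℝ)^2)^n * (((q:ℝ)^2)^(n+1) - 1) * Nat.card (GL (Fin n) K) := by
  have h : Nat.card (GL (Fin (n+1)) K) = (q^2)^n * ((q^2)^(n+1) - 1) * Nat.card (GL (Fin n) K) := by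
    rw [Matrix.card_GL_field, Matrix.card_GL_field, Fin.prod_univ_succ, hK]
    have : ∀ i : Fin n, ((q^2)^(n+1) - (q^2)^((Fin.succ i : Fin (n+1)) : ℕ)) = q^2 * ((q^2)^n - (q^2)^(i:ℕ)) := by
      intro i
      rw [Nat.mul_sub, Fin.val_succ, pow_succ', pow_succ' _ (i:ℕ)]
    simp only [this]
    rw [Finset.prod_mul_distrib, Finset.prod_const, Finset.card_univ, Fintype.card_fin]
    simp; ring
  rw [h]
  have h1 : 1 ≤ (q^2)^(n+1) := Nat.one_le_pow _ _ (by have := two_le_q hK; positivity)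
  push_cast [Nat.cast_sub h1]
  ring

lemma guOrder_step (q n : ℕ) : guOrder q (n+1) = (q:ℝ)^n * ((q:ℝ)^(n+1) - (-1)^(n+1)) * guOrder q n := by
  unfold guOrder
  rw [Finset.prod_range_succ, Nat.triangle_succ, pow_add]
  ring

lemma guOrder_zero (q : ℕ) : guOrder q 0 = 1 := by simp [guOrder]

lemma fac_pos (h2 : 2 ≤ q) (n : ℕ) : 0 < (q:ℝ)^(n+1) - (-1)^(n+1) := by
  have h2' : (2:ℝ) ≤ q := by exact_mod_cast h2
  have : (1:ℝ) < (q:ℝ)^(n+1) := one_lt_pow₀ (by linarith) (by omega)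
  rcases neg_one_pow_eq_or ℝ (n+1) with h | h <;> rw [h] <;> linarith

lemma guOrder_pos (h2 : 2 ≤ q) (n : ℕ) : 0 < guOrder q n := by
  induction n with
  | zero => simp [guOrder_zero]
  | succ n ih => rw [guOrder_step]; have := fac_pos h2 n; positivity

lemma I_mul_guOrder (hK : Fintype.card K = q ^ 2) (hs : ∀ a : K, star a = a ^ q) (n : ℕ) :
    (Nat.card (HInv K (Fin n)) : ℝ) * guOrder q n = Nat.card (GL (Fin n) K) := by
  induction n with
  | zero => rw [card_HInv_zero, card_GL_zero, guOrder_zero]; simp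
  | succ n ih =>
    rw [I_step hK hs, guOrder_step, card_GL_step hK, ← ih]
    have : ((-1:ℝ)^(n+1)) ^ 2 = 1 := by rw [← pow_mul, mul_comm, pow_mul]; simp
    linear_combination (-(q:ℝ)^(2*n) * Nat.card (HInv K (Fin n)) * guOrder q n) * this

lemma tpow (h2 : 2 ≤ q) (m : ℕ) : (-(1/(q:ℝ)))^(m+1) = (-1)^(m+1) / (q:ℝ)^(m+1) := by
  rw [← div_pow]; congr 1; ring

lemma coef_true_step (hK : Fintype.card K = q ^ 2) (hs : ∀ a : K, star a = a ^ q) (m : ℕ) :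
    (1 - (-(1/(q:ℝ)))^(m+1)) * coef K q true (m+1) = coef K q true m := by
  have h2 := two_le_q hK
  have hq : (0:ℝ) < q := by exact_mod_cast (by omega : 0 < q)
  have hG := GL_pos (K := K) (Fin m)
  have hG' := GL_pos (K := K) (Fin (m+1))
  have h3 := I_mul_guOrder hK hs m
  have h4 := I_mul_guOrder hK hs (m+1)
  have h5 := guOrder_pos h2 m
  have h6 := guOrder_pos h2 (m+1)
  have g1 : ∀ k, coef K q true k = (q:ℝ)^(k^2) / guOrder q k := by
    intro k
    have hG := GL_pos (K := K) (Fin k)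
    have h3 := I_mul_guOrder hK hs k
    have h5 := guOrder_pos h2 k
    unfold coef
    simp only [if_true]
    rw [div_eq_div_iff (by positivity) (by positivity), ← h3]
    ring
  rw [g1, g1, guOrder_step, tpow h2]
  have := fac_pos h2 m
  have e : (q:ℝ)^((m+1)^2) = (q:ℝ)^(m^2) * (q:ℝ)^m * (q:ℝ)^(m+1) := by ring
  rw [e]
  field_simp

lemma coef_false_step (hK : Fintype.card K = q ^ 2) (hs : ∀ a : K, star a = a ^ q) (m : ℕ) :
    (1 - (-(1/(q:ℝ)))^(m+1)) * coef K q false (m+1) = (1 + (-(1/(q:ℝ)))^(m+1)) * coef K q false m := by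
  have h2 := two_le_q hK
  have hq : (0:ℝ) < q := by exact_mod_cast (by omega : 0 < q)
  have g1 : ∀ k, coef K q false k = (Nat.card (HInv K (Fin k)) : ℝ) / guOrder q k := by
    intro k
    have hG := GL_pos (K := K) (Fin k)
    have h3 := I_mul_guOrder hK hs k
    have h5 := guOrder_pos h2 k
    unfold coef
    simp only [Bool.false_eq_true, if_false]
    rw [div_eq_div_iff (by positivity) (by positivity), ← h3]
    ring
  have h5 := guOrder_pos h2 m
  rw [g1, g1, guOrder_step, I_step hK hs, tpow h2]
  have := fac_pos h2 m
  field_simp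

end orders

section nu
variable {K : Type} [Field K] [Fintype K] [StarRing K] {q : ℕ}

lemma gl1 {n : Type} [Fintype n] [DecidableEq n] (g : GL n K) : (g : Matrix n n K) * ((g⁻¹ : GL n K) : Matrix n n K) = 1 := by
  rw [← Units.val_mul]; simp
lemma gl2 {n : Type} [Fintype n] [DecidableEq n] (g : GL n K) : ((g⁻¹ : GL n K) : Matrix n n K) * (g : Matrix n n K)  = 1 := by
  rw [← Units.val_mul]; simp

/-- commuting nilpotent Hermitian pairs -/
def PH {n : Type} [Fintype n] [DecidableEq n] (y : Matrix n n K × Matrix n n K) : Prop :=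
  y.1.IsHermitian ∧ y.2.IsHermitian ∧ IsNilpotent y.1 ∧ IsNilpotent y.2 ∧ y.1 * y.2 = y.2 * y.1

lemma nP_orbit (hK : Fintype.card K = q ^ 2) (hs : ∀ a : K, star a = a ^ q) (n : ℕ) :
    (Nat.card {g : GL (Fin n) K // ((g⁻¹ : GL (Fin n) K) : Matrix (Fin n) (Fin n) K)ᴴ * ((g⁻¹ : GL (Fin n) K) : Matrix (Fin n) (Fin n) K) = 1} : ℝ) *
      nP K (Fin n) = Nat.card (GL (Fin n) K) * Nat.card {y : Matrix (Fin n) (Fin n) K × Matrix (Fin n) (Fin n) K // PH y} := by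
  classical
  have h := orbit_count (G := GL (Fin n) K) (Ω := Tr K (Fin n))
    (fun g x => actT (g : Matrix (Fin n) (Fin n) K) ((g⁻¹ : GL (Fin n) K) : Matrix (Fin n) (Fin n) K) x) 
    (by intro x; simp [actT])
    (by intro g h x; simp only [actT, _root_.mul_inv_rev, Units.val_mul, conjTranspose_mul, Matrix.mul_assoc])
    (fun x => V x ∧ IsNilpotent x.2.2) (fun x => (V x ∧ IsNilpotent x.2.2) ∧ x.1 = 1)
    (fun g => ((g⁻¹ : GL (Fin n) K) : Matrix (Fin n) (Fin n) K)ᴴ * ((g⁻¹ : GL (Fin n) K) : Matrix (Fin n) (Fin n) K) = 1)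
    (fun _ => 1) (by intros; rfl)
    (by rintro g x ⟨h1, h2⟩; exact ⟨V_act _ _ (gl1 g) (gl2 g) h1, nilp_conj _ _ (gl1 g) (gl2 g) h2⟩)
    (by intro x h; exact h.1)
    (by
      rintro x ⟨h1, h2⟩
      obtain ⟨p, p', a1, a2, a3⟩ := trans_fin hK hs n x.1 h1.1.1 h1.1.2
      exact ⟨⟨p', p, a2, a1⟩, ⟨V_act p' p a2 a1 h1, nilp_conj p' p a2 a1 h2⟩, a3⟩)
    (by
      rintro g x ⟨⟨h1, h2⟩, h3⟩
      have : (actT (g : Matrix (Fin n) (Fin n) K) ((g⁻¹ : GL (Fin n) K) : Matrix (Fin n) (Fin n) K) x).1 = 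
        ((g⁻¹ : GL (Fin n) K) : Matrix (Fin n) (Fin n) K)ᴴ * ((g⁻¹ : GL (Fin n) K) : Matrix (Fin n) (Fin n) K) := by
        simp only [actT, h3, Matrix.mul_one]
      rw [this]
      constructor
      · exact fun h => h.2
      · exact fun h => ⟨⟨V_act _ _ (gl1 g) (gl2 g) h1, nilp_conj _ _ (gl1 g) (gl2 g) h2⟩, h⟩)
  rw [Finset.sum_const, Finset.sum_const, nsmul_one, nsmul_one] at h
  have e1 : nP K (Fin n) = (Finset.univ.filter fun x : Tr K (Fin n) => V x ∧ IsNilpotent x.2.2).card := by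
    unfold nP; rw [Nat.card_eq_fintype_card, Fintype.card_subtype]
  have e2 : Nat.card {y : Matrix (Fin n) (Fin n) K × Matrix (Fin n) (Fin n) K // PH y} = 
      (Finset.univ.filter fun x : Tr K (Fin n) => (V x ∧ IsNilpotent x.2.2) ∧ x.1 = 1).card := by
    rw [← Fintype.card_subtype, ← Nat.card_eq_fintype_card]
    refine Nat.card_congr 
      { toFun := fun y => ⟨(1, y.1.1, y.1.2), ⟨⟨⟨isHermitian_one, isUnit_one⟩, ?_, ?_, y.2.2.2.2.2, y.2.2.2.1⟩, y.2.2.2.2.1⟩, rfl⟩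
        invFun := fun x => ⟨x.1.2, ?_⟩
        left_inv := ?_
        right_inv := ?_ }
    · simpa using y.2.1
    · simpa using y.2.2.1
    · obtain ⟨⟨h, A, B⟩, ⟨⟨h0, h1, h2, h3, h4⟩, h5⟩, h6⟩ := x
      simp only at h6
      subst h6
      simp only [Matrix.one_mul] at h1 h2
      exact ⟨h1, h2, h4, h5, h3⟩
    · intro y; rfl
    · rintro ⟨⟨h, A, B⟩, h', h6⟩
      simp only at h6
      subst h6
      rfl
  rw [e1, e2]
  exact h

lemma U_orbit (hK : Fintype.card K = q ^ 2) (hs : ∀ a : K, star a = a ^ q) (n : ℕ) :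
    (Nat.card {g : GL (Fin n) K // ((g⁻¹ : GL (Fin n) K) : Matrix (Fin n) (Fin n) K)ᴴ * ((g⁻¹ : GL (Fin n) K) : Matrix (Fin n) (Fin n) K) = 1} : ℝ) *
      Nat.card (HInv K (Fin n)) = Nat.card (GL (Fin n) K) := by
  classical
  have h := orbit_count (G := GL (Fin n) K) (Ω := Matrix (Fin n) (Fin n) K)
    (fun g x => ((g⁻¹ : GL (Fin n) K) : Matrix (Fin n) (Fin n) K)ᴴ * x * ((g⁻¹ : GL (Fin n) K) : Matrix (Fin n) (Fin n) K)) 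
    (by intro x; simp)
    (by intro g h x; simp only [_root_.mul_inv_rev, Units.val_mul, conjTranspose_mul, Matrix.mul_assoc])
    (fun x => x.IsHermitian ∧ IsUnit x) (fun x => x = 1)
    (fun g => ((g⁻¹ : GL (Fin n) K) : Matrix (Fin n) (Fin n) K)ᴴ * ((g⁻¹ : GL (Fin n) K) : Matrix (Fin n) (Fin n) K) = 1)
    (fun _ => 1) (by intros; rfl)
    (by rintro g x ⟨h1, h2⟩; exact ⟨herm_conj _ h1, isUnit_conj _ _ (gl1 g) (gl2 g) h2⟩)
    (by rintro x rfl; exact ⟨isHermitian_one, isUnit_one⟩)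
    (by
      rintro x ⟨h1, h2⟩
      obtain ⟨p, p', a1, a2, a3⟩ := trans_fin hK hs n x h1 h2
      exact ⟨⟨p', p, a2, a1⟩, a3⟩)
    (by
      rintro g x rfl
      rw [Matrix.mul_one])
  rw [Finset.sum_const, Finset.sum_const, nsmul_one, nsmul_one] at h
  have e1 : Nat.card (HInv K (Fin n)) = (Finset.univ.filter fun x : Matrix (Fin n) (Fin n) K => x.IsHermitian ∧ IsUnit x).card := by
    rw [Nat.card_eq_fintype_card, Fintype.card_subtype]
  rw [e1, h]
  simp [Finset.filter_eq']

lemma card_PH (hK : Fintype.card K = q ^ 2) (hs : ∀ a : K, star a = a ^ q) (n : ℕ) :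
    Nat.card {y : Matrix (Fin n) (Fin n) K × Matrix (Fin n) (Fin n) K // PH y} = guNilCommPairs q K n := by
  obtain ⟨a, ha⟩ := exists_nonfixed hK hs
  have ha' : a - star a ≠ 0 := sub_ne_zero.mpr (Ne.symm ha)
  have hss : star (a - star a) = - (a - star a) := by simp
  set ε := a - star a with hε
  unfold guNilCommPairs
  have hH : ∀ A : Matrix (Fin n) (Fin n) K, (A.map (fun a => a ^ q))ᵀ = Aᴴ := by
    intro A; ext i j; simp [hs]
  have hm : ∀ A : Matrix (Fin n) (Fin n) K, A.IsHermitian ↔ (ε • A)ᴴ = - (ε • A) := by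
    intro A
    rw [conjTranspose_smul, hss, neg_smul, neg_inj]
    constructor
    · intro h; rw [h.eq]
    · intro h; exact smul_right_injective _ ha' h
  have hn : ∀ A : Matrix (Fin n) (Fin n) K, IsNilpotent A ↔ IsNilpotent (ε • A) := by
    intro A
    constructor
    · rintro ⟨k, hk⟩; exact ⟨k, by rw [smul_pow, hk, smul_zero]⟩
    · rintro ⟨k, hk⟩; refine ⟨k, ?_⟩
      rw [smul_pow] at hk
      exact (smul_eq_zero.mp hk).resolve_left (pow_ne_zero _ ha')
  let e : Matrix (Fin n) (Fin n) K ≃ Matrix (Fin n) (Fin n) K := 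
    { toFun := fun A => ε • A
      invFun := fun A => ε⁻¹ • A
      left_inv := fun A => by simp [smul_smul, ha']
      right_inv := fun A => by simp [smul_smul, ha'] }
  refine Nat.card_congr (Equiv.subtypeEquiv (Equiv.prodCongr e e) ?_)
  rintro ⟨A, B⟩
  simp only [PH, hH, Equiv.prodCongr_apply, Prod.map, e, Equiv.coe_fn_mk]
  rw [hm A, hm B, hn A, hn B]
  have : A * B = B * A ↔ (ε • A) * (ε • B) = (ε • B) * (ε • A) := by
    rw [smul_mul_smul_comm, smul_mul_smul_comm]
    constructor
    · intro h; rw [h]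
    · intro h; exact smul_right_injective _ (mul_ne_zero ha' ha') h
  rw [this]

lemma totP_eq (hK : Fintype.card K = q ^ 2) (hs : ∀ a : K, star a = a ^ q) (n : ℕ) :
    totP K n = (guNilCommPairs q K n : ℝ) / guOrder q n := by
  have h1 := nP_orbit hK hs n
  have h2 := U_orbit hK hs n
  have h3 := I_mul_guOrder hK hs n
  have hG : (0:ℝ) < Nat.card (GL (Fin n) K) := GL_pos (K := K) (Fin n)
  have hU := guOrder_pos (two_le_q hK) n
  rw [card_PH hK hs] at h1
  set U := (Nat.card {g : GL (Fin n) K // ((g⁻¹ : GL (Fin n) K) : Matrix (Fin n) (Fin n) K)ᴴ * ((g⁻¹ : GL (Fin n) K) : Matrix (Fin n) (Fin n) K) = 1} : ℝ)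
  unfold totP
  have hI : (Nat.card (HInv K (Fin n)) : ℝ) ≠ 0 := by
    intro h; rw [h, zero_mul] at h3; exact hG.ne h3
  have hUg : U = guOrder q n := by
    apply mul_right_cancel₀ hI; rw [h2, ← h3]; ring
  rw [div_eq_div_iff hG.ne' hU.ne', ← hUg]
  linear_combination h1

end nu
end FF

namespace FF

section analysis

/-- abstract recursive system -/
structure Sys (c : ℕ → ℝ) (T : ℕ → ℕ → ℝ) : Prop where
  c0 : c 0 = 1
  cn : ∀ m, 0 ≤ c m
  cs : ∀ x : ℝ, |x| < 1 → Summable (fun m => c m * x ^ m)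
  Tn : ∀ n b, 0 ≤ T n b
  Tg : ∀ n b, n < b → T n b = 0
  T0 : T 0 0 = 1
  T1 : ∀ n, T (n+1) 0 = 0
  hrec : ∀ r b, T (r + b) b = ∑ k ∈ Finset.range (b + 1), c (b - k) * T r k

/-- generating function of the coefficients -/
noncomputable def gf (c : ℕ → ℝ) (x : ℝ) : ℝ := ∑' m, c m * x ^ m

/-- row polynomial -/
noncomputable def rowP (T : ℕ → ℕ → ℝ) (n : ℕ) (x : ℝ) : ℝ := ∑ b ∈ Finset.range (n+1), T n b * x ^ b

variable {c : ℕ → ℝ} {T : ℕ → ℕ → ℝ}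

lemma Sys.csn (h : Sys c T) {x : ℝ} (hx : |x| < 1) : Summable (fun m => ‖c m * x ^ m‖) := by
  have := h.cs |x| (by simpa using hx)
  refine this.congr ?_
  intro m
  rw [norm_mul, norm_pow, Real.norm_eq_abs, Real.norm_eq_abs, abs_of_nonneg (h.cn m)]

lemma gf_sub_one (h : Sys c T) {ρ : ℝ} (h0 : 0 ≤ ρ) (h1 : ρ < 1) :
    ∃ D : ℝ, 0 ≤ D ∧ ∀ x : ℝ, |x| ≤ ρ → |gf c x - 1| ≤ D * |x| := by
  have hρ : Summable (fun m => c m * ((1+ρ)/2) ^ m) := h.cs _ (by rw [abs_of_nonneg (by linarith)]; linarith)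
  set σ := (1+ρ)/2 with hσ
  have hσ0 : 0 < σ := by rw [hσ]; linarith
  have hs1 : Summable (fun m => c (m+1) * σ ^ m) := by
    have := ((summable_nat_add_iff 1).mpr hρ).mul_right σ⁻¹
    refine this.congr ?_
    intro m
    rw [pow_succ]; field_simp
  refine ⟨∑' m, c (m+1) * σ ^ m, tsum_nonneg fun m => mul_nonneg (h.cn _) (by positivity), ?_⟩
  intro x hx
  have hx1 : |x| < 1 := by linarith
  unfold gf
  rw [(h.cs x hx1).tsum_eq_zero_add, h.c0]
  simp only [pow_zero, mul_one, add_sub_cancel_left]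
  have hxs : ∀ m, ‖c (m+1) * x ^ (m+1)‖ ≤ c (m+1) * σ ^ m * |x| := by
    intro m
    rw [norm_mul, norm_pow, Real.norm_eq_abs, Real.norm_eq_abs, abs_of_nonneg (h.cn _), pow_succ, ← mul_assoc]
    have : |x| ^ m ≤ σ ^ m := pow_le_pow_left₀ (abs_nonneg _) (by rw [hσ]; linarith) m
    have := h.cn (m+1)
    gcongr
  rw [← tsum_mul_right]
  exact tsum_of_norm_bounded (hs1.mul_right _).hasSum hxs

lemma hasSum_row (h : Sys c T) (r : ℕ) {x : ℝ} (hx : |x| < 1) :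
    HasSum (fun b => T (r + b) b * x ^ b) (rowP T r x * gf c x) := by
  have hz : ∀ b ∉ Finset.range (r+1), T r b * x ^ b = 0 := by
    intro b hb
    rw [h.Tg r b (by simpa using hb), zero_mul]
  have h1 : HasSum (fun b => T r b * x ^ b) (rowP T r x) := hasSum_sum_of_ne_finset_zero hz
  have h1n : Summable (fun b => ‖T r b * x ^ b‖) := 
    summable_of_ne_finset_zero (s := Finset.range (r+1)) (by intro b hb; rw [hz b hb, norm_zero])
  have h2 := h.csn hx
  have h3 := tsum_mul_tsum_eq_tsum_sum_antidiagonal_of_summable_norm h1n h2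
  have h4 := (summable_norm_sum_mul_antidiagonal_of_summable_norm h1n h2).of_norm
  have h5 : ∀ b, (∑ kl ∈ Finset.HasAntidiagonal.antidiagonal b, T r kl.1 * x ^ kl.1 * (c kl.2 * x ^ kl.2)) = T (r + b) b * x ^ b := by
    intro b
    rw [h.hrec, Finset.sum_mul, Finset.Nat.sum_antidiagonal_eq_sum_range_succ_mk]
    apply Finset.sum_congr rfl
    intro k hk
    have hk' : k ≤ b := by simp at hk; omega
    have : x ^ b = x ^ k * x ^ (b - k) := by rw [← pow_add]; congr 1; omega
    rw [this]; ring
  simp only [h5] at h3 h4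
  rw [h1.tsum_eq] at h3
  unfold gf
  rw [h3]
  exact h4.hasSum

lemma shift_le (f : ℕ → ℝ) (hf : ∀ n, 0 ≤ f n) (b M : ℕ) (h0 : ∀ n < b, f n = 0) :
    ∑ n ∈ Finset.range M, f n ≤ ∑ r ∈ Finset.range M, f (r + b) := by
  calc ∑ n ∈ Finset.range M, f n ≤ ∑ n ∈ Finset.range (b + M), f n := by
        apply Finset.sum_le_sum_of_subset_of_nonneg
        · intro n hn; simp at hn ⊢; omega
        · intro n _ _; exact hf n
    _ = _ := by
        rw [Finset.sum_range_add, Finset.sum_eq_zero (by intro n hn; exact h0 n (by simpa using hn)), zero_add]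
        simp only [add_comm]

lemma rowP_ext (h : Sys c T) {n M : ℕ} (hn : n < M) (x : ℝ) : rowP T n x = ∑ b ∈ Finset.range M, T n b * x ^ b := by
  unfold rowP
  apply Finset.sum_subset
  · intro b hb; simp at hb ⊢; omega
  · intro b _ hb
    rw [h.Tg n b (by simpa using hb), zero_mul]

lemma rowP_nonneg (h : Sys c T) (n : ℕ) {x : ℝ} (hx : 0 ≤ x) : 0 ≤ rowP T n x :=
  Finset.sum_nonneg fun b _ => mul_nonneg (h.Tn _ _) (by positivity)

lemma trunc_step (h : Sys c T) {u z : ℝ} (hu0 : 0 ≤ u) (hz0 : 0 ≤ z) (huz : u * z < 1) (M : ℕ) :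
    ∑ n ∈ Finset.range M, u ^ n * rowP T n z ≤ gf c (u * z) * ∑ n ∈ Finset.range M, u ^ n * rowP T n (u * z) := by
  have hab : |u * z| < 1 := by rw [abs_of_nonneg (by positivity)]; exact huz
  calc ∑ n ∈ Finset.range M, u ^ n * rowP T n z 
      = ∑ n ∈ Finset.range M, ∑ b ∈ Finset.range M, u ^ n * (T n b * z ^ b) := by
        apply Finset.sum_congr rfl
        intro n hn
        rw [rowP_ext h (by simpa using hn), Finset.mul_sum]
    _ = ∑ b ∈ Finset.range M, ∑ n ∈ Finset.range M, u ^ n * (T n b * z ^ b) := Finset.sum_comm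
    _ ≤ ∑ b ∈ Finset.range M, ∑ r ∈ Finset.range M, u ^ (r + b) * (T (r + b) b * z ^ b) := by
        apply Finset.sum_le_sum
        intro b _
        apply shift_le (fun n => u ^ n * (T n b * z ^ b))
        · intro n; have := h.Tn n b; positivity
        · intro n hn; simp [h.Tg n b hn]
    _ = ∑ r ∈ Finset.range M, u ^ r * ∑ b ∈ Finset.range M, T (r + b) b * (u * z) ^ b := by
        rw [Finset.sum_comm]
        apply Finset.sum_congr rfl
        intro r _
        rw [Finset.mul_sum]
        apply Finset.sum_congr rfl
        intro b _
        rw [pow_add, mul_pow]; ring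
    _ ≤ ∑ r ∈ Finset.range M, u ^ r * (rowP T r (u * z) * gf c (u * z)) := by
        apply Finset.sum_le_sum
        intro r _
        apply mul_le_mul_of_nonneg_left _ (by positivity)
        apply sum_le_hasSum _ _ (hasSum_row h r hab)
        intro b _
        have := h.Tn (r+b) b
        positivity
    _ = _ := by
        rw [Finset.mul_sum]
        apply Finset.sum_congr rfl
        intro r _
        ring

lemma summable_gf (h : Sys c T) {u : ℝ} (hu : |u| < 1) : Summable (fun i : ℕ => ‖gf c (u ^ (i+1)) - 1‖) := by
  obtain ⟨D, hD, hb⟩ := gf_sub_one h (abs_nonneg u) hu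
  have hg : Summable (fun i : ℕ => D * |u| ^ (i+1)) :=
    ((summable_nat_add_iff 1).mpr (summable_geometric_of_lt_one (abs_nonneg u) hu)).mul_left D
  refine Summable.of_nonneg_of_le (fun _ => norm_nonneg _) ?_ hg
  intro i
  rw [Real.norm_eq_abs, ← abs_pow]
  apply hb
  rw [abs_pow, pow_succ]
  exact mul_le_of_le_one_left (abs_nonneg _) (pow_le_one₀ (abs_nonneg _) hu.le)

lemma multipliable_gf (h : Sys c T) {u : ℝ} (hu : |u| < 1) : Multipliable (fun i : ℕ => gf c (u ^ (i+1))) := by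
  have := multipliable_one_add_of_summable (summable_gf h hu)
  simpa using this

lemma gf_nonneg (h : Sys c T) {x : ℝ} (hx : 0 ≤ x) : 0 ≤ gf c x :=
  tsum_nonneg fun m => mul_nonneg (h.cn m) (by positivity)

lemma rowP_continuous (n : ℕ) : Continuous (rowP T n) := by
  unfold rowP; fun_prop

lemma rowP_zero (h : Sys c T) (n : ℕ) : rowP T n 0 = if n = 0 then 1 else 0 := by
  unfold rowP
  rw [Finset.sum_eq_single 0]
  · cases n with
    | zero => simp [h.T0]
    | succ n => simp [h.T1]
  · intro b _ hb; simp [hb]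
  · simp

lemma summable_rows (h : Sys c T) {u : ℝ} (hu0 : 0 ≤ u) (hu : u < 1) : Summable (fun n => u ^ n * rowP T n 1) := by
  have hab : |u| < 1 := by rwa [abs_of_nonneg hu0]
  have hm := (multipliable_gf h hab).hasProd.tendsto_prod_nat
  refine summable_of_sum_range_le (c := (∏' i : ℕ, gf c (u ^ (i+1))) * 1) 
    (fun n => mul_nonneg (by positivity) (rowP_nonneg h n zero_le_one)) ?_
  intro M
  have hN : ∀ N : ℕ, ∑ n ∈ Finset.range M, u ^ n * rowP T n 1 ≤ 
      (∏ i ∈ Finset.range N, gf c (u ^ (i+1))) * ∑ n ∈ Finset.range M, u ^ n * rowP T n (u ^ N) := by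
    intro N
    induction N with
    | zero => simp
    | succ N ih =>
      refine ih.trans ?_
      rw [Finset.prod_range_succ, mul_assoc]
      apply mul_le_mul_of_nonneg_left _ (Finset.prod_nonneg fun i _ => gf_nonneg h (by positivity))
      have := trunc_step h (u := u) (z := u ^ N) hu0 (by positivity) 
        (by have := pow_le_one₀ (n := N) hu0 hu.le; nlinarith) M
      rwa [← pow_succ'] at this
  have hlim : Filter.Tendsto (fun N : ℕ => ∑ n ∈ Finset.range M, u ^ n * rowP T n (u ^ N)) Filter.atTop 
      (nhds (∑ n ∈ Finset.range M, u ^ n * rowP T n 0)) := by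
    apply tendsto_finset_sum
    intro n _
    apply Filter.Tendsto.const_mul
    exact ((rowP_continuous n).tendsto 0).comp (tendsto_pow_atTop_nhds_zero_of_lt_one hu0 hu)
  have h1 : ∑ n ∈ Finset.range M, u ^ n * rowP T n 0 ≤ 1 := by
    simp only [rowP_zero h]
    simp only [mul_ite, mul_one, mul_zero, Finset.sum_ite_eq']
    split_ifs <;> simp
  have h2 := ge_of_tendsto' (hm.mul hlim) hN
  refine h2.trans ?_
  apply mul_le_mul_of_nonneg_left h1
  exact ge_of_tendsto' hm fun N => Finset.prod_nonneg fun i _ => gf_nonneg h (by positivity)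

lemma rowP_abs_le (h : Sys c T) (n : ℕ) {z : ℝ} (hz : |z| ≤ 1) : |rowP T n z| ≤ rowP T n 1 := by
  unfold rowP
  refine (Finset.abs_sum_le_sum_abs _ _).trans ?_
  apply Finset.sum_le_sum
  intro b _
  rw [abs_mul, abs_of_nonneg (h.Tn n b), abs_pow, one_pow]
  exact mul_le_mul_of_nonneg_left (pow_le_one₀ (abs_nonneg _) hz) (h.Tn n b)

lemma hasSum_rowP (h : Sys c T) (n : ℕ) (x : ℝ) : HasSum (fun b => T n b * x ^ b) (rowP T n x) := by
  apply hasSum_sum_of_ne_finset_zero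
  intro b hb
  rw [h.Tg n b (by simpa using hb), zero_mul]

lemma summable_pairs (h : Sys c T) {u z : ℝ} (hu : |u| < 1) (hz : |z| ≤ 1) : 
    Summable (fun p : ℕ × ℕ => u ^ p.1 * (T p.1 p.2 * z ^ p.2)) := by
  apply Summable.of_norm
  rw [summable_prod_of_nonneg (fun p => norm_nonneg _)]
  have e : ∀ n b, ‖u ^ n * (T n b * z ^ b)‖ = |u| ^ n * (T n b * |z| ^ b) := by
    intro n b
    rw [norm_mul, norm_mul, norm_pow, norm_pow, Real.norm_eq_abs, Real.norm_eq_abs, Real.norm_eq_abs, abs_of_nonneg (h.Tn n b)]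
  simp only [e]
  constructor
  · intro n
    exact ((hasSum_rowP h n |z|).mul_left _).summable
  · simp only [((hasSum_rowP h _ |z|).mul_left _).tsum_eq]
    refine Summable.of_nonneg_of_le (fun n => mul_nonneg (by positivity) (rowP_nonneg h n (abs_nonneg z))) ?_ 
      (summable_rows h (abs_nonneg u) hu)
    intro n
    apply mul_le_mul_of_nonneg_left _ (by positivity)
    exact (le_abs_self _).trans (rowP_abs_le h n (by simpa using hz))

lemma fun_eq (h : Sys c T) {u z : ℝ} (hu : |u| < 1) (hz : |z| ≤ 1) :
    ∑' n, u ^ n * rowP T n z = gf c (u * z) * ∑' n, u ^ n * rowP T n (u * z) := by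
  have huz : |u * z| < 1 := by
    rw [abs_mul]
    have := abs_nonneg u; nlinarith
  have hs := summable_pairs h hu hz
  have e1 : ∑' n, u ^ n * rowP T n z = ∑' p : ℕ × ℕ, u ^ p.1 * (T p.1 p.2 * z ^ p.2) := by
    have hf : ∀ n, HasSum (fun b => u ^ n * (T n b * z ^ b)) (u ^ n * rowP T n z) :=
      fun n => (hasSum_rowP h n z).mul_left _
    have h9 := Summable.tsum_prod' hs (fun n => (hf n).summable)
    rw [h9]
    exact tsum_congr fun n => (hf n).tsum_eq.symm
  let i : ℕ × ℕ → ℕ × ℕ := fun p => (p.1 + p.2, p.2)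
  have hi : Function.Injective i := by
    rintro ⟨a, b⟩ ⟨a', b'⟩ hh
    simp only [i, Prod.mk.injEq] at hh
    obtain ⟨h1, h2⟩ := hh
    subst h2
    simp only [Prod.mk.injEq, and_true]; omega
  have hsup : ∀ x ∉ Set.range i, u ^ x.1 * (T x.1 x.2 * z ^ x.2) = 0 := by
    rintro ⟨n, b⟩ hx
    have : n < b := by
      by_contra hh
      apply hx
      exact ⟨(n - b, b), by simp [i]; omega⟩
    simp [h.Tg n b this]
  have e2 := hi.tsum_eq (f := fun p : ℕ × ℕ => u ^ p.1 * (T p.1 p.2 * z ^ p.2)) (by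
    intro x hx
    by_contra hh
    exact hx (hsup x hh))
  have hs2 := (hi.summable_iff hsup).mpr hs
  have e3 : ∀ r b, u ^ (r + b) * (T (r + b) b * z ^ b) = u ^ r * (T (r + b) b * (u * z) ^ b) := by
    intro r b; rw [pow_add, mul_pow]; ring
  rw [e1, ← e2]
  have hs3 : Summable (fun p : ℕ × ℕ => u ^ p.1 * (T (p.1 + p.2) p.2 * (u * z) ^ p.2)) := by
    refine hs2.congr ?_
    rintro ⟨r, b⟩
    exact e3 r b
  simp only [i, e3]
  have hf : ∀ r, HasSum (fun b => u ^ r * (T (r + b) b * (u * z) ^ b)) (u ^ r * (rowP T r (u * z) * gf c (u * z))) :=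
    fun r => (hasSum_row h r huz).mul_left _
  have h9 := Summable.tsum_prod' hs3 (fun n => (hf n).summable)
  rw [h9, ← tsum_mul_left]
  refine tsum_congr fun r => ?_
  rw [(hf r).tsum_eq]
  ring

lemma summable_tot (h : Sys c T) {u : ℝ} (hu : |u| < 1) : Summable (fun n => ‖u ^ n * rowP T n 1‖) := by
  refine (summable_rows h (abs_nonneg u) hu).congr ?_
  intro n
  rw [norm_mul, norm_pow, Real.norm_eq_abs, Real.norm_eq_abs, abs_of_nonneg (rowP_nonneg h n zero_le_one)]

lemma tot_tprod (h : Sys c T) {u : ℝ} (hu : |u| < 1) :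
    ∑' n, u ^ n * rowP T n 1 = ∏' i : ℕ, gf c (u ^ (i+1)) := by
  have hm := (multipliable_gf h hu).hasProd.tendsto_prod_nat
  have hN : ∀ N : ℕ, ∑' n, u ^ n * rowP T n 1 = 
      (∏ i ∈ Finset.range N, gf c (u ^ (i+1))) * ∑' n, u ^ n * rowP T n (u ^ N) := by
    intro N
    induction N with
    | zero => simp
    | succ N ih =>
      rw [ih, Finset.prod_range_succ, mul_assoc, fun_eq h hu (by rw [abs_pow]; exact pow_le_one₀ (abs_nonneg _) hu.le), ← pow_succ']
  have hlim : Filter.Tendsto (fun N : ℕ => ∑' n, u ^ n * rowP T n (u ^ N)) Filter.atTop 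
      (nhds (∑' n, u ^ n * rowP T n 0)) := by
    refine tendsto_tsum_of_dominated_convergence (summable_rows h (abs_nonneg u) hu) ?_ ?_
    · intro n
      apply Filter.Tendsto.const_mul
      exact ((rowP_continuous n).tendsto 0).comp (tendsto_pow_atTop_nhds_zero_of_abs_lt_one hu)
    · refine Filter.Eventually.of_forall fun N n => ?_
      rw [norm_mul, norm_pow, Real.norm_eq_abs, Real.norm_eq_abs]
      apply mul_le_mul_of_nonneg_left _ (by positivity)
      apply rowP_abs_le h
      rw [abs_pow]; exact pow_le_one₀ (abs_nonneg _) hu.le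
  have h1 : ∑' n, u ^ n * rowP T n 0 = 1 := by
    simp only [rowP_zero h]
    rw [tsum_eq_single 0]
    · simp
    · intro n hn; simp [hn]
  rw [h1] at hlim
  have h2 := hm.mul hlim
  rw [mul_one] at h2
  refine tendsto_nhds_unique ?_ h2
  simp only [← hN]
  exact tendsto_const_nhds

end analysis
end FF

namespace FF

section qfun

variable {c : ℕ → ℝ} {T : ℕ → ℕ → ℝ} {t e : ℝ}

lemma t_abs_pow (ht : |t| ≤ 1/2) (m : ℕ) : |t ^ (m+1)| ≤ 1/2 := by
  rw [abs_pow, pow_succ]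
  have : |t| ^ m ≤ 1 := pow_le_one₀ (abs_nonneg _) (by linarith)
  have := abs_nonneg t
  nlinarith

lemma c_ne_zero (ht : |t| ≤ 1/2) (he : |e| ≤ 1) (c0 : c 0 = 1)
    (hr : ∀ m, (1 - t^(m+1)) * c (m+1) = (1 + e * t^(m+1)) * c m) (m : ℕ) : c m ≠ 0 := by
  induction m with
  | zero => rw [c0]; exact one_ne_zero
  | succ m ih =>
    intro h
    have h1 := hr m
    rw [h, mul_zero] at h1
    have h2 : 1 + e * t^(m+1) ≠ 0 := by
      have h3 := t_abs_pow ht m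
      have h4 : |e * t^(m+1)| ≤ 1/2 := by
        rw [abs_mul]
        have := abs_nonneg (t^(m+1)); nlinarith
      have := (abs_le.mp h4).1
      linarith
    exact (mul_ne_zero h2 ih) h1.symm

lemma c_summable (ht : |t| ≤ 1/2) (he : |e| ≤ 1) (c0 : c 0 = 1)
    (hr : ∀ m, (1 - t^(m+1)) * c (m+1) = (1 + e * t^(m+1)) * c m) (x : ℝ) (hx : |x| < 1) :
    Summable (fun m => c m * x ^ m) := by
  by_cases hx0 : x = 0
  · subst hx0
    apply summable_of_ne_finset_zero (s := {0})
    intro b hb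
    have : b ≠ 0 := by simpa using hb
    simp [this]
  have hne := c_ne_zero ht he c0 hr
  refine summable_of_ratio_test_tendsto_lt_one (l := |x|) hx 
    (Filter.Eventually.of_forall fun n => mul_ne_zero (hne n) (pow_ne_zero _ hx0)) ?_
  have hd : ∀ m, 1 - t^(m+1) ≠ 0 := by
    intro m
    have := (abs_le.mp (t_abs_pow ht m)).2
    linarith
  have hf : ∀ m, ‖c (m+1) * x^(m+1)‖ / ‖c m * x ^ m‖ = |(1 + e * t^(m+1)) / (1 - t^(m+1)) * x| := by
    intro m
    rw [← norm_div, Real.norm_eq_abs]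
    congr 1
    have h1 := hr m
    have h2 : c (m+1) = (1 + e * t^(m+1)) / (1 - t^(m+1)) * c m := by
      field_simp [hd m]
      linarith
    rw [h2, pow_succ x]
    have := hne m
    field_simp
  simp only [hf]
  have h0 : Filter.Tendsto (fun m : ℕ => t^(m+1)) Filter.atTop (nhds 0) :=
    (Filter.tendsto_add_atTop_iff_nat 1).mpr (tendsto_pow_atTop_nhds_zero_of_abs_lt_one (by linarith))
  have h1 : Filter.Tendsto (fun m : ℕ => |(1 + e * t^(m+1)) / (1 - t^(m+1)) * x|) Filter.atTop 
      (nhds |(1 + e * 0) / (1 - 0) * x|) :=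
    ((((h0.const_mul e).const_add 1).div (h0.const_sub 1) (by norm_num)).mul_const x).abs
  simpa using h1

lemma gf_fun (h : Sys c T) (ht : |t| ≤ 1/2) 
    (hr : ∀ m, (1 - t^(m+1)) * c (m+1) = (1 + e * t^(m+1)) * c m) {x : ℝ} (hx : |x| < 1) :
    (1 - x) * gf c x = (1 + e * (t * x)) * gf c (t * x) := by
  have htx : |t * x| < 1 := by
    rw [abs_mul]; have := abs_nonneg t; have := abs_nonneg x; nlinarith
  have s1 := h.cs x hx
  have s2 := h.cs (t * x) htx
  have a1 : gf c x = 1 + ∑' m, c (m+1) * x^(m+1) := by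
    unfold gf; rw [s1.tsum_eq_zero_add, h.c0]; simp
  have a2 : gf c (t*x) = 1 + ∑' m, c (m+1) * (t*x)^(m+1) := by
    unfold gf; rw [s2.tsum_eq_zero_add, h.c0]; simp
  have t1 := (summable_nat_add_iff 1).mpr s1
  have t2 := (summable_nat_add_iff 1).mpr s2
  have key : (∑' m, c (m+1) * x^(m+1)) - ∑' m, c (m+1) * (t*x)^(m+1) = x * gf c x + e * (t * x) * gf c (t * x) := by
    rw [← t1.tsum_sub t2]
    unfold gf
    rw [← tsum_mul_left, ← tsum_mul_left, ← (s1.mul_left x).tsum_add (s2.mul_left (e * (t*x)))]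
    refine tsum_congr fun m => ?_
    have := hr m
    calc c (m+1) * x^(m+1) - c (m+1) * (t*x)^(m+1) = ((1 - t^(m+1)) * c (m+1)) * x^(m+1) := by rw [mul_pow]; ring
      _ = _ := by rw [this, mul_pow]; ring
  linarith

lemma gf_tendsto (h : Sys c T) (ht : |t| ≤ 1/2) {x : ℝ} (hx : |x| < 1) :
    Filter.Tendsto (fun N : ℕ => gf c (t^N * x)) Filter.atTop (nhds 1) := by
  obtain ⟨D, hD, hb⟩ := gf_sub_one h (abs_nonneg x) hx
  have h0 : Filter.Tendsto (fun N : ℕ => D * (|t|^N * |x|)) Filter.atTop (nhds 0) := by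
    have := ((tendsto_pow_atTop_nhds_zero_of_lt_one (abs_nonneg t) (by linarith)).mul_const |x|).const_mul D
    simpa using this
  rw [tendsto_iff_norm_sub_tendsto_zero]
  refine squeeze_zero (fun _ => norm_nonneg _) ?_ h0
  intro N
  have e1 : |t^N * x| = |t|^N * |x| := by rw [abs_mul, abs_pow]
  have := hb (t^N * x) (by
    rw [e1]
    exact mul_le_of_le_one_left (abs_nonneg _) (pow_le_one₀ (abs_nonneg _) (by linarith)))
  rw [e1] at this
  exact this

lemma abs_tNx (ht : |t| ≤ 1/2) {x : ℝ} (hx : |x| < 1) (N : ℕ) : |t^N * x| < 1 := by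
  rw [abs_mul, abs_pow]
  have : |t|^N ≤ 1 := pow_le_one₀ (abs_nonneg _) (by linarith)
  have := abs_nonneg x
  have : |t|^N * |x| ≤ |x| := mul_le_of_le_one_left (abs_nonneg _) (by assumption)
  linarith

lemma abs_tNx' (ht : |t| ≤ 1/2) {x : ℝ} (hx : |x| < 1) (N : ℕ) : |t^(N+1) * x| ≤ 1/2 := by
  rw [abs_mul]
  have := t_abs_pow ht N
  have := abs_nonneg (t^(N+1))
  nlinarith

lemma one_add_tNx (ht : |t| ≤ 1/2) {x : ℝ} (hx : |x| < 1) (N : ℕ) : 1 + t^(N+1) * x ≠ 0 := by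
  have := (abs_le.mp (abs_tNx' ht hx N)).1
  linarith

lemma gf_ne_zero (h : Sys c T) (ht : |t| ≤ 1/2) 
    (hr : ∀ m, (1 - t^(m+1)) * c (m+1) = (1 + 1 * t^(m+1)) * c m) {x : ℝ} (hx : |x| < 1) : gf c x ≠ 0 := by
  intro h0
  have hN : ∀ N : ℕ, gf c (t^N * x) = 0 := by
    intro N
    induction N with
    | zero => simpa using h0
    | succ N ih =>
      have h1 := gf_fun h ht hr (abs_tNx ht hx N)
      rw [ih, mul_zero] at h1
      have h2 := one_add_tNx ht hx N
      rw [← mul_assoc t, ← pow_succ', one_mul] at h1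
      rcases mul_eq_zero.mp h1.symm with h3 | h3
      · exact absurd h3 h2
      · exact h3
  have h1 := gf_tendsto h ht hx
  simp only [hN] at h1
  exact zero_ne_one (tendsto_nhds_unique tendsto_const_nhds h1)

lemma multipliable_inv {ι : Type} (y : ι → ℝ) (hy : Summable (fun i => |y i|)) (hb : ∀ i, |y i| ≤ 1/2) :
    Multipliable (fun i => (1 + y i)⁻¹) := by
  have : Summable (fun i => ‖(1 + y i)⁻¹ - 1‖) := by
    refine Summable.of_nonneg_of_le (fun _ => norm_nonneg _) ?_ (hy.mul_left 2)
    intro i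
    have h1 := (abs_le.mp (hb i)).1
    have h2 : 0 < 1 + y i := by linarith
    have h3 : (1 + y i)⁻¹ - 1 = - y i * (1 + y i)⁻¹ := by field_simp; ring
    rw [h3, Real.norm_eq_abs, abs_mul, abs_neg, mul_comm]
    apply mul_le_mul_of_nonneg_right _ (abs_nonneg _)
    rw [abs_of_pos (by positivity), inv_le_comm₀ h2 (by norm_num)]
    linarith
  simpa using multipliable_one_add_of_summable this

lemma quot_hasProd {cQ cR : ℕ → ℝ} {TQ TR : ℕ → ℕ → ℝ} (hQ : Sys cQ TQ) (hR : Sys cR TR) (ht : |t| ≤ 1/2)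
    (hrQ : ∀ m, (1 - t^(m+1)) * cQ (m+1) = (1 + 0 * t^(m+1)) * cQ m)
    (hrR : ∀ m, (1 - t^(m+1)) * cR (m+1) = (1 + 1 * t^(m+1)) * cR m) {x : ℝ} (hx : |x| < 1) :
    HasProd (fun l : ℕ => (1 + t^(l+1) * x)⁻¹) (gf cQ x / gf cR x) := by
  have hm : Multipliable (fun l : ℕ => (1 + t^(l+1) * x)⁻¹) := by
    apply multipliable_inv
    · have : Summable (fun l : ℕ => |t|^(l+1) * |x|) :=
        ((summable_nat_add_iff 1).mpr (summable_geometric_of_lt_one (abs_nonneg t) (by linarith))).mul_right _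
      refine this.congr fun l => ?_
      rw [abs_mul, abs_pow]
    · exact abs_tNx' ht hx
  have hN : ∀ N : ℕ, gf cQ x / gf cR x = (∏ l ∈ Finset.range N, (1 + t^(l+1) * x)⁻¹) * (gf cQ (t^N * x) / gf cR (t^N * x)) := by
    intro N
    induction N with
    | zero => simp
    | succ N ih =>
      rw [ih, Finset.prod_range_succ, mul_assoc]
      congr 1
      have hy := abs_tNx ht hx N
      have h1 := gf_fun hQ ht hrQ hy
      have h2 := gf_fun hR ht hrR hy
      rw [← mul_assoc t, ← pow_succ'] at h1 h2
      rw [zero_mul, add_zero, one_mul] at h1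
      rw [one_mul] at h2
      have n1 := gf_ne_zero hR ht hrR hy
      have n2 := gf_ne_zero hR ht hrR (abs_tNx ht hx (N+1))
      have n3 := one_add_tNx ht hx N
      have n4 : 1 - t^N * x ≠ 0 := by
        have := (abs_lt.mp hy).2
        linarith
      rw [← h1]
      have h3 : gf cR (t^(N+1) * x) = (1 - t^N * x) * gf cR (t^N * x) / (1 + t^(N+1) * x) := by
        rw [h2]; field_simp
      rw [h3]
      generalize 1 + t^(N+1) * x = w at *
      generalize 1 - t^N * x = v at *
      field_simp
  have hlim := hm.hasProd.tendsto_prod_nat.mul ((gf_tendsto hQ ht hx).div (gf_tendsto hR ht hx) one_ne_zero)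
  simp only [Pi.div_apply, ← hN, div_one, mul_one] at hlim
  have := tendsto_nhds_unique tendsto_const_nhds hlim
  rw [this]
  exact hm.hasProd

lemma multipliable_double (ht : |t| ≤ 1/2) {u : ℝ} (hu : |u| < 1) :
    Multipliable (fun il : ℕ × ℕ => (1 + t^(il.2+1) * u^(il.1+1))⁻¹) := by
  apply multipliable_inv
  · have h1 : Summable (fun l : ℕ => |t|^(l+1)) :=
        ((summable_nat_add_iff 1).mpr (summable_geometric_of_lt_one (abs_nonneg t) (by linarith)))
    have h2 : Summable (fun l : ℕ => |u|^(l+1)) :=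
        ((summable_nat_add_iff 1).mpr (summable_geometric_of_lt_one (abs_nonneg u) hu))
    refine (h2.mul_of_nonneg h1 (fun _ => by positivity) (fun _ => by positivity)).congr fun l => ?_
    rw [abs_mul, abs_pow, abs_pow, mul_comm]
  · rintro ⟨i, l⟩
    exact abs_tNx' ht (x := u^(i+1)) (by rw [abs_pow]; exact pow_lt_one₀ (abs_nonneg _) hu (by omega)) l

lemma hasProd_double {cQ cR : ℕ → ℝ} {TQ TR : ℕ → ℕ → ℝ} (hQ : Sys cQ TQ) (hR : Sys cR TR) (ht : |t| ≤ 1/2)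
    (hrQ : ∀ m, (1 - t^(m+1)) * cQ (m+1) = (1 + 0 * t^(m+1)) * cQ m)
    (hrR : ∀ m, (1 - t^(m+1)) * cR (m+1) = (1 + 1 * t^(m+1)) * cR m) {u : ℝ} (hu : |u| < 1) :
    (∏' il : ℕ × ℕ, (1 + t^(il.2+1) * u^(il.1+1))⁻¹) * (∏' i : ℕ, gf cR (u^(i+1))) = ∏' i : ℕ, gf cQ (u^(i+1)) ∧
    (∏' i : ℕ, gf cR (u^(i+1))) ≠ 0 := by
  have hx : ∀ i : ℕ, |u^(i+1)| < 1 := fun i => by rw [abs_pow]; exact pow_lt_one₀ (abs_nonneg _) hu (by omega)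
  have h1 := (multipliable_double ht hu).hasProd.prod_fiberwise 
    (g := fun i => gf cQ (u^(i+1)) / gf cR (u^(i+1))) (fun i => quot_hasProd hQ hR ht hrQ hrR (hx i))
  have h2 := h1.mul (multipliable_gf hR hu).hasProd
  refine ⟨?_, ?_⟩
  · rw [← h2.tprod_eq]
    refine tprod_congr fun i => ?_
    have := gf_ne_zero hR ht hrR (hx i)
    field_simp
  · have h3 := tprod_one_add_ne_zero_of_summable (f := fun i : ℕ => gf cR (u^(i+1)) - 1) 
      (fun i => by simpa using gf_ne_zero hR ht hrR (hx i)) (summable_gf hR hu)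
    simpa using h3

end qfun

section final
variable {K : Type} [Field K] [Fintype K] [StarRing K] {q : ℕ}

lemma t_le (hK : Fintype.card K = q ^ 2) : |(-(1/(q:ℝ)))| ≤ 1/2 := by
  have h2 : (2:ℝ) ≤ q := by exact_mod_cast two_le_q hK
  rw [abs_neg, abs_of_nonneg (by positivity)]
  exact one_div_le_one_div_of_le (by norm_num) h2

lemma sysTT (hK : Fintype.card K = q ^ 2) (hs : ∀ a : K, star a = a ^ q) (f : Bool) :
    Sys (coef K q f) (TT K f) where
  c0 := coef_zero q f
  cn := coef_nonneg q f
  cs := by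
    cases f
    · exact c_summable (t := -(1/(q:ℝ))) (e := 1) (t_le hK) (by norm_num) (coef_zero q false) 
        (fun m => by rw [one_mul]; exact coef_false_step hK hs m)
    · exact c_summable (t := -(1/(q:ℝ))) (e := 0) (t_le hK) (by norm_num) (coef_zero q true) 
        (fun m => by rw [zero_mul, add_zero, one_mul]; exact coef_true_step hK hs m)
  Tn := TT_nonneg f
  Tg := TT_gt f
  T0 := TT_zero f
  T1 := TT_pos_zero f
  hrec := TT_rec hK hs f

lemma rowP_TT (f : Bool) (n : ℕ) : rowP (TT K f) n 1 = tot K f n := by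
  rw [← sum_TT]; unfold rowP; simp

theorem main_totP (hK : Fintype.card K = q ^ 2) (hs : ∀ a : K, star a = a ^ q) {u : ℝ} (hu : |u| < 1) :
    Summable (fun n : ℕ => totP K n * u ^ n) ∧
    ∑' n : ℕ, totP K n * u ^ n = ∏' il : ℕ × ℕ, (1 + (-(1/(q:ℝ)))^(il.2+1) * u^(il.1+1))⁻¹ := by
  have hQ := sysTT hK hs true
  have hR := sysTT hK hs false
  obtain ⟨h1, h2⟩ := hasProd_double hQ hR (t_le hK) 
    (fun m => by rw [zero_mul, add_zero, one_mul]; exact coef_true_step hK hs m)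
    (fun m => by rw [one_mul]; exact coef_false_step hK hs m) hu
  have sQ := summable_tot hQ hu
  have sR := summable_tot hR hu
  rw [← tot_tprod hQ hu, ← tot_tprod hR hu] at h1
  rw [← tot_tprod hR hu] at h2
  simp only [rowP_TT] at h1 h2 sQ sR
  have sP : Summable (fun n : ℕ => ‖totP K n * u ^ n‖) := by
    refine Summable.of_nonneg_of_le (fun _ => norm_nonneg _) ?_ sQ
    intro n
    rw [norm_mul, norm_mul, mul_comm]
    apply mul_le_mul_of_nonneg_left _ (norm_nonneg _)
    rw [Real.norm_eq_abs, Real.norm_eq_abs, abs_of_nonneg (totP_nonneg n), abs_of_nonneg (tot_nonneg true n)]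
    exact totP_le n
  refine ⟨sP.of_norm, ?_⟩
  have h3 := tsum_mul_tsum_eq_tsum_sum_antidiagonal_of_summable_norm sP sR
  have h4 : ∀ n, (∑ kl ∈ Finset.HasAntidiagonal.antidiagonal n, totP K kl.1 * u ^ kl.1 * (u ^ kl.2 * tot K false kl.2)) = u ^ n * tot K true n := by
    intro n
    rw [fitting_tot, Finset.mul_sum]
    apply Finset.sum_congr rfl
    intro kl hkl
    rw [← Finset.HasAntidiagonal.mem_antidiagonal.mp hkl, pow_add]
    ring
  simp only [h4] at h3
  rw [← h1] at h3
  exact mul_right_cancel₀ h2 h3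

end final

/-- the Frobenius involution -/
lemma exists_star (q : ℕ) (hq : ∃ p m : ℕ, p.Prime ∧ 0 < m ∧ q = p ^ m)
    (K : Type) [Field K] [Fintype K] (hK : Fintype.card K = q ^ 2) :
    ∃ S : StarRing K, ∀ a : K, S.star a = a ^ q := by
  obtain ⟨p, m, hp, hm, rfl⟩ := hq
  haveI : Fact p.Prime := ⟨hp⟩
  obtain ⟨p', hp'⟩ := CharP.exists K
  obtain ⟨n, hpr, hc⟩ := FiniteField.card K p'
  have hpp : p' = p := by
    have h1 : p' ∣ Fintype.card K := by rw [hc]; exact dvd_pow_self _ n.ne_zero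
    rw [hK, ← pow_mul] at h1
    exact (Nat.prime_dvd_prime_iff_eq hpr hp).mp (hpr.dvd_of_dvd_pow h1)
  subst hpp
  refine ⟨{ star := fun a => a ^ (p' ^ m), star_involutive := ?_, star_mul := ?_, star_add := ?_ }, fun a => rfl⟩
  · intro a
    show (a ^ (p' ^ m)) ^ (p' ^ m) = a
    rw [← pow_mul, ← sq, ← hK]
    exact FiniteField.pow_card a
  · intro a b
    show (a * b) ^ (p' ^ m) = b ^ (p' ^ m) * a ^ (p' ^ m)
    rw [mul_pow, mul_comm]
  · intro a b
    exact add_pow_char_pow a b p' m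

end FF

theorem feit_fine_unitary_nilpotent
    (q : ℕ) (hq : ∃ p m : ℕ, p.Prime ∧ 0 < m ∧ q = p ^ m)
    (K : Type) [Field K] [Fintype K] (hK : Fintype.card K = q ^ 2)
    (u : ℝ) (hu : |u| < 1 / q) :
    Summable (fun n : ℕ => (guNilCommPairs q K n : ℝ) * u ^ n / guOrder q n) ∧
    Multipliable (fun il : ℕ × ℕ =>
      (1 + (-1 : ℝ) ^ (il.2 + 1) * u ^ (il.1 + 1) * (q : ℝ) ^ (-(il.2 : ℤ) - 1))⁻¹) ∧
    ∑' n : ℕ, (guNilCommPairs q K n : ℝ) * u ^ n / guOrder q n =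
      ∏' il : ℕ × ℕ,
        (1 + (-1 : ℝ) ^ (il.2 + 1) * u ^ (il.1 + 1) * (q : ℝ) ^ (-(il.2 : ℤ) - 1))⁻¹ := by
  obtain ⟨S, hs⟩ := FF.exists_star q hq K hK
  letI := S
  have h2 : (2:ℝ) ≤ q := by exact_mod_cast FF.two_le_q hK
  have hu1 : |u| < 1 := by
    refine hu.trans_le ?_
    rw [div_le_one (by linarith)]
    linarith
  have e1 : ∀ n, (guNilCommPairs q K n : ℝ) * u ^ n / guOrder q n = FF.totP K n * u ^ n := by
    intro n
    rw [FF.totP_eq hK hs n]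
    ring
  have e2 : ∀ il : ℕ × ℕ, (1 + (-1 : ℝ) ^ (il.2 + 1) * u ^ (il.1 + 1) * (q : ℝ) ^ (-(il.2 : ℤ) - 1))⁻¹ =
      (1 + (-(1/(q:ℝ)))^(il.2+1) * u^(il.1+1))⁻¹ := by
    intro il
    have h3 : (q:ℝ) ^ (-(il.2 : ℤ) - 1) = (1/(q:ℝ))^(il.2+1) := by
      rw [one_div, inv_pow, ← zpow_natCast, ← _root_.zpow_neg]
      congr 1
      push_cast
      ring
    have h4 : (-(1/(q:ℝ)))^(il.2+1) = (-1)^(il.2+1) * (1/(q:ℝ))^(il.2+1) := neg_pow _ _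
    rw [h3, h4]
    congr 2
    ring
  simp only [e1, e2]
  obtain ⟨h3, h4⟩ := FF.main_totP hK hs hu1
  exact ⟨h3, FF.multipliable_double (FF.t_le hK) hu1, h4⟩
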